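/- Let D be a parallel slit half-plane and (F_t)_{t∈[0,T]} a strictly increasing family of bounded ℍ-hulls contained in D whose closures are disjoint from the slits of D, with mapping-out functions g_t : D ∖ F_t → D_t as in the context. Then the following are equivalent: (P.1) (F_t)_{t∈[0,T]} has the local growth property; (P.3) there exists a continuous function ξ : [0,T] → ℝ such that ⋂_{δ>0} closure(g_t(F_{t+δ} ∖ F_t)) = {ξ(t)} for every t ∈ [0,T), and (F_t)_{t∈[0,T]} is left continuous in Carathéodory's sense at every t₀ ∈ (0,T]. -/

import Mathlib

open Complex Set Filter Topology Bornology MeasureTheory Metric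

noncomputable section

/-- The upper half-plane `ℍ = {z : ℂ | 0 < Im z}`. -/
def UHP : Set ℂ := {z : ℂ | 0 < z.im}

/-- The half-plane `ℍ_η = {z : ℂ | η < Im z}`. -/
def HP (η : ℝ) : Set ℂ := {z : ℂ | η < z.im}

/-- The sector `△_θ = {z : ℂ | θ < arg z < π - θ}`. -/
def Sector (θ : ℝ) : Set ℂ :=
  {z : ℂ | θ < Complex.arg z ∧ Complex.arg z < Real.pi - θ}

/-- A closed horizontal line segment of positive length contained in `ℍ`. -/
def IsHorizontalSlit (C : Set ℂ) : Prop :=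
  ∃ y xl xr : ℝ, 0 < y ∧ xl < xr ∧
    C = {z : ℂ | z.im = y ∧ z.re ∈ Set.Icc xl xr}

/-- A parallel slit half-plane with `N` slits: `ℍ` minus `N` pairwise disjoint
closed horizontal segments of positive length. -/
def IsParallelSlitHalfPlaneN (N : ℕ) (D : Set ℂ) : Prop :=
  ∃ C : Fin N → Set ℂ,
    (∀ j, IsHorizontalSlit (C j)) ∧
    (Pairwise fun i j => Disjoint (C i) (C j)) ∧
    D = UHP \ ⋃ j, C j

/-- A parallel slit half-plane (with some number of slits). -/
def IsParallelSlitHalfPlane (D : Set ℂ) : Prop :=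
  ∃ N : ℕ, IsParallelSlitHalfPlaneN N D

/-- (H.1): hydrodynamic normalization at infinity. -/
def SatisfiesH1 (D : Set ℂ) (f : ℂ → ℂ) : Prop :=
  ∃ η : ℝ, 0 ≤ η ∧ HP η ⊆ D ∧
    Tendsto (fun z => f z - z) (cobounded ℂ ⊓ 𝓟 (HP η)) (𝓝 0)

/-- (H.2): `f` has angular residue `c` at infinity, i.e. `z (f z - z) → -c`
as `z → ∞` within every sector `△_θ`. -/
def SatisfiesH2 (f : ℂ → ℂ) (c : ℂ) : Prop :=
  ∀ θ : ℝ, 0 < θ → θ < Real.pi / 2 →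
    Tendsto (fun z => z * (f z - z)) (cobounded ℂ ⊓ 𝓟 (Sector θ)) (𝓝 (-c))

/-- `F` is an ℍ-hull: relatively closed in `ℍ` with `ℍ \ F` a simply connected
domain. -/
def IsHHull (F : Set ℂ) : Prop :=
  F ⊆ UHP ∧ closure F ∩ UHP ⊆ F ∧
    IsConnected (UHP \ F) ∧ SimplyConnectedSpace ↥(UHP \ F)

/-- `η_D = min {Im w | w ∈ ℍ \ D}`. -/
def etaD (D : Set ℂ) : ℝ := sInf (Complex.im '' (UHP \ D))

/-- A (chordal) evolution family `φ t s : D s → D t` (for `s ≤ t` in `I`) over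
parallel slit half-planes `D t`, where `lam t` is the angular residue of
`φ t 0` at infinity. -/
structure IsEvolutionFamily (I : Set ℝ) (D : ℝ → Set ℂ)
    (φ : ℝ → ℝ → ℂ → ℂ) (lam : ℝ → ℂ) : Prop where
  slit : ∀ t ∈ I, IsParallelSlitHalfPlane (D t)
  mapsTo : ∀ s ∈ I, ∀ t ∈ I, s ≤ t → Set.MapsTo (φ t s) (D s) (D t)
  holo : ∀ s ∈ I, ∀ t ∈ I, s ≤ t → DifferentiableOn ℂ (φ t s) (D s)
  inj : ∀ s ∈ I, ∀ t ∈ I, s ≤ t → Set.InjOn (φ t s) (D s)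
  h1 : ∀ s ∈ I, ∀ t ∈ I, s ≤ t → SatisfiesH1 (D s) (φ t s)
  h2 : ∀ s ∈ I, ∀ t ∈ I, s ≤ t → ∃ c : ℂ, SatisfiesH2 (φ t s) c
  h3 : ∀ s ∈ I, ∀ t ∈ I, s ≤ t → IsHHull (D t \ φ t s '' D s)
  ef1 : ∀ t ∈ I, Set.EqOn (φ t t) id (D t)
  ef2 : ∀ s ∈ I, ∀ t ∈ I, ∀ u ∈ I, s ≤ t → t ≤ u →
    ∀ z ∈ D s, φ u s z = φ u t (φ t s z)
  lam_res : ∀ t ∈ I, SatisfiesH2 (φ t 0) (lam t)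
  ef3 : ContinuousOn lam I

/-- A (chordal) Loewner chain `f t : D t → Dcod` over parallel slit
half-planes `D t` with codomain `Dcod`, where `ell t` is the angular residue
of `f t` at infinity. -/
structure IsLoewnerChain (I : Set ℝ) (D : ℝ → Set ℂ) (Dcod : Set ℂ)
    (f : ℝ → ℂ → ℂ) (ell : ℝ → ℂ) : Prop where
  slit : ∀ t ∈ I, IsParallelSlitHalfPlane (D t)
  slitcod : IsParallelSlitHalfPlane Dcod
  mapsTo : ∀ t ∈ I, Set.MapsTo (f t) (D t) Dcod
  holo : ∀ t ∈ I, DifferentiableOn ℂ (f t) (D t)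
  inj : ∀ t ∈ I, Set.InjOn (f t) (D t)
  h1 : ∀ t ∈ I, SatisfiesH1 (D t) (f t)
  h2 : ∀ t ∈ I, SatisfiesH2 (f t) (ell t)
  h3 : ∀ t ∈ I, IsHHull (Dcod \ f t '' D t)
  lc1 : ∀ s ∈ I, ∀ t ∈ I, s ≤ t → f s '' D s ⊆ f t '' D t
  lc2 : ContinuousOn ell I

/-- `(Lip)_μ`: Lipschitz continuity of `t ↦ f t` w.r.t. the measure `μ`,
uniformly on compact subsets of `D`. -/
def SatisfiesLip (I : Set ℝ) (μ : Measure ℝ) (D : Set ℂ)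
    (f : ℝ → ℂ → ℂ) : Prop :=
  ∀ K : Set ℂ, K ⊆ D → IsCompact K → ∃ L : ℝ,
    ∀ s ∈ I, ∀ t ∈ I, s ≤ t → ∀ z ∈ K,
      ‖f t z - f s z‖ ≤ L * (μ (Set.Ioc s t)).toReal

/-- `(AC)_μ`: absolute continuity of `t ↦ f t` w.r.t. the measure `μ`,
uniformly on compact subsets of `D`. -/
def SatisfiesAC (I : Set ℝ) (μ : Measure ℝ) (D : Set ℂ)
    (f : ℝ → ℂ → ℂ) : Prop :=
  ∀ K : Set ℂ, K ⊆ D → IsCompact K →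
    ∃ ν : Measure ℝ, ν ≪ μ ∧
      (∀ a ∈ I, ∀ b ∈ I, ν (Set.Icc a b) < ⊤) ∧
      ∀ s ∈ I, ∀ t ∈ I, s ≤ t → ∀ z ∈ K,
        ‖f t z - f s z‖ ≤ (ν (Set.Ioc s t)).toReal

/-- The symmetric difference quotient
`(f (t+δ) z - f (t-δ) z) / μ((t-δ, t+δ))`. -/
def symmQuot (μ : Measure ℝ) (f : ℝ → ℂ → ℂ) (t δ : ℝ) (z : ℂ) : ℂ :=
  (f (t + δ) z - f (t - δ) z) / ((μ (Set.Ioo (t - δ) (t + δ))).toReal : ℂ)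

/-- A cross-cut of a domain `G`. -/
def IsCrossCut (G C : Set ℂ) : Prop :=
  ∃ c : ℝ → ℂ, ContinuousOn c (Set.Icc 0 1) ∧ Set.InjOn c (Set.Icc 0 1) ∧
    c 0 ∈ frontier G ∧ c 1 ∈ frontier G ∧ c '' Set.Ioo 0 1 ⊆ G ∧
    C = c '' Set.Icc 0 1

/-- `C` separates `S` from `∞` in `G`: `S` is disjoint from the unbounded
connected component of `G \ C`. -/
def SeparatesFromInfty (G C S : Set ℂ) : Prop :=
  ∀ z ∈ S ∩ (G \ C), Bornology.IsBounded (connectedComponentIn (G \ C) z)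

/-- The local growth property of a family of hulls `(F t)_{t ∈ [0,T]}` in `D`. -/
def LocalGrowth (T : ℝ) (D : Set ℂ) (F : ℝ → Set ℂ) : Prop :=
  ∀ ε : ℝ, 0 < ε → ∃ δ ∈ Set.Ioo 0 T, ∀ t ∈ Set.Icc 0 (T - δ),
    ∃ C : Set ℂ, IsCrossCut (D \ F t) C ∧ Metric.diam C < ε ∧
      SeparatesFromInfty (D \ F t) C (F (t + δ) \ F t)

/-- Carathéodory kernel of a sequence of domains w.r.t. the point `a`. -/
def kernelAt (a : ℂ) (G : ℕ → Set ℂ) : Set ℂ :=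
  connectedComponentIn
    {z : ℂ | ∃ r > 0, ∃ N : ℕ, ∀ n ≥ N, Metric.ball z r ⊆ G n} a

/-- Left continuity in Carathéodory's sense of `(F t)` at `t₀`. -/
def CaratheodoryLeftContinuousAt (D : Set ℂ) (F : ℝ → Set ℂ)
    (T t₀ : ℝ) : Prop :=
  ∀ a ∈ D \ F T, ∀ s : ℕ → ℝ,
    Monotone s → (∀ n, s n ∈ Set.Ico 0 t₀) → Tendsto s atTop (𝓝 t₀) →
      kernelAt a (fun n => D \ F (s n)) = D \ F t₀

namespace SlitLoewner

/-! ### Rectangular neighbourhoods of slits -/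

/-- A rectangular gauge of the distance of `z` to the segment `[a, b] × {y}`; it vanishes
exactly on the segment. -/
def slitGauge (a b y : ℝ) (z : ℂ) : ℝ := max |z.im - y| (max (a - z.re) (z.re - b))

/-- The segment `[a, b] × {y}`. -/
def slit (a b y : ℝ) : Set ℂ := {z : ℂ | z.im = y ∧ z.re ∈ Set.Icc a b}

/-- The open rectangular neighbourhood of a slit with the slit removed. -/
def slitRing (a b y e : ℝ) : Set ℂ := {z | 0 < slitGauge a b y z ∧ slitGauge a b y z < e}

lemma continuous_slitGauge (a b y : ℝ) : Continuous (slitGauge a b y) := by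
  unfold slitGauge; fun_prop

lemma slitGauge_lt_iff {a b y e : ℝ} {z : ℂ} : slitGauge a b y z < e ↔
    (y - e < z.im ∧ z.im < y + e) ∧ a - e < z.re ∧ z.re < b + e := by
  simp only [slitGauge, max_lt_iff, abs_lt]
  constructor <;> rintro ⟨⟨_, _⟩, _, _⟩ <;> refine ⟨⟨?_, ?_⟩, ?_, ?_⟩ <;> linarith

lemma slitGauge_le_iff {a b y e : ℝ} {z : ℂ} : slitGauge a b y z ≤ e ↔
    (y - e ≤ z.im ∧ z.im ≤ y + e) ∧ a - e ≤ z.re ∧ z.re ≤ b + e := by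
  simp only [slitGauge, max_le_iff, abs_le]
  constructor <;> rintro ⟨⟨_, _⟩, _, _⟩ <;> refine ⟨⟨?_, ?_⟩, ?_, ?_⟩ <;> linarith

lemma mem_slit_iff {a b y : ℝ} {z : ℂ} : z ∈ slit a b y ↔ slitGauge a b y z ≤ 0 := by
  rw [slitGauge_le_iff]
  simp only [slit, mem_ofPred_eq, mem_Icc]
  constructor
  · rintro ⟨_, _, _⟩; refine ⟨⟨?_, ?_⟩, ?_, ?_⟩ <;> linarith
  · rintro ⟨⟨_, _⟩, _, _⟩; refine ⟨?_, ?_, ?_⟩ <;> linarith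

lemma slitGauge_pos_iff {a b y : ℝ} {z : ℂ} : 0 < slitGauge a b y z ↔ z ∉ slit a b y := by
  rw [mem_slit_iff, not_le]

lemma isBounded_slitGauge_le (a b y e : ℝ) : IsBounded {z | slitGauge a b y z ≤ e} := by
  refine (Bornology.IsBounded.reProdIm (isBounded_Icc (a - e) (b + e))
    (isBounded_Icc (y - e) (y + e))).subset ?_
  intro z hz
  rw [mem_ofPred_eq, slitGauge_le_iff] at hz
  exact mem_reProdIm.2 ⟨hz.2, hz.1⟩

lemma isCompact_slitGauge_le (a b y e : ℝ) : IsCompact {z | slitGauge a b y z ≤ e} :=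
  Metric.isCompact_of_isClosed_isBounded
    (isClosed_le (continuous_slitGauge a b y) continuous_const) (isBounded_slitGauge_le a b y e)

lemma isCompact_slit (a b y : ℝ) : IsCompact (slit a b y) := by
  have : slit a b y = {z | slitGauge a b y z ≤ 0} := by ext; exact mem_slit_iff
  rw [this]; exact isCompact_slitGauge_le a b y 0

lemma isOpen_slitGauge_lt (a b y e : ℝ) : IsOpen {z | slitGauge a b y z < e} :=
  isOpen_lt (continuous_slitGauge a b y) continuous_const

lemma isOpen_slitRing (a b y e : ℝ) : IsOpen (slitRing a b y e) :=
  (isOpen_lt continuous_const (continuous_slitGauge a b y)).inter (isOpen_slitGauge_lt a b y e)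

/-- Open coordinate rectangles. -/
lemma convex_box (a b c d : ℝ) : Convex ℝ {z : ℂ | (a < z.re ∧ z.re < b) ∧ c < z.im ∧ z.im < d} :=
  ((convex_Ioo a b).linear_preimage Complex.reLm).inter
    ((convex_Ioo c d).linear_preimage Complex.imLm)

lemma convex_slitGauge_lt (a b y e : ℝ) : Convex ℝ {z | slitGauge a b y z < e} := by
  have : {z | slitGauge a b y z < e} =
      {z : ℂ | (a - e < z.re ∧ z.re < b + e) ∧ y - e < z.im ∧ z.im < y + e} := by
    ext z; rw [mem_ofPred_eq, slitGauge_lt_iff, mem_ofPred_eq, and_comm]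
  rw [this]; exact convex_box _ _ _ _

/-- The complement of a closed rectangle in a larger open rectangle. -/
lemma isPreconnected_frame {a b c d a' b' c' d' : ℝ} (h1 : a < a') (h2 : a' ≤ b') (h3 : b' < b)
    (h4 : c < c') (h5 : c' ≤ d') (h6 : d' < d) :
    IsPreconnected {z : ℂ | ((a < z.re ∧ z.re < b) ∧ c < z.im ∧ z.im < d) ∧
      (z.re < a' ∨ b' < z.re ∨ z.im < c' ∨ d' < z.im)} := by
  have hU := (convex_box a b d' d).isPreconnected
  have hR := (convex_box b' b c d).isPreconnected
  have hD := (convex_box a b c c').isPreconnected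
  have hL := (convex_box a a' c d).isPreconnected
  have h := ((hU.union' ⟨⟨(b + b') / 2, (d + d') / 2⟩, ?_⟩ hR).union'
    ⟨⟨(b + b') / 2, (c + c') / 2⟩, ?_⟩ hD).union' ⟨⟨(a + a') / 2, (c + c') / 2⟩, ?_⟩ hL
  · convert h using 1
    ext z
    simp only [mem_ofPred_eq, mem_union]
    clear h hU hR hD hL
    generalize z.re = u, z.im = v
    grind
  all_goals simp only [mem_inter_iff, mem_ofPred_eq, mem_union]; clear hU hR hD hL; grind

lemma isPreconnected_slitRing {a b y e : ℝ} (hab : a ≤ b) : IsPreconnected (slitRing a b y e) := by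
  rcases le_or_gt e 0 with he | he
  · have : slitRing a b y e = ∅ := by
      ext z; simp only [slitRing, mem_ofPred_eq, mem_empty_iff_false, iff_false]; intro h; linarith [h.1, h.2]
    rw [this]; exact isPreconnected_empty
  have h := isPreconnected_frame (a := a - e) (b := b + e) (c := y - e) (d := y + e)
    (a' := a) (b' := b) (c' := y) (d' := y) (by linarith) hab (by linarith) (by linarith) le_rfl
    (by linarith)
  convert h using 1
  ext z
  simp only [slitRing, mem_ofPred_eq, slitGauge_lt_iff, slitGauge_pos_iff, slit, mem_Icc]
  try clear h
  grind

lemma mem_slitRing {a b y e : ℝ} (hab : a ≤ b) (he : 0 < e) :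
    (⟨b + e / 2, y⟩ : ℂ) ∈ slitRing a b y e := by
  simp only [slitRing, mem_ofPred_eq, slitGauge_lt_iff, slitGauge_pos_iff, slit, mem_Icc]
  grind

lemma isLocallyInjective_exp : IsLocallyInjective Complex.exp := by
  intro z
  refine ⟨{w | z.im - Real.pi < w.im ∧ w.im < z.im + Real.pi}, ?_, ?_, ?_⟩
  · exact (isOpen_lt continuous_const continuous_im).inter
      (isOpen_lt continuous_im continuous_const)
  · have := Real.pi_pos
    constructor <;> linarith
  · rintro u ⟨hu1, hu2⟩ v ⟨hv1, hv2⟩ h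
    have hs : Complex.exp (u - z.im * I) = Complex.exp (v - z.im * I) := by
      rw [Complex.exp_sub, Complex.exp_sub, h]
    have := Complex.exp_inj_of_neg_pi_lt_of_le_pi (x := u - z.im * I) (y := v - z.im * I)
      (by simp; linarith) (by simp; linarith) (by simp; linarith) (by simp; linarith) hs
    simpa using this

/-- There is no continuous logarithm of `w - p` on a punctured rectangular neighbourhood of a
slit containing `p`. -/
lemma not_continuous_log_slitRing {a b y e : ℝ} {p : ℂ} (he : 0 < e) (hp : p ∈ slit a b y)
    {l : ℂ → ℂ} (hl : ContinuousOn l (slitRing a b y e))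
    (hexp : ∀ w ∈ slitRing a b y e, Complex.exp (l w) = w - p) : False := by
  obtain ⟨hpy, hpa, hpb⟩ := hp
  -- the slit plane part of the ring
  set X : Set ℂ := {z : ℂ | z ∈ slitRing a b y e ∧ (a ≤ z.re ∨ z.im ≠ y)} with hX
  have hXpre : IsPreconnected X := by
    have hU := (convex_box (a - e) (b + e) y (y + e)).isPreconnected
    have hR := (convex_box b (b + e) (y - e) (y + e)).isPreconnected
    have hD := (convex_box (a - e) (b + e) (y - e) y).isPreconnected
    have h := (hU.union' ⟨⟨b + e / 2, y + e / 2⟩, ?_⟩ hR).union'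
      ⟨⟨b + e / 2, y - e / 2⟩, ?_⟩ hD
    · convert h using 1
      ext z
      simp only [hX, slitRing, mem_ofPred_eq, slitGauge_lt_iff, slitGauge_pos_iff, slit, mem_Icc,
        mem_union]
      clear h hU hR hD
      generalize z.re = u, z.im = v
      grind
    all_goals simp only [mem_inter_iff, mem_ofPred_eq, mem_union]; clear hU hR hD; grind
  have hXsub : X ⊆ slitRing a b y e := fun z hz => hz.1
  have hXs : ∀ z ∈ X, z - p ∈ slitPlane := by
    rintro z ⟨⟨h1, h2⟩, h3⟩
    rw [slitGauge_pos_iff] at h1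
    rw [slitGauge_lt_iff] at h2
    rw [mem_slitPlane_iff]
    simp only [slit, mem_ofPred_eq, mem_Icc, not_and, not_le] at h1
    simp only [sub_re, sub_im, hpy]
    by_cases hy : z.im = y
    · left
      have := h1 hy
      grind
    · right; exact sub_ne_zero.2 hy
  set q : ℂ := ⟨b + e / 2, y⟩ with hq
  have hqX : q ∈ X := by
    simp only [hX, slitRing, mem_ofPred_eq, slitGauge_lt_iff, slitGauge_pos_iff, slit, mem_Icc, hq]
    grind
  have hEq : EqOn l (fun w => Complex.log (w - p) + (l q - Complex.log (q - p))) X := by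
    refine (T2Space.isSeparatedMap Complex.exp).eqOn_of_comp_eqOn isLocallyInjective_exp hXpre
      (hl.mono hXsub) ?_ ?_ hqX ?_
    · exact ContinuousOn.add (fun z hz => (ContinuousAt.clog
        (f := fun w => w - p) (by fun_prop) (hXs z hz)).continuousWithinAt) continuousOn_const
    · intro z hz
      have hz0 : z - p ≠ 0 := slitPlane_ne_zero (hXs z hz)
      have hq0 : q - p ≠ 0 := slitPlane_ne_zero (hXs q hqX)
      simp only [Function.comp]
      rw [hexp z (hXsub hz), Complex.exp_add, Complex.exp_sub, hexp q (hXsub hqX),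
        Complex.exp_log hz0, Complex.exp_log hq0, div_self hq0, mul_one]
    · simp
  -- the point on the left, where the logarithm jumps
  set o : ℂ := ⟨a - e / 2, y⟩ with ho
  have hoR : o ∈ slitRing a b y e := by
    simp only [slitRing, mem_ofPred_eq, slitGauge_lt_iff, slitGauge_pos_iff, slit, mem_Icc, ho]
    grind
  have hor : (o - p).re < 0 := by simp [ho]; linarith
  have hoi : (o - p).im = 0 := by simp [ho, hpy]
  have hlo : Tendsto l (𝓝 o) (𝓝 (l o)) :=
    (hl.continuousAt ((isOpen_slitRing a b y e).mem_nhds hoR)).tendsto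
  have hup : Tendsto (fun s : ℝ => o + s * I) (𝓝[>] 0) (𝓝 o) := by
    have : Continuous (fun s : ℝ => o + s * I) := by fun_prop
    simpa using (this.tendsto 0).mono_left nhdsWithin_le_nhds
  have hdn : Tendsto (fun s : ℝ => o - s * I) (𝓝[>] 0) (𝓝 o) := by
    have : Continuous (fun s : ℝ => o - s * I) := by fun_prop
    simpa using (this.tendsto 0).mono_left nhdsWithin_le_nhds
  have hupX : ∀ᶠ s : ℝ in 𝓝[>] 0, o + s * I ∈ X := by
    filter_upwards [hup ((isOpen_slitRing a b y e).mem_nhds hoR), self_mem_nhdsWithin] with s hs h0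
    exact ⟨hs, Or.inr (by simp [ho]; exact ne_of_gt h0)⟩
  have hdnX : ∀ᶠ s : ℝ in 𝓝[>] 0, o - s * I ∈ X := by
    filter_upwards [hdn ((isOpen_slitRing a b y e).mem_nhds hoR), self_mem_nhdsWithin] with s hs h0
    exact ⟨hs, Or.inr (by simp [ho]; exact ne_of_gt h0)⟩
  have hlu : Tendsto (fun s : ℝ => Complex.log (o + s * I - p)) (𝓝[>] 0)
      (𝓝 (Real.log ‖o - p‖ + Real.pi * I)) := by
    refine (tendsto_log_nhdsWithin_im_nonneg_of_re_neg_of_im_zero hor hoi).comp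
      (tendsto_nhdsWithin_iff.2 ⟨hup.sub_const p, ?_⟩)
    filter_upwards [self_mem_nhdsWithin] with s hs
    have h0 : (0:ℝ) < s := hs
    show 0 ≤ (o + s * I - p).im
    have : (o + s * I - p).im = s := by
      have : (o + s * I - p).im = (o - p).im + s := by simp; ring
      rw [this, hoi, zero_add]
    rw [this]; exact le_of_lt h0
  have hld : Tendsto (fun s : ℝ => Complex.log (o - s * I - p)) (𝓝[>] 0)
      (𝓝 (Real.log ‖o - p‖ - Real.pi * I)) := by
    refine (tendsto_log_nhdsWithin_im_neg_of_re_neg_of_im_zero hor hoi).comp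
      (tendsto_nhdsWithin_iff.2 ⟨hdn.sub_const p, ?_⟩)
    filter_upwards [self_mem_nhdsWithin] with s hs
    have h0 : (0:ℝ) < s := hs
    show (o - s * I - p).im < 0
    have : (o - s * I - p).im = -s := by
      have : (o - s * I - p).im = (o - p).im - s := by simp; ring
      rw [this, hoi, zero_sub]
    rw [this]; linarith
  have e1 := tendsto_nhds_unique (hlo.comp hup) (((hlu.add_const
    (l q - Complex.log (q - p))).congr' (by
      filter_upwards [hupX] with s hs using (hEq hs).symm)))
  have e2 := tendsto_nhds_unique (hlo.comp hdn) (((hld.add_const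
    (l q - Complex.log (q - p))).congr' (by
      filter_upwards [hdnX] with s hs using (hEq hs).symm)))
  have e3 := congrArg Complex.im (e1.symm.trans e2)
  have := Real.pi_pos
  simp at e3
  linarith

end SlitLoewner

namespace SlitLoewner

/-! ### Slit half-planes -/

lemma isOpen_UHP : IsOpen UHP := isOpen_lt continuous_const continuous_im

lemma mem_UHP {z : ℂ} : z ∈ UHP ↔ 0 < z.im := Iff.rfl

lemma convex_UHP : Convex ℝ UHP := convex_halfSpace_im_gt 0

/-- A finite system of pairwise disjoint horizontal slits in the upper half-plane. -/
structure SlitSys where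
  n : ℕ
  a : Fin n → ℝ
  b : Fin n → ℝ
  y : Fin n → ℝ
  y_pos : ∀ j, 0 < y j
  a_lt_b : ∀ j, a j < b j
  disj : Pairwise fun i j => Disjoint (slit (a i) (b i) (y i)) (slit (a j) (b j) (y j))

namespace SlitSys

variable (S : SlitSys)

/-- The gauge of the `j`-th slit. -/
abbrev gauge (j : Fin S.n) : ℂ → ℝ := slitGauge (S.a j) (S.b j) (S.y j)

/-- The `j`-th slit. -/
abbrev seg (j : Fin S.n) : Set ℂ := slit (S.a j) (S.b j) (S.y j)

/-- The punctured neighbourhood of the `j`-th slit. -/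
abbrev ring (j : Fin S.n) (e : ℝ) : Set ℂ := slitRing (S.a j) (S.b j) (S.y j) e

/-- The union of the slits. -/
def set : Set ℂ := ⋃ j, S.seg j

/-- The slit half-plane. -/
def dom : Set ℂ := UHP \ S.set

lemma seg_subset_set (j : Fin S.n) : S.seg j ⊆ S.set := subset_iUnion S.seg j

lemma mem_set {z : ℂ} : z ∈ S.set ↔ ∃ j, z ∈ S.seg j := mem_iUnion

lemma isCompact_set : IsCompact S.set := isCompact_iUnion fun _ => isCompact_slit _ _ _

lemma set_subset_UHP : S.set ⊆ UHP := by
  intro z hz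
  obtain ⟨j, hj⟩ := S.mem_set.1 hz
  have := S.y_pos j
  rw [mem_UHP, hj.1]; exact this

lemma isOpen_dom : IsOpen S.dom := isOpen_UHP.sdiff S.isCompact_set.isClosed

lemma im_pos {z : ℂ} (hz : z ∈ S.dom) : 0 < z.im := hz.1

end SlitSys

/-- A closed set missing a slit stays at positive gauge from it. -/
lemma exists_lt_slitGauge {a b y : ℝ} {K : Set ℂ} (hK : IsClosed K)
    (h : Disjoint K (slit a b y)) : ∃ e > 0, ∀ z ∈ K, e < slitGauge a b y z := by
  have hc : IsCompact (K ∩ {z | slitGauge a b y z ≤ 1}) :=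
    (isCompact_slitGauge_le a b y 1).inter_left hK
  rcases (K ∩ {z | slitGauge a b y z ≤ 1}).eq_empty_or_nonempty with he | hne
  · refine ⟨1, one_pos, fun z hz => ?_⟩
    by_contra hle
    have : z ∈ K ∩ {z | slitGauge a b y z ≤ 1} := ⟨hz, not_lt.1 hle⟩
    rw [he] at this; exact this
  · obtain ⟨z0, hz0, hmin⟩ := hc.exists_isMinOn hne (continuous_slitGauge a b y).continuousOn
    have hpos : 0 < slitGauge a b y z0 :=
      slitGauge_pos_iff.2 (disjoint_left.1 h hz0.1)
    refine ⟨min (slitGauge a b y z0 / 2) (1 / 2), by positivity, fun z hz => ?_⟩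
    by_cases hle : slitGauge a b y z ≤ 1
    · have : slitGauge a b y z0 ≤ slitGauge a b y z := hmin ⟨hz, hle⟩
      exact (min_le_left _ _).trans_lt (by linarith)
    · exact (min_le_right _ _).trans_lt (by linarith)

/-- Neighbourhoods of a slit shrink to it. -/
lemma exists_slitGauge_subset {a b y : ℝ} {U : Set ℂ} (hU : IsOpen U) (h : slit a b y ⊆ U) :
    ∃ e > 0, ∀ z, slitGauge a b y z ≤ e → z ∈ U := by
  obtain ⟨e, he, h⟩ := exists_lt_slitGauge (a := a) (b := b) (y := y) hU.isClosed_compl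
    (disjoint_left.2 fun z hz hz' => hz (h hz'))
  exact ⟨e, he, fun z hz => by_contra fun hn => absurd (h z hn) (not_lt.2 hz)⟩

lemma exists_pos_forall_lt_of_finite {ι : Type*} [Finite ι] {P : ι → ℝ → Prop}
    (hP : ∀ i, ∃ e > 0, ∀ e', 0 < e' → e' ≤ e → P i e') :
    ∃ e > 0, ∀ e', 0 < e' → e' ≤ e → ∀ i, P i e' := by
  cases nonempty_fintype ι
  choose e he h using hP
  rcases isEmpty_or_nonempty ι with hι | hι
  · exact ⟨1, one_pos, fun _ _ _ i => (hι.false i).elim⟩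
  · refine ⟨Finset.univ.inf' Finset.univ_nonempty e, ?_, fun e' h0 h1 i => h i e' h0 ?_⟩
    · exact (Finset.lt_inf'_iff _).2 fun i _ => he i
    · exact h1.trans (Finset.inf'_le _ (Finset.mem_univ i))

namespace SlitSys

variable (S : SlitSys)

/-- Closed rectangular neighbourhoods of different slits are disjoint when they are thin. -/
lemma exists_disjoint_gauge : ∃ e > 0, ∀ i j, i ≠ j → ∀ z, S.gauge i z ≤ e → e < S.gauge j z := by
  have key : ∀ p : Fin S.n × Fin S.n, ∃ e > 0, ∀ e', 0 < e' → e' ≤ e →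
      (p.1 ≠ p.2 → ∀ z, S.gauge p.1 z ≤ e' → e' < S.gauge p.2 z) := by
    rintro ⟨i, j⟩
    by_cases hij : i = j
    · exact ⟨1, one_pos, fun _ _ _ h => (h hij).elim⟩
    have hopen : IsOpen (S.seg j)ᶜ := (isCompact_slit _ _ _).isClosed.isOpen_compl
    obtain ⟨e1, he1, h1⟩ := exists_slitGauge_subset (a := S.a i) (b := S.b i) (y := S.y i) hopen
      (fun z hz hz' => disjoint_left.1 (S.disj hij) hz hz')
    obtain ⟨e2, he2, h2⟩ := exists_lt_slitGauge (a := S.a j) (b := S.b j) (y := S.y j)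
      (K := {z | S.gauge i z ≤ e1}) (isCompact_slitGauge_le _ _ _ _).isClosed
      (disjoint_left.2 fun z hz => h1 z hz)
    refine ⟨min e1 e2, lt_min he1 he2, fun e' _ h _ z hz => ?_⟩
    exact (h.trans (min_le_right _ _)).trans_lt (h2 z (hz.trans (h.trans (min_le_left _ _))))
  obtain ⟨e, he, h⟩ := exists_pos_forall_lt_of_finite key
  exact ⟨e, he, fun i j hij => h e he le_rfl (i, j) hij⟩

lemma exists_disjoint_gauge' : ∃ e > 0, ∀ e', 0 < e' → e' ≤ e →
    ∀ i j, i ≠ j → ∀ z, S.gauge i z ≤ e' → e' < S.gauge j z := by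
  obtain ⟨e, he, h⟩ := S.exists_disjoint_gauge
  exact ⟨e, he, fun e' _ hle i j hij z hz => hle.trans_lt (h i j hij z (hz.trans hle))⟩

lemma exists_gauge_subset {U : Set ℂ} (hU : IsOpen U) (h : S.set ⊆ U) :
    ∃ e > 0, ∀ e', 0 < e' → e' ≤ e → ∀ j z, S.gauge j z ≤ e' → z ∈ U := by
  refine exists_pos_forall_lt_of_finite fun j => ?_
  obtain ⟨e, he, h⟩ := exists_slitGauge_subset hU ((S.seg_subset_set j).trans h)
  exact ⟨e, he, fun e' _ hle z hz => h z (hz.trans hle)⟩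

/-- Points of a thin ring around a slit lie in the slit half-plane. -/
lemma exists_ring_subset_dom : ∃ e > 0, ∀ e', 0 < e' → e' ≤ e → ∀ j, S.ring j e' ⊆ S.dom := by
  obtain ⟨e1, he1, h1⟩ := S.exists_disjoint_gauge'
  obtain ⟨e2, he2, h2⟩ := S.exists_gauge_subset isOpen_UHP S.set_subset_UHP
  refine ⟨min e1 e2, lt_min he1 he2, fun e' h0 hle j z hz => ⟨h2 e' h0 (hle.trans (min_le_right _ _)) j z
    hz.2.le, fun hz' => ?_⟩⟩
  obtain ⟨i, hi⟩ := S.mem_set.1 hz'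
  by_cases hij : j = i
  · subst hij; exact slitGauge_pos_iff.1 hz.1 hi
  · have := h1 e' h0 (hle.trans (min_le_left _ _)) j i hij z hz.2.le
    have h3 := mem_slit_iff.1 hi
    linarith

lemma exists_norm_lt : ∃ R > 0, ∀ z ∈ S.set, ‖z‖ < R := by
  obtain ⟨R, hR, h⟩ := S.isCompact_set.isBounded.exists_pos_norm_lt
  exact ⟨R, hR, h⟩

/-- A positive lower bound for the heights of the slits. -/
lemma exists_lt_y : ∃ m > 0, ∀ j, m < S.y j := by
  obtain ⟨e, he, h⟩ := exists_pos_forall_lt_of_finite (P := fun j e => e < S.y j) fun j =>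
    ⟨S.y j / 2, half_pos (S.y_pos j), fun e' _ hle => by have := S.y_pos j; linarith⟩
  exact ⟨e, he, h e he le_rfl⟩

lemma notMem_set_of_im {z : ℂ} (h : ∀ j, z.im ≠ S.y j) : z ∉ S.set := by
  intro hz
  obtain ⟨j, hj⟩ := S.mem_set.1 hz
  exact h j hj.1

end SlitSys

/-- The part of the upper half-plane outside a disk centred at a real point is connected. -/
lemma isPreconnected_far (x R : ℝ) : IsPreconnected {z : ℂ | R < ‖z - x‖ ∧ 0 < z.im} := by
  have h : {z : ℂ | R < ‖z - x‖ ∧ 0 < z.im} =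
      (fun p : ℝ × ℝ => (x : ℂ) + p.1 * Complex.exp (p.2 * I)) ''
        (Ioi (max R 0) ×ˢ Ioo 0 Real.pi) := by
    ext z
    constructor
    · rintro ⟨h1, h2⟩
      have hne : z - x ≠ 0 := by
        intro h0
        have : (z - x).im = 0 := by rw [h0]; rfl
        simp at this; linarith
      have hi : 0 < (z - x).im := by simpa using h2
      refine ⟨(‖z - x‖, (z - x).arg), ⟨max_lt h1 (norm_pos_iff.2 hne), ?_, ?_⟩, ?_⟩
      · have h3 := Complex.arg_nonneg_iff.2 hi.le
        refine lt_of_le_of_ne h3 fun h0 => ?_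
        have := (Complex.arg_eq_zero_iff.1 h0.symm).2
        linarith
      · exact Complex.arg_lt_pi_iff.2 (Or.inr hi.ne')
      · simp only [norm_mul_exp_arg_mul_I]; ring
    · rintro ⟨⟨r, θ⟩, ⟨hr, h0, hpi⟩, rfl⟩
      simp only [mem_Ioi, max_lt_iff] at hr
      refine ⟨?_, ?_⟩
      · simpa [Complex.norm_exp_ofReal_mul_I, abs_of_pos hr.2] using hr.1
      · simp [Complex.exp_ofReal_mul_I_im]
        exact mul_pos hr.2 (Real.sin_pos_of_pos_of_lt_pi h0 hpi)
  rw [h]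
  refine IsPreconnected.image ?_ _ (by fun_prop)
  exact isPreconnected_Ioi.prod isPreconnected_Ioo

/-- The horizontal ray from `z` pointing away from the real point `x`. -/
lemma isPreconnected_hray (z : ℂ) (s : ℝ) : IsPreconnected ((fun t : ℝ => z + (s * t : ℝ)) '' Ici 0) :=
  isPreconnected_Ici.image _ (by fun_prop)

/-- A slit half-plane minus a half-disk is connected. -/
lemma SlitSys.isPreconnected_dom_diff (S : SlitSys) (x r : ℝ) :
    IsPreconnected (S.dom \ closedBall (x : ℂ) r) := by
  obtain ⟨R, hR, hSR⟩ := S.exists_norm_lt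
  set Q := max (R + |x|) r with hQ
  set Far : Set ℂ := {z : ℂ | Q < ‖z - x‖ ∧ 0 < z.im} with hFar
  have hopen : IsOpen (S.dom \ closedBall (x : ℂ) r) := S.isOpen_dom.sdiff isClosed_closedBall
  have hFarsub : Far ⊆ S.dom \ closedBall (x : ℂ) r := by
    rintro z ⟨h1, h2⟩
    refine ⟨⟨h2, fun hz => ?_⟩, ?_⟩
    · have h3 := hSR z hz
      have h4 : ‖z - x‖ ≤ ‖z‖ + |x| := by simpa using norm_sub_le z (x : ℂ)
      have := le_max_left (R + |x|) r
      linarith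
    · rw [mem_closedBall, dist_eq_norm, not_le]
      exact (le_max_right _ _).trans_lt h1
  have hFarpt : ∀ w : ℂ, 0 < w.im → Q < |w.re - x| → w ∈ Far := fun w h1 h2 => by
    refine ⟨h2.trans_le ?_, h1⟩
    simpa using abs_re_le_norm (w - x)
  set o : ℂ := ⟨x + (|Q| + 1), 1⟩ with ho
  have hoF : o ∈ Far := hFarpt o (by simp [ho]) (by
    simp only [ho, add_sub_cancel_left]
    rw [abs_of_pos (by positivity)]; linarith [le_abs_self Q])
  refine isPreconnected_of_forall o fun z hz => ?_
  -- move up slightly to avoid the heights of the slits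
  obtain ⟨ε, hε, hball⟩ := Metric.isOpen_iff.1 hopen z hz
  obtain ⟨h, ⟨hh0, hhε⟩, hhy⟩ : ∃ h ∈ Ioo (0:ℝ) ε, h ∉ Set.range (fun j => S.y j - z.im) := by
    have := (Ioo_infinite hε).sdiff (Set.finite_range (fun j => S.y j - z.im))
    exact this.nonempty
  set z' : ℂ := z + h * I with hz'
  have hz'im : z'.im = z.im + h := by simp [hz']
  have hz'ball : z' ∈ ball z ε := by
    simp [hz', dist_eq_norm, abs_of_pos hh0, hhε]
  have hz'N := hball hz'ball
  have hseg : IsPreconnected (segment ℝ z z') := (convex_segment z z').isPreconnected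
  have hsegsub : segment ℝ z z' ⊆ S.dom \ closedBall (x : ℂ) r :=
    ((convex_ball z ε).segment_subset (mem_ball_self hε) hz'ball).trans hball
  set s : ℝ := if x ≤ z'.re then 1 else -1 with hs
  have hray := isPreconnected_hray z' s
  have hgrow : ∀ t : ℝ, 0 ≤ t → |(z' + (s * t : ℝ)).re - x| = |z'.re - x| + t := by
    intro t ht
    simp only [add_re, ofReal_re, hs]
    split_ifs with hc
    · rw [abs_of_nonneg (by linarith), abs_of_nonneg (by linarith)]; ring
    · push Not at hc
      rw [abs_of_neg (by linarith), abs_of_neg (by linarith)]; ring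
  have hraysub : (fun t : ℝ => z' + (s * t : ℝ)) '' Ici 0 ⊆ S.dom \ closedBall (x : ℂ) r := by
    rintro _ ⟨t, ht, rfl⟩
    have ht' : (0:ℝ) ≤ t := ht
    have him : (z' + (s * t : ℝ)).im = z'.im := by simp
    refine ⟨⟨?_, ?_⟩, ?_⟩
    · rw [mem_UHP, him]; exact hz'N.1.1
    · refine S.notMem_set_of_im fun j hj => hhy ⟨j, ?_⟩
      simp only; linarith
    · have h1 := hz'N.2
      rw [mem_closedBall, dist_eq_norm, not_le] at h1 ⊢
      refine h1.trans_le ((sq_le_sq₀ (norm_nonneg _) (norm_nonneg _)).1 ?_)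
      rw [Complex.sq_norm, Complex.sq_norm, normSq_apply, normSq_apply]
      have h2 := hgrow t ht'
      have h3 : |z'.re - x| ≤ |(z' + (s * t : ℝ)).re - x| := by linarith
      have h4 := sq_le_sq.2 h3
      simp only [sub_re, sub_im, ofReal_re, ofReal_im, him] at *
      nlinarith
  set T : ℝ := |Q| + 1 with hT
  have hw : z' + (s * T : ℝ) ∈ Far := by
    apply hFarpt
    · have : (z' + (s * T : ℝ)).im = z'.im := by simp
      rw [this]; exact hz'N.1.1
    · rw [hgrow T (by positivity)]
      have := abs_nonneg (z'.re - x)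
      linarith [le_abs_self Q]
  refine ⟨(segment ℝ z z' ∪ (fun t : ℝ => z' + (s * t : ℝ)) '' Ici 0) ∪ Far, ?_, Or.inr hoF,
    Or.inl (Or.inl (left_mem_segment ℝ z z')), ?_⟩
  · exact union_subset (union_subset hsegsub hraysub) hFarsub
  · have h1 : (segment ℝ z z' ∩ (fun t : ℝ => z' + (s * t : ℝ)) '' Ici 0).Nonempty :=
      ⟨z', right_mem_segment ℝ z z', 0, by simp, by simp⟩
    have h2 : ((segment ℝ z z' ∪ (fun t : ℝ => z' + (s * t : ℝ)) '' Ici 0) ∩ Far).Nonempty :=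
      ⟨z' + (s * T : ℝ), Or.inr ⟨T, by simp [hT]; positivity, rfl⟩, hw⟩
    exact (hseg.union' h1 hray).union' h2 (isPreconnected_far x Q)

lemma SlitSys.isPreconnected_dom (S : SlitSys) : IsPreconnected S.dom := by
  have := S.isPreconnected_dom_diff 0 (-1)
  rwa [closedBall_eq_empty.2 (by norm_num), sdiff_empty] at this

/-- A preconnected set meeting a ball and not contained in it meets the sphere. -/
lemma exists_mem_sphere_of_isPreconnected {X : Set ℂ} (hX : IsPreconnected X) {c p q : ℂ} {r : ℝ}
    (hp : p ∈ X) (hq : q ∈ X) (hpr : dist p c ≤ r) (hqr : r ≤ dist q c) :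
    ∃ z ∈ X, dist z c = r := by
  have := hX.intermediate_value hp hq (f := fun z => dist z c) (by fun_prop)
  obtain ⟨z, hz, h⟩ := this ⟨hpr, hqr⟩
  exact ⟨z, hz, h⟩

end SlitLoewner

namespace SlitLoewner

/-! ### Slits correspond to slits -/

/-- The topological core: a homeomorphism between the complement of slits in a simply connected
domain and another domain cannot unfold a slit ring of the target away from the slits of the
source. -/
lemma false_of_slitRing_unfolded {Ω : Set ℂ} (hΩ : IsOpen Ω) (hΩs : SimplyConnectedSpace Ω)
    (S : SlitSys) (hS : S.set ⊆ Ω) {g f : ℂ → ℂ} (hg : ContinuousOn g (Ω \ S.set))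
    {a b y e : ℝ} (he : 0 < e) {p : ℂ} (hp : p ∈ slit a b y)
    (hne : ∀ z ∈ Ω \ S.set, g z ≠ p) {V : Set ℂ} (hV : IsOpen V) (hSV : S.set ⊆ V)
    (hf : ContinuousOn f (slitRing a b y e))
    (hfm : ∀ w ∈ slitRing a b y e, f w ∈ Ω ∧ f w ∉ V ∧ g (f w) = w)
    (hconv : ∀ i, ∃ e > 0, ∃ Q : Set ℂ, Convex ℝ Q ∧ p ∉ Q ∧ MapsTo g (S.ring i e) Q) :
    False := by
  choose e' he' Q hQ hpQ hgQ using hconv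
  obtain ⟨e1, he1, h1⟩ := S.exists_disjoint_gauge'
  obtain ⟨e2, he2, h2⟩ := S.exists_gauge_subset (hΩ.inter hV) (subset_inter hS hSV)
  obtain ⟨e3, he3, h3⟩ := exists_pos_forall_lt_of_finite (P := fun i ε => ε ≤ e' i) fun i =>
    ⟨e' i, he' i, fun _ _ h => h⟩
  obtain ⟨ε, hε, hε1, hε2, hε3⟩ : ∃ ε > 0, ε ≤ e1 ∧ ε ≤ e2 ∧ ε ≤ e3 :=
    ⟨min e1 (min e2 e3), by positivity, min_le_left _ _,
      (min_le_right _ _).trans (min_le_left _ _), (min_le_right _ _).trans (min_le_right _ _)⟩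
  replace h1 := h1 ε hε hε1
  replace h2 := h2 ε hε hε2
  replace h3 := h3 ε hε hε3
  have hring : ∀ i, MapsTo g (S.ring i ε) (Q i) := fun i z hz =>
    hgQ i ⟨hz.1, hz.2.trans_le (h3 i)⟩
  have hq : ∀ i, g ⟨S.b i + ε / 2, S.y i⟩ ∈ Q i := fun i =>
    hring i (mem_slitRing (S.a_lt_b i).le hε)
  set q : Fin S.n → ℂ := fun i => g ⟨S.b i + ε / 2, S.y i⟩ with hqdef
  set χ : Fin S.n → ℂ → ℝ := fun i z => max 0 (min 1 (2 - 3 * S.gauge i z / ε)) with hχ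
  have hχc : ∀ i, Continuous (χ i) := fun i => by
    have := continuous_slitGauge (S.a i) (S.b i) (S.y i)
    simp only [hχ]; fun_prop
  have hχ0 : ∀ i z, ε ≤ S.gauge i z → χ i z = 0 := fun i z hz => by
    have : 3 ≤ 3 * S.gauge i z / ε := by rw [le_div_iff₀ hε]; linarith
    simp only [hχ]
    exact max_eq_left ((min_le_right _ _).trans (by linarith))
  have hχ1 : ∀ i z, S.gauge i z < ε / 3 → χ i z = 1 := fun i z hz => by
    have : 3 * S.gauge i z / ε ≤ 1 := by rw [div_le_one hε]; linarith
    simp only [hχ]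
    rw [min_eq_left (by linarith), max_eq_right zero_le_one]
  have hχI : ∀ i z, 0 ≤ χ i z ∧ χ i z ≤ 1 := fun i z =>
    ⟨le_max_left _ _, max_le zero_le_one (min_le_left _ _)⟩
  set G : ℂ → ℂ := fun z => g z + ∑ i, (χ i z : ℂ) * (q i - g z) with hG
  have hGnear : ∀ i z, S.gauge i z < ε → G z = g z + (χ i z : ℂ) * (q i - g z) := by
    intro i z hz
    simp only [hG]
    rw [Finset.sum_eq_single i]
    · intro j _ hji
      rw [hχ0 j z (h1 i j hji.symm z hz.le).le]; simp
    · intro h; exact (h (Finset.mem_univ i)).elim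
  have hGfar : ∀ z, (∀ i, ε ≤ S.gauge i z) → G z = g z := by
    intro z hz
    simp only [hG]
    rw [Finset.sum_eq_zero]
    · simp
    · intro i _; rw [hχ0 i z (hz i)]; simp
  have hGc : ContinuousOn G Ω := by
    intro z hz
    by_cases hzS : z ∈ S.set
    · obtain ⟨i, hi⟩ := S.mem_set.1 hzS
      have hi' : S.gauge i z < ε / 3 := (mem_slit_iff.1 hi).trans_lt (by positivity)
      have hev : G =ᶠ[𝓝 z] fun _ => q i := by
        filter_upwards [(isOpen_slitGauge_lt (S.a i) (S.b i) (S.y i) (ε / 3)).mem_nhds hi']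
          with w hw
        have hw' : S.gauge i w < ε / 3 := hw
        rw [hGnear i w (by linarith), hχ1 i w hw']; simp
      exact (continuousAt_const.congr hev.symm).continuousWithinAt
    · have hgz : ContinuousAt g z :=
        hg.continuousAt ((hΩ.sdiff S.isCompact_set.isClosed).mem_nhds ⟨hz, hzS⟩)
      refine ContinuousAt.continuousWithinAt ?_
      refine hgz.add (tendsto_finsetSum _ fun i _ => ?_)
      exact ((continuous_ofReal.comp (hχc i)).continuousAt).mul (continuousAt_const.sub hgz)
  have hGp : ∀ z ∈ Ω, G z ≠ p := by
    intro z hz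
    by_cases hex : ∃ i, S.gauge i z < ε
    · obtain ⟨i, hi⟩ := hex
      rw [hGnear i z hi]
      by_cases hzi : z ∈ S.seg i
      · rw [hχ1 i z ((mem_slit_iff.1 hzi).trans_lt (by positivity))]
        simp only [ofReal_one, one_mul, add_sub_cancel]
        exact fun h => hpQ i (h ▸ hq i)
      · have hgz : g z ∈ Q i := hring i ⟨slitGauge_pos_iff.2 hzi, hi⟩
        have := (hQ i).add_smul_sub_mem hgz (hq i) (hχI i z)
        rw [real_smul] at this
        exact fun h => hpQ i (h ▸ this)
    · push Not at hex
      rw [hGfar z hex]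
      refine hne z ⟨hz, fun hzS => ?_⟩
      obtain ⟨i, hi⟩ := S.mem_set.1 hzS
      have := mem_slit_iff.1 hi
      linarith [hex i]
  obtain ⟨l, hl, hexp⟩ := Complex.exists_continuousOn_eqOn_exp_comp
    hΩs hΩ
    (g := fun z => G z - p) (hGc.sub continuousOn_const) (by
      rintro ⟨z, hz, h⟩; exact hGp z hz (sub_eq_zero.1 h))
  refine not_continuous_log_slitRing he hp (l := l ∘ f)
    (hl.comp hf fun w hw => (hfm w hw).1) fun w hw => ?_
  obtain ⟨hw1, hw2, hw3⟩ := hfm w hw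
  have := hexp hw1
  simp only [Function.comp] at this ⊢
  rw [this, hGfar, hw3]
  intro i
  by_contra hlt
  exact hw2 (h2 i (f w) (not_le.1 hlt).le).2

/-- A connected set avoiding the frontier of `V` lies inside `V` or outside its closure. -/
lemma subset_or_disjoint_closure {X V : Set ℂ} (hX : IsPreconnected X) (hV : IsOpen V)
    (h : ∀ z ∈ X, z ∉ frontier V) : (∀ z ∈ X, z ∈ V) ∨ ∀ z ∈ X, z ∉ closure V := by
  have hsub : X ⊆ V ∪ (closure V)ᶜ := fun z hz => by
    by_contra hn
    simp only [mem_union, mem_compl_iff, not_or, not_not] at hn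
    refine h z hz ⟨hn.2, ?_⟩
    rw [hV.interior_eq]; exact hn.1
  have := isPreconnected_iff_subset_of_disjoint.1 hX V (closure V)ᶜ hV
    isClosed_closure.isOpen_compl hsub (by
      ext z; simp only [mem_inter_iff, mem_compl_iff, mem_empty_iff_false, iff_false]
      rintro ⟨_, h1, h2⟩; exact h2 (subset_closure h1))
  rcases this with h | h
  · exact Or.inl fun z hz => h hz
  · exact Or.inr fun z hz => h hz

/-- Mutually inverse homeomorphisms between two open sets with slits removed. -/
structure HomeoData (Ω : Set ℂ) (S : SlitSys) (Ω' : Set ℂ) (S' : SlitSys) (g f : ℂ → ℂ) :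
    Prop where
  open_left : IsOpen Ω
  open_right : IsOpen Ω'
  sub_left : S.set ⊆ Ω
  sub_right : S'.set ⊆ Ω'
  cont_g : ContinuousOn g (Ω \ S.set)
  cont_f : ContinuousOn f (Ω' \ S'.set)
  maps_g : MapsTo g (Ω \ S.set) (Ω' \ S'.set)
  maps_f : MapsTo f (Ω' \ S'.set) (Ω \ S.set)
  left_inv : ∀ z ∈ Ω \ S.set, f (g z) = z
  right_inv : ∀ w ∈ Ω' \ S'.set, g (f w) = w

namespace HomeoData

variable {Ω Ω' : Set ℂ} {S S' : SlitSys} {g f : ℂ → ℂ}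

lemma symm (H : HomeoData Ω S Ω' S' g f) : HomeoData Ω' S' Ω S f g :=
  ⟨H.open_right, H.open_left, H.sub_right, H.sub_left, H.cont_f, H.cont_g, H.maps_f, H.maps_g,
    H.right_inv, H.left_inv⟩

lemma exists_ring_subset (H : HomeoData Ω S Ω' S' g f) :
    ∃ e > 0, ∀ e', 0 < e' → e' ≤ e → ∀ j, S.ring j e' ⊆ Ω \ S.set := by
  obtain ⟨e1, he1, h1⟩ := S.exists_ring_subset_dom
  obtain ⟨e2, he2, h2⟩ := S.exists_gauge_subset H.open_left H.sub_left
  refine ⟨min e1 e2, lt_min he1 he2, fun e' h0 hle j z hz => ⟨?_, ?_⟩⟩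
  · exact h2 e' h0 (hle.trans (min_le_right _ _)) j z hz.2.le
  · exact (h1 e' h0 (hle.trans (min_le_left _ _)) j hz).2

/-- The image of a thin slit ring lies inside `V` or outside its closure. -/
lemma ring_dichotomy (H : HomeoData Ω S Ω' S' g f) (j : Fin S'.n) {V : Set ℂ} (hV : IsOpen V)
    (hVc : IsCompact (frontier V)) (hVs : frontier V ⊆ Ω \ S.set) :
    ∃ e > 0, ∀ e', 0 < e' → e' ≤ e → S'.ring j e' ⊆ Ω' \ S'.set ∧
      ((∀ w ∈ S'.ring j e', f w ∈ V) ∨ ∀ w ∈ S'.ring j e', f w ∉ closure V) := by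
  obtain ⟨e1, he1, h1⟩ := H.symm.exists_ring_subset
  have hK : IsCompact (g '' frontier V) := hVc.image_of_continuousOn (H.cont_g.mono hVs)
  obtain ⟨e2, he2, h2⟩ := exists_lt_slitGauge (a := S'.a j) (b := S'.b j) (y := S'.y j)
    hK.isClosed (disjoint_left.2 (by
      rintro _ ⟨z, hz, rfl⟩ hz'
      exact (H.maps_g (hVs hz)).2 (S'.seg_subset_set j hz')))
  refine ⟨min e1 e2, lt_min he1 he2, fun e' h0 hle => ?_⟩
  have hsub := h1 e' h0 (hle.trans (min_le_left _ _)) j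
  refine ⟨hsub, ?_⟩
  have := subset_or_disjoint_closure ((isPreconnected_slitRing (S'.a_lt_b j).le).image f
    (H.cont_f.mono hsub)) hV (by
      rintro _ ⟨w, hw, rfl⟩ hfr
      have h3 := h2 w ⟨f w, hfr, H.right_inv w (hsub hw)⟩
      have h4 := hw.2
      have := min_le_right e1 e2
      linarith)
  simpa only [forall_mem_image] using this

end HomeoData

namespace SlitSys

variable (S : SlitSys)

/-- The open rectangular neighbourhood of the union of the slits. -/
def nhd (e : ℝ) : Set ℂ := ⋃ i, {z | S.gauge i z < e}

lemma mem_nhd {e : ℝ} {z : ℂ} : z ∈ S.nhd e ↔ ∃ i, S.gauge i z < e := by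
  simp [nhd]

lemma isOpen_nhd (e : ℝ) : IsOpen (S.nhd e) :=
  isOpen_iUnion fun _ => isOpen_slitGauge_lt _ _ _ _

lemma set_subset_nhd {e : ℝ} (he : 0 < e) : S.set ⊆ S.nhd e := fun z hz => by
  obtain ⟨i, hi⟩ := S.mem_set.1 hz
  exact S.mem_nhd.2 ⟨i, (mem_slit_iff.1 hi).trans_lt he⟩

lemma isCompact_iUnion_gauge_le (e : ℝ) : IsCompact (⋃ i, {z | S.gauge i z ≤ e}) :=
  isCompact_iUnion fun _ => isCompact_slitGauge_le _ _ _ _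

lemma closure_nhd_subset (e : ℝ) : closure (S.nhd e) ⊆ ⋃ i, {z | S.gauge i z ≤ e} :=
  closure_minimal (iUnion_mono fun _ z hz => show S.gauge _ z ≤ e from le_of_lt hz)
    (S.isCompact_iUnion_gauge_le e).isClosed

lemma isCompact_frontier_nhd (e : ℝ) : IsCompact (frontier (S.nhd e)) :=
  (S.isCompact_iUnion_gauge_le e).of_isClosed_subset isClosed_frontier
    (frontier_subset_closure.trans (S.closure_nhd_subset e))

lemma notMem_set_of_mem_frontier_nhd {e : ℝ} (he : 0 < e) {z : ℂ} (hz : z ∈ frontier (S.nhd e)) :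
    z ∉ S.set := fun h => by
  rw [(S.isOpen_nhd e).frontier_eq] at hz
  exact hz.2 (S.set_subset_nhd he h)

lemma isCompact_frontier_gauge_lt (i : Fin S.n) (e : ℝ) :
    IsCompact (frontier {z | S.gauge i z < e}) :=
  (isCompact_slitGauge_le _ _ _ e).of_isClosed_subset isClosed_frontier
    (frontier_subset_closure.trans (closure_lt_subset_le (continuous_slitGauge _ _ _)
      continuous_const))

/-- The boundary of a thin neighbourhood of one slit misses all slits. -/
lemma frontier_gauge_lt_subset {U : Set ℂ} {e : ℝ} (he : 0 < e)
    (hd : ∀ i j, i ≠ j → ∀ z, S.gauge i z ≤ e → e < S.gauge j z)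
    (hU : ∀ j z, S.gauge j z ≤ e → z ∈ U) (i : Fin S.n) :
    frontier {z | S.gauge i z < e} ⊆ U \ S.set := by
  intro z hz
  have hle : S.gauge i z ≤ e :=
    closure_lt_subset_le (continuous_slitGauge _ _ _) continuous_const (frontier_subset_closure hz)
  rw [(isOpen_slitGauge_lt _ _ _ _).frontier_eq] at hz
  refine ⟨hU i z hle, fun hzS => ?_⟩
  obtain ⟨j, hj⟩ := S.mem_set.1 hzS
  rw [mem_slit_iff] at hj
  by_cases hij : i = j
  · subst hij; exact hz.2 (hj.trans_lt he)
  · have := hd i j hij z hle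
    linarith

lemma exists_notMem_closure_nhd {q : ℂ} (hq : q ∉ S.set) :
    ∃ e > 0, ∀ e', 0 < e' → e' ≤ e → q ∉ closure (S.nhd e') := by
  obtain ⟨e, he, h⟩ := S.exists_gauge_subset (U := {q}ᶜ) isOpen_compl_singleton
    (fun z hz => by rintro rfl; exact hq hz)
  refine ⟨e, he, fun e' h0 hle hmem => ?_⟩
  obtain ⟨i, hi⟩ := mem_iUnion.1 (S.closure_nhd_subset e' hmem)
  exact h e' h0 hle i q hi rfl

/-- Points of the slit half-plane close to a slit are in the ring around it. -/
lemma eventually_mem_ring {w : ℕ → ℂ} {p : ℂ} {Ω : Set ℂ} (hw : ∀ n, w n ∈ Ω \ S.set)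
    (hwp : Tendsto w atTop (𝓝 p)) {j : Fin S.n} (hp : p ∈ S.seg j) {e : ℝ} (he : 0 < e) :
    ∀ᶠ n in atTop, w n ∈ S.ring j e := by
  have : S.gauge j p < e := (mem_slit_iff.1 hp).trans_lt he
  filter_upwards [hwp ((isOpen_slitGauge_lt _ _ _ e).mem_nhds this)] with n hn
  exact ⟨slitGauge_pos_iff.2 fun h => (hw n).2 (S.seg_subset_set j h), hn⟩

end SlitSys

namespace HomeoData

variable {Ω Ω' : Set ℂ} {S S' : SlitSys} {g f : ℂ → ℂ}

/-- If `f` has a limit off the slits along a sequence converging to a slit, then the image of a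
ring around that slit stays away from the slits. -/
lemma exists_ring_far (H : HomeoData Ω S Ω' S' g f) {w : ℕ → ℂ} (hw : ∀ n, w n ∈ Ω' \ S'.set)
    {p q : ℂ} (hwp : Tendsto w atTop (𝓝 p)) {j : Fin S'.n} (hp : p ∈ S'.seg j)
    (hq : Tendsto (f ∘ w) atTop (𝓝 q)) (hqS : q ∉ S.set) :
    ∃ e > 0, ∃ δ > 0, S'.ring j e ⊆ Ω' \ S'.set ∧ ∀ w ∈ S'.ring j e, f w ∉ S.nhd δ := by
  obtain ⟨e1, he1, h1⟩ := S.exists_notMem_closure_nhd hqS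
  obtain ⟨e2, he2, h2⟩ := S.exists_gauge_subset H.open_left H.sub_left
  set δ := min e1 e2 with hδ
  have hδ0 : 0 < δ := lt_min he1 he2
  have hqδ := h1 δ hδ0 (min_le_left _ _)
  obtain ⟨e, he, h⟩ := H.ring_dichotomy j (S.isOpen_nhd δ) (S.isCompact_frontier_nhd δ)
    (fun z hz => ⟨by
      obtain ⟨i, hi⟩ := mem_iUnion.1 (S.closure_nhd_subset δ (frontier_subset_closure hz))
      exact h2 δ hδ0 (min_le_right _ _) i z hi, S.notMem_set_of_mem_frontier_nhd hδ0 hz⟩)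
  obtain ⟨hsub, hd⟩ := h e he le_rfl
  refine ⟨e, he, δ, hδ0, hsub, ?_⟩
  rcases hd with hd | hd
  · exfalso
    have h3 : ∀ᶠ n in atTop, f (w n) ∉ closure (S.nhd δ) :=
      hq (isClosed_closure.isOpen_compl.mem_nhds hqδ)
    obtain ⟨n, hn1, hn2⟩ := (h3.and (S'.eventually_mem_ring hw hwp hp he)).exists
    exact hn1 (subset_closure (hd _ hn2))
  · exact fun w hw hn => hd w hw (subset_closure hn)

/-- Points tending to a slit of the target half-plane come from points tending to the slits. -/
lemma mem_slits_of_tendsto (H : HomeoData Ω S UHP S' g f) (hΩs : SimplyConnectedSpace Ω)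
    (hb : ∀ R, ∃ B, ∀ z ∈ Ω \ S.set, ‖z‖ ≤ R → ‖g z‖ ≤ B)
    {w : ℕ → ℂ} (hw : ∀ n, w n ∈ S'.dom)
    {p q : ℂ} (hwp : Tendsto w atTop (𝓝 p)) (hp : p ∈ S'.set)
    (hq : Tendsto (f ∘ w) atTop (𝓝 q)) : q ∈ S.set := by
  by_contra hqS
  obtain ⟨j, hj⟩ := S'.mem_set.1 hp
  obtain ⟨e, he, δ, hδ, hsub, hfar⟩ := H.exists_ring_far hw hwp hj hq hqS
  refine false_of_slitRing_unfolded H.open_left hΩs S H.sub_left H.cont_g he hj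
    (fun z hz h => (H.maps_g hz).2 (h ▸ hp)) (S.isOpen_nhd δ) (S.set_subset_nhd hδ)
    (H.cont_f.mono hsub) (fun w hw => ⟨(H.maps_f (hsub hw)).1, hfar w hw, H.right_inv w (hsub hw)⟩)
    fun i => ?_
  -- thin neighbourhoods of the target slits
  obtain ⟨e1, he1, h1⟩ := S'.exists_disjoint_gauge'
  obtain ⟨e2, he2, h2⟩ := S'.exists_gauge_subset isOpen_UHP S'.set_subset_UHP
  set ε := min e (min e1 e2) with hε
  have hε0 : 0 < ε := by positivity
  replace h1 := h1 ε hε0 ((min_le_right _ _).trans (min_le_left _ _))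
  replace h2 := h2 ε hε0 ((min_le_right _ _).trans (min_le_right _ _))
  have hdich : ∀ k, ∃ η > 0, ∀ η', 0 < η' → η' ≤ η → S.ring i η' ⊆ Ω \ S.set ∧
      ((∀ z ∈ S.ring i η', g z ∈ {w | S'.gauge k w < ε}) ∨
        ∀ z ∈ S.ring i η', g z ∉ closure {w | S'.gauge k w < ε}) := fun k =>
    H.symm.ring_dichotomy i (isOpen_slitGauge_lt _ _ _ _) (S'.isCompact_frontier_gauge_lt k ε)
      (S'.frontier_gauge_lt_subset hε0 h1 h2 k)
  obtain ⟨η1, hη1, hd⟩ := exists_pos_forall_lt_of_finite hdich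
  obtain ⟨R, hR⟩ := (isBounded_slitGauge_le (S.a i) (S.b i) (S.y i) 1).exists_norm_le
  obtain ⟨B, hB⟩ := hb R
  obtain ⟨η0, hη0, hsub0⟩ := H.exists_ring_subset
  set K : Set ℂ := (closedBall 0 B ∩ {w | S'.y j ≤ w.im}) \ S'.nhd ε with hK
  have hKc : IsCompact K := ((isCompact_closedBall 0 B).inter_right
    (isClosed_le continuous_const continuous_im)).diff (S'.isOpen_nhd ε)
  have hKsub : K ⊆ UHP \ S'.set := fun w hw =>
    ⟨(S'.y_pos j).trans_le hw.1.2, fun h => hw.2 (S'.set_subset_nhd hε0 h)⟩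
  obtain ⟨η2, hη2, hgK⟩ := exists_lt_slitGauge (a := S.a i) (b := S.b i) (y := S.y i)
    (hKc.image_of_continuousOn (H.cont_f.mono hKsub)).isClosed (disjoint_left.2 (by
      rintro _ ⟨w, hw, rfl⟩ hz'
      exact (H.maps_f (hKsub hw)).2 (S.seg_subset_set i hz')))
  set η := min (min η1 η0) (min η2 (min 1 δ)) with hη
  have hηpos : 0 < η := by positivity
  have hηle1 : η ≤ η1 := (min_le_left _ _).trans (min_le_left _ _)
  have hηle0 : η ≤ η0 := (min_le_left _ _).trans (min_le_right _ _)
  have hηle2 : η ≤ η2 := (min_le_right _ _).trans (min_le_left _ _)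
  have hηle3 : η ≤ 1 := (min_le_right _ _).trans ((min_le_right _ _).trans (min_le_left _ _))
  have hηle4 : η ≤ δ := (min_le_right _ _).trans ((min_le_right _ _).trans (min_le_right _ _))
  have hring := hsub0 η hηpos hηle0 i
  by_cases hk : ∃ k, ∀ z ∈ S.ring i η, g z ∈ {w | S'.gauge k w < ε}
  · obtain ⟨k, hk⟩ := hk
    by_cases hkj : k = j
    · exfalso
      subst hkj
      have hz := mem_slitRing (a := S.a i) (b := S.b i) (y := S.y i) (S.a_lt_b i).le hηpos
      set z : ℂ := ⟨S.b i + η / 2, S.y i⟩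
      have hgz := hk z hz
      have hgd := H.maps_g (hring hz)
      refine hfar (g z) ⟨slitGauge_pos_iff.2 fun h => hgd.2 (S'.seg_subset_set k h),
        lt_of_lt_of_le hgz (min_le_left _ _)⟩ ?_
      rw [H.left_inv z (hring hz)]
      exact S.mem_nhd.2 ⟨i, hz.2.trans_le hηle4⟩
    · refine ⟨η, hηpos, {w | S'.gauge k w < ε}, convex_slitGauge_lt _ _ _ _, ?_, hk⟩
      have := h1 j k (Ne.symm hkj) p ((mem_slit_iff.1 hj).trans hε0.le)
      simp only [mem_ofPred_eq, not_lt]; exact this.le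
  · push Not at hk
    refine ⟨η, hηpos, {w | w.im < S'.y j}, convex_halfSpace_im_lt _, ?_, fun z hz => ?_⟩
    · have : p.im = S'.y j := hj.1
      simp [this]
    · by_contra hle
      have hle' : S'.y j ≤ (g z).im := not_lt.1 hle
      have hzb : ‖g z‖ ≤ B := hB z (hring hz) (hR z (hz.2.le.trans hηle3))
      have hgk : g z ∈ K := by
        refine ⟨⟨by simpa using hzb, hle'⟩, fun hn => ?_⟩
        obtain ⟨k, hk'⟩ := S'.mem_nhd.1 hn
        rcases (hd η hηpos hηle1 k).2 with h | h
        · obtain ⟨z', hz', h'⟩ := hk k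
          exact h' (h z' hz')
        · exact h z hz (subset_closure hk')
      have h5 := hgK z ⟨g z, hgk, H.left_inv z (hring hz)⟩
      have h6 := hz.2
      linarith

end HomeoData

end SlitLoewner

namespace SlitLoewner

/-! ### Mapping-out functions -/

/-- The slit half-plane with a hull removed. -/
def gdom (S : SlitSys) (F : Set ℂ) : Set ℂ := (UHP \ F) \ S.set

/-- The data of a mapping-out function `g` of the hull `F` in `S.dom`, with inverse `f`. -/
structure Conf (S : SlitSys) (F : Set ℂ) (S' : SlitSys) (g f : ℂ → ℂ) : Prop where
  hull : IsHHull F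
  bdd : IsBounded F
  sep : Disjoint (closure F) S.set
  holo_g : DifferentiableOn ℂ g (gdom S F)
  holo_f : DifferentiableOn ℂ f S'.dom
  maps_g : MapsTo g (gdom S F) S'.dom
  maps_f : MapsTo f S'.dom (gdom S F)
  left_inv : ∀ z ∈ gdom S F, f (g z) = z
  right_inv : ∀ w ∈ S'.dom, g (f w) = w
  norm : Tendsto (fun z => g z - z) (cobounded ℂ ⊓ 𝓟 (gdom S F)) (𝓝 0)

lemma _root_.IsHHull.isOpen_compl {F : Set ℂ} (h : IsHHull F) : IsOpen (UHP \ F) := by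
  have : UHP \ F = UHP \ closure F := by
    ext z
    exact ⟨fun hz => ⟨hz.1, fun hc => hz.2 (h.2.1 ⟨hc, hz.1⟩)⟩,
      fun hz => ⟨hz.1, fun hc => hz.2 (subset_closure hc)⟩⟩
  rw [this]; exact isOpen_UHP.sdiff isClosed_closure

namespace Conf

variable {S S' : SlitSys} {F : Set ℂ} {g f : ℂ → ℂ}

lemma set_subset (H : Conf S F S' g f) : S.set ⊆ UHP \ F := fun _ hz =>
  ⟨S.set_subset_UHP hz, fun hF => disjoint_left.1 H.sep (subset_closure hF) hz⟩

lemma isOpen_gdom (H : Conf S F S' g f) : IsOpen (gdom S F) :=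
  H.hull.isOpen_compl.sdiff S.isCompact_set.isClosed

lemma homeo (H : Conf S F S' g f) : HomeoData (UHP \ F) S UHP S' g f where
  open_left := H.hull.isOpen_compl
  open_right := isOpen_UHP
  sub_left := H.set_subset
  sub_right := S'.set_subset_UHP
  cont_g := H.holo_g.continuousOn
  cont_f := H.holo_f.continuousOn
  maps_g := H.maps_g
  maps_f := H.maps_f
  left_inv := H.left_inv
  right_inv := H.right_inv

lemma inj_g (H : Conf S F S' g f) : InjOn g (gdom S F) := fun z hz w hw h => by
  rw [← H.left_inv z hz, ← H.left_inv w hw, h]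

lemma inj_f (H : Conf S F S' g f) : InjOn f S'.dom := fun z hz w hw h => by
  rw [← H.right_inv z hz, ← H.right_inv w hw, h]

lemma image_f (H : Conf S F S' g f) : f '' S'.dom = gdom S F :=
  Subset.antisymm H.maps_f.image_subset fun z hz => ⟨g z, H.maps_g hz, H.left_inv z hz⟩

lemma isPreconnected_gdom (H : Conf S F S' g f) : IsPreconnected (gdom S F) := by
  rw [← H.image_f]
  exact S'.isPreconnected_dom.image f H.holo_f.continuousOn

/-- The images under `f` of open sets are open. -/
lemma isOpen_image_f (H : Conf S F S' g f) {U : Set ℂ} (hU : IsOpen U) (hs : U ⊆ S'.dom) :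
    IsOpen (f '' U) := by
  have : f '' U = gdom S F ∩ g ⁻¹' U := by
    ext z
    constructor
    · rintro ⟨w, hw, rfl⟩
      exact ⟨H.maps_f (hs hw), by rw [mem_preimage, H.right_inv w (hs hw)]; exact hw⟩
    · rintro ⟨hz, hw⟩
      exact ⟨g z, hw, H.left_inv z hz⟩
  rw [this]
  exact H.holo_g.continuousOn.isOpen_inter_preimage H.isOpen_gdom hU

/-- The images under `g` of open sets are open. -/
lemma isOpen_image_g (H : Conf S F S' g f) {U : Set ℂ} (hU : IsOpen U) (hs : U ⊆ gdom S F) :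
    IsOpen (g '' U) := by
  have : g '' U = S'.dom ∩ f ⁻¹' U := by
    ext z
    constructor
    · rintro ⟨w, hw, rfl⟩
      exact ⟨H.maps_g (hs hw), by rw [mem_preimage, H.left_inv w (hs hw)]; exact hw⟩
    · rintro ⟨hz, hw⟩
      exact ⟨f z, hw, H.right_inv z hz⟩
  rw [this]
  exact H.holo_f.continuousOn.isOpen_inter_preimage S'.isOpen_dom hU

/-- Points high up on the imaginary axis belong to the domain. -/
lemma exists_mul_I_mem (H : Conf S F S' g f) :
    ∃ Y0 > 0, ∀ z : ℂ, Y0 ≤ ‖z‖ → 0 < z.im → z ∈ gdom S F := by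
  obtain ⟨R1, hR1, h1⟩ := S.exists_norm_lt
  obtain ⟨R2, hR2, h2⟩ := H.bdd.exists_pos_norm_lt
  refine ⟨max R1 R2, by positivity, fun z hz hi => ⟨⟨hi, fun hF => ?_⟩, fun hS => ?_⟩⟩
  · exact absurd (h2 z hF) (not_lt.2 ((le_max_right _ _).trans hz))
  · exact absurd (h1 z hS) (not_lt.2 ((le_max_left _ _).trans hz))

/-- An estimate of `g z - z` near infinity bounds `g` on bounded sets. -/
lemma norm_g_le (H : Conf S F S' g f) {R c : ℝ} (hc : 0 ≤ c)
    (h : ∀ z ∈ gdom S F, R ≤ ‖z‖ → ‖g z - z‖ ≤ c) {X : ℝ} (hX : R ≤ X) {z : ℂ}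
    (hz : z ∈ gdom S F) (hzX : ‖z‖ ≤ X) : ‖g z‖ ≤ X + c := by
  by_contra hlt
  push Not at hlt
  obtain ⟨Y0, hY0, hY⟩ := H.exists_mul_I_mem
  set Y := max Y0 (|X| + 2 * c + |R| + 1) with hYdef
  have hYpos : 0 < Y := lt_max_of_lt_left hY0
  have hYX : |X| + 2 * c + |R| + 1 ≤ Y := le_max_right _ _
  have hnY : ‖(Y * I : ℂ)‖ = Y := by simp [abs_of_pos hYpos]
  have hYm : (Y * I : ℂ) ∈ gdom S F :=
    hY _ (by rw [hnY]; exact le_max_left _ _) (by simpa using hYpos)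
  have hR : R ≤ Y := by have := le_abs_self R; have := abs_nonneg X; linarith
  have hgY := h _ hYm (by rw [hnY]; exact hR)
  have hgY' : Y - c ≤ ‖g (Y * I)‖ := by
    have := norm_sub_norm_le (Y * I : ℂ) (Y * I - g (Y * I))
    rw [sub_sub_cancel, hnY, norm_sub_rev] at this
    linarith
  set N := S'.dom \ closedBall ((0 : ℝ) : ℂ) (X + c) with hN
  have hNpre := (S'.isPreconnected_dom_diff 0 (X + c)).image f
    (H.holo_f.continuousOn.mono sdiff_subset)
  have hzN : z ∈ f '' N := ⟨g z, ⟨H.maps_g hz, by simpa using hlt⟩, H.left_inv z hz⟩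
  have hYN : (Y * I : ℂ) ∈ f '' N := ⟨g (Y * I), ⟨H.maps_g hYm, by
    simp only [ofReal_zero, mem_closedBall, dist_zero_right, not_le]
    have := le_abs_self X; have := abs_nonneg R; linarith⟩, H.left_inv _ hYm⟩
  obtain ⟨_, ⟨w, hw, rfl⟩, hwX⟩ := exists_mem_sphere_of_isPreconnected (c := 0) (r := X)
    hNpre hzN hYN (by simpa using hzX) (by
      rw [dist_zero_right, hnY]; have := le_abs_self X; have := abs_nonneg R; linarith)
  rw [dist_zero_right] at hwX
  have h3 := h (f w) (H.maps_f hw.1) (by rw [hwX]; exact hX)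
  rw [H.right_inv w hw.1] at h3
  have h4 := hw.2
  simp only [ofReal_zero, mem_closedBall, dist_zero_right, not_le] at h4
  have := norm_sub_norm_le w (f w)
  linarith

lemma norm_f_le (H : Conf S F S' g f) {R c : ℝ}
    (h : ∀ z ∈ gdom S F, R ≤ ‖z‖ → ‖g z - z‖ ≤ c) {X : ℝ} {w : ℂ}
    (hw : w ∈ S'.dom) (hwX : ‖w‖ ≤ X) : ‖f w‖ ≤ max R (X + c) := by
  by_contra hlt
  push Not at hlt
  have h1 := h (f w) (H.maps_f hw) ((le_max_left _ _).trans hlt.le)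
  rw [H.right_inv w hw] at h1
  have h2 := norm_sub_norm_le (f w) (f w - w)
  rw [sub_sub_cancel, norm_sub_rev] at h2
  have := le_max_right R (X + c)
  linarith

lemma exists_norm_sub_le (H : Conf S F S' g f) {ε : ℝ} (hε : 0 < ε) :
    ∃ R, ∀ z ∈ gdom S F, R ≤ ‖z‖ → ‖g z - z‖ ≤ ε := by
  have := H.norm (closedBall_mem_nhds 0 hε)
  rw [mem_map, mem_inf_principal, ← comap_norm_atTop] at this
  obtain ⟨s, hs, hsub⟩ := this
  obtain ⟨R, hR⟩ := mem_atTop_sets.1 hs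
  exact ⟨R, fun z hz hRz => by simpa using hsub (hR ‖z‖ hRz) hz⟩

lemma exists_bound_g (H : Conf S F S' g f) (R : ℝ) :
    ∃ B, ∀ z ∈ gdom S F, ‖z‖ ≤ R → ‖g z‖ ≤ B := by
  obtain ⟨R0, h⟩ := H.exists_norm_sub_le one_pos
  exact ⟨max R0 R + 1, fun z hz hR => H.norm_g_le zero_le_one h (le_max_left _ _) hz
    (hR.trans (le_max_right _ _))⟩

lemma exists_bound_f (H : Conf S F S' g f) (R : ℝ) :
    ∃ B, ∀ w ∈ S'.dom, ‖w‖ ≤ R → ‖f w‖ ≤ B := by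
  obtain ⟨R0, h⟩ := H.exists_norm_sub_le one_pos
  exact ⟨_, fun z hz hR => H.norm_f_le h hz hR⟩

lemma exists_norm_f_sub_le (H : Conf S F S' g f) {ε : ℝ} (hε : 0 < ε) :
    ∃ R, ∀ w ∈ S'.dom, R ≤ ‖w‖ → ‖f w - w‖ ≤ ε := by
  obtain ⟨R, h⟩ := H.exists_norm_sub_le hε
  obtain ⟨B, hB⟩ := H.exists_bound_g R
  refine ⟨B + 1, fun w hw hRw => ?_⟩
  have h1 : R ≤ ‖f w‖ := by
    by_contra hlt
    have := hB (f w) (H.maps_f hw) (not_le.1 hlt).le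
    rw [H.right_inv w hw] at this
    linarith
  have := h (f w) (H.maps_f hw) h1
  rwa [H.right_inv w hw, norm_sub_rev] at this

/-! #### Boundary correspondence -/

lemma im_nonneg_of_tendsto {z : ℕ → ℂ} {p : ℂ} (hz : ∀ n, 0 < (z n).im)
    (h : Tendsto z atTop (𝓝 p)) : 0 ≤ p.im :=
  ge_of_tendsto' ((continuous_im.tendsto p).comp h) fun n => (hz n).le

lemma mem_set_of_pair_right (H : Conf S F S' g f) {z : ℕ → ℂ} {p q : ℂ}
    (hz : ∀ n, z n ∈ gdom S F) (hp : Tendsto z atTop (𝓝 p)) (hq : Tendsto (g ∘ z) atTop (𝓝 q))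
    (h : q ∈ S'.set) : p ∈ S.set :=
  H.homeo.mem_slits_of_tendsto H.hull.2.2.2 H.exists_bound_g (w := g ∘ z)
    (fun n => H.maps_g (hz n)) hq h (hp.congr fun n => (H.left_inv _ (hz n)).symm)

lemma mem_gdom_of_tendsto (H : Conf S F S' g f) {z : ℕ → ℂ} {p q : ℂ}
    (hz : ∀ n, z n ∈ gdom S F) (hp : Tendsto z atTop (𝓝 p)) (hq : Tendsto (g ∘ z) atTop (𝓝 q))
    (h : q ∈ S'.dom) : p ∈ gdom S F := by
  have h1 : Tendsto (f ∘ (g ∘ z)) atTop (𝓝 (f q)) :=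
    (H.holo_f.continuousOn.continuousAt (S'.isOpen_dom.mem_nhds h)).tendsto.comp hq
  have h2 : Tendsto z atTop (𝓝 (f q)) := h1.congr fun n => H.left_inv _ (hz n)
  rw [tendsto_nhds_unique hp h2]
  exact H.maps_f h

lemma im_eq_zero_of_tendsto (H : Conf S F S' g f) {z : ℕ → ℂ} {p q : ℂ}
    (hz : ∀ n, z n ∈ gdom S F) (hp : Tendsto z atTop (𝓝 p)) (hq : Tendsto (g ∘ z) atTop (𝓝 q))
    (h : p ∉ UHP \ F) : q.im = 0 := by
  by_contra hne
  have h0 := im_nonneg_of_tendsto (fun n => (H.maps_g (hz n)).1) hq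
  have hpos : 0 < q.im := lt_of_le_of_ne h0 (Ne.symm hne)
  by_cases hqS : q ∈ S'.set
  · exact h (H.set_subset (H.mem_set_of_pair_right hz hp hq hqS))
  · exact h (H.mem_gdom_of_tendsto hz hp hq ⟨hpos, hqS⟩).1

/-- The imaginary part of a mapping-out function vanishes at the complement of `UHP \ F`. -/
lemma tendsto_im_zero (H : Conf S F S' g f) {z : ℕ → ℂ} {p : ℂ}
    (hz : ∀ n, z n ∈ gdom S F) (hp : Tendsto z atTop (𝓝 p)) (h : p ∉ UHP \ F) :
    Tendsto (fun n => (g (z n)).im) atTop (𝓝 0) := by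
  refine tendsto_of_subseq_tendsto fun ns hns => ?_
  obtain ⟨R, hR⟩ := (Metric.isBounded_range_of_tendsto z hp).exists_norm_le
  obtain ⟨B, hB⟩ := H.exists_bound_g R
  obtain ⟨q, -, φ, hφ, hq⟩ := tendsto_subseq_of_bounded (x := fun n => g (z (ns n)))
    (isBounded_closedBall (x := (0 : ℂ)) (r := B)) (fun n => by
      simpa using hB _ (hz _) (hR _ ⟨_, rfl⟩))
  refine ⟨φ, ?_⟩
  have := H.im_eq_zero_of_tendsto (z := fun n => z (ns (φ n))) (fun n => hz _)
    (hp.comp (hns.comp hφ.tendsto_atTop)) hq h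
  rw [← this]
  exact (continuous_im.tendsto q).comp hq

instance simplyConnectedSpace_UHP : SimplyConnectedSpace UHP := by
  have : ContractibleSpace UHP := convex_UHP.contractibleSpace ⟨I, by simp [mem_UHP]⟩
  infer_instance

/-- Limits of `f` at a slit are in the slits. -/
lemma exists_mem_set_of_seg (H : Conf S F S' g f) {w : ℕ → ℂ} (hw : ∀ n, w n ∈ S'.dom)
    {p : ℂ} (hwp : Tendsto w atTop (𝓝 p)) (hp : p ∈ S'.set) :
    ∃ q ∈ S.set, ∃ φ : ℕ → ℕ, StrictMono φ ∧ Tendsto (fun n => f (w (φ n))) atTop (𝓝 q) := by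
  obtain ⟨R, hR⟩ := (Metric.isBounded_range_of_tendsto w hwp).exists_norm_le
  obtain ⟨B, hB⟩ := H.exists_bound_f R
  obtain ⟨q, -, φ, hφ, hq⟩ := tendsto_subseq_of_bounded (x := fun n => f (w n))
    (isBounded_closedBall (x := (0 : ℂ)) (r := B)) (fun n => by
      simpa using hB _ (hw _) (hR _ ⟨_, rfl⟩))
  refine ⟨q, ?_, φ, hφ, hq⟩
  exact H.homeo.mem_slits_of_tendsto H.hull.2.2.2 H.exists_bound_g (w := w ∘ φ)
    (fun n => hw _) (hwp.comp hφ.tendsto_atTop) hp hq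

lemma mem_set_of_pair_left (H : Conf S F S' g f) {z : ℕ → ℂ} {p q : ℂ}
    (hz : ∀ n, z n ∈ gdom S F) (hp : Tendsto z atTop (𝓝 p)) (hq : Tendsto (g ∘ z) atTop (𝓝 q))
    (h : p ∈ S.set) : q ∈ S'.set := by
  by_contra hqS
  obtain ⟨i, hi⟩ := S.mem_set.1 h
  obtain ⟨e, he, δ, hδ, hsub, hfar⟩ := H.homeo.symm.exists_ring_far hz hp hi hq hqS
  refine false_of_slitRing_unfolded isOpen_UHP simplyConnectedSpace_UHP S' S'.set_subset_UHP
    H.holo_f.continuousOn he hi (fun w hw hwp => (H.maps_f hw).2 (hwp ▸ h)) (S'.isOpen_nhd δ)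
    (S'.set_subset_nhd hδ) (H.holo_g.continuousOn.mono hsub)
    (fun z hz => ⟨(H.maps_g (hsub hz)).1, hfar z hz, H.left_inv z (hsub hz)⟩) fun k => ?_
  obtain ⟨e1, he1, h1⟩ := S.exists_disjoint_gauge'
  obtain ⟨e2, he2, h2⟩ := S.exists_gauge_subset H.hull.isOpen_compl H.set_subset
  set ε := min e (min e1 e2) with hε
  have hε0 : 0 < ε := by positivity
  replace h1 := h1 ε hε0 ((min_le_right _ _).trans (min_le_left _ _))
  replace h2 := h2 ε hε0 ((min_le_right _ _).trans (min_le_right _ _))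
  have hdich : ∀ l, ∃ η > 0, ∀ η', 0 < η' → η' ≤ η → S'.ring k η' ⊆ UHP \ S'.set ∧
      ((∀ z ∈ S'.ring k η', f z ∈ {w | S.gauge l w < ε}) ∨
        ∀ z ∈ S'.ring k η', f z ∉ closure {w | S.gauge l w < ε}) := fun l =>
    H.homeo.ring_dichotomy k (isOpen_slitGauge_lt _ _ _ _) (S.isCompact_frontier_gauge_lt l ε)
      (S.frontier_gauge_lt_subset hε0 h1 h2 l)
  obtain ⟨η1, hη1, hd⟩ := exists_pos_forall_lt_of_finite hdich
  set η := min η1 δ with hη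
  have hηpos : 0 < η := by positivity
  replace hd := hd η hηpos (min_le_left _ _)
  have hring : S'.ring k η ⊆ S'.dom ∨ IsEmpty (Fin S.n) := by
    by_cases hn : IsEmpty (Fin S.n)
    · exact Or.inr hn
    · rw [not_isEmpty_iff] at hn
      exact Or.inl (hd (Classical.arbitrary _)).1
  rcases hring with hring | hn
  swap
  · exact (hn.false i).elim
  -- a sequence in the ring tending to the slit
  have hwpt : ∀ n : ℕ, (⟨S'.b k + η / (n + 1) / 2, S'.y k⟩ : ℂ) ∈ S'.ring k η := fun n => by
    have h3 := mem_slitRing (y := S'.y k) (S'.a_lt_b k).le (e := η / (n + 1)) (by positivity)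
    exact ⟨h3.1, h3.2.trans_le (div_le_self hηpos.le (by linarith [n.cast_nonneg (α := ℝ)]))⟩
  obtain ⟨q', hq', φ, hφ, hlim⟩ := H.exists_mem_set_of_seg (fun n => hring (hwpt n))
    (p := ⟨S'.b k, S'.y k⟩) (by
      have h0 : Tendsto (fun n : ℕ => S'.b k + η / (n + 1) / 2) atTop (𝓝 (S'.b k)) := by
        have : Tendsto (fun n : ℕ => η / 2 * (1 / ((n : ℝ) + 1))) atTop (𝓝 (η / 2 * 0)) :=
          tendsto_one_div_add_atTop_nhds_zero_nat.const_mul _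
        have := this.const_add (S'.b k)
        rw [mul_zero, add_zero] at this
        refine this.congr fun n => ?_
        ring
      have h1 : Continuous fun x : ℝ => (⟨x, S'.y k⟩ : ℂ) := by
        have : (fun x : ℝ => (⟨x, S'.y k⟩ : ℂ)) = fun x : ℝ => (x : ℂ) + S'.y k * I := by
          ext x; exact Complex.ext (by simp) (by simp)
        rw [this]; fun_prop
      exact (h1.tendsto _).comp h0)
    (S'.seg_subset_set k ⟨rfl, (S'.a_lt_b k).le, le_rfl⟩)
  obtain ⟨l, hl⟩ := S.mem_set.1 hq'
  have hl' : S.gauge l q' < ε := (mem_slit_iff.1 hl).trans_lt hε0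
  have hall : ∀ w ∈ S'.ring k η, f w ∈ {w | S.gauge l w < ε} := by
    rcases (hd l).2 with h | h
    · exact h
    · obtain ⟨n, hn⟩ := (hlim.eventually ((isOpen_slitGauge_lt _ _ _ ε).mem_nhds (show q' ∈ {w | S.gauge l w < ε} from hl'))).exists
      exact (h _ (hwpt _) (subset_closure hn)).elim
  refine ⟨η, hηpos, {w | S.gauge l w < ε}, convex_slitGauge_lt _ _ _ _, ?_, hall⟩
  by_cases hil : i = l
  · exfalso
    subst hil
    have h3 := hwpt 0
    set w : ℂ := ⟨S'.b k + η / ((0 : ℕ) + 1) / 2, S'.y k⟩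
    have hfw := H.maps_f (hring h3)
    refine hfar (f w) ⟨slitGauge_pos_iff.2 fun h => hfw.2 (S.seg_subset_set i h),
      lt_of_lt_of_le (hall w h3) (min_le_left _ _)⟩ ?_
    rw [H.right_inv w (hring h3)]
    exact S'.mem_nhd.2 ⟨k, h3.2.trans_le (min_le_right _ _)⟩
  · have := h1 i l hil p ((mem_slit_iff.1 hi).trans hε0.le)
    simp only [mem_ofPred_eq, not_lt]; exact this.le

end Conf

end SlitLoewner

namespace SlitLoewner

/-! ### Univalent functions and the maximum principle -/

/-- Univalent functions are locally open. -/
lemma nhds_le_map_of_injOn {U : Set ℂ} (hU : IsOpen U) {g : ℂ → ℂ}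
    (hg : DifferentiableOn ℂ g U) (hi : InjOn g U) {z : ℂ} (hz : z ∈ U) :
    𝓝 (g z) ≤ map g (𝓝 z) := by
  refine ((hg.analyticOnNhd hU) z hz).eventually_constant_or_nhds_le_map_nhds.resolve_left
    fun hc => ?_
  have h1 : ∀ᶠ w in 𝓝[≠] z, g w = g z ∧ w ∈ U :=
    (hc.and (hU.mem_nhds hz)).filter_mono nhdsWithin_le_nhds
  obtain ⟨w, ⟨hw, hwU⟩, hne⟩ := (h1.and self_mem_nhdsWithin).exists
  exact hne (hi hwU hz hw)

/-- The inverse of a univalent function is holomorphic. -/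
lemma differentiableOn_inverse {U V : Set ℂ} (hU : IsOpen U) (hV : IsOpen V) {g f : ℂ → ℂ}
    (hg : DifferentiableOn ℂ g U) (hf : MapsTo f V U) (hl : ∀ z ∈ U, f (g z) = z)
    (hr : ∀ w ∈ V, g (f w) = w) : DifferentiableOn ℂ f V := by
  have hi : InjOn g U := fun z hz w hw h => by rw [← hl z hz, ← hl w hw, h]
  have hc : ∀ w ∈ V, ContinuousAt f w := by
    intro w hw s hs
    have h1 := nhds_le_map_of_injOn hU hg hi (hf hw)
    rw [hr w hw] at h1
    have h2 : g '' (s ∩ U) ∈ 𝓝 w :=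
      h1 (image_mem_map (inter_mem hs (hU.mem_nhds (hf hw))))
    rw [mem_map]
    refine mem_of_superset h2 ?_
    rintro _ ⟨z, hz, rfl⟩
    show f (g z) ∈ s
    rw [hl z hz.2]; exact hz.1
  have hd : ∀ w ∈ V, deriv g (f w) ≠ 0 → DifferentiableAt ℂ f w := by
    intro w hw hne
    have h1 : HasDerivAt g (deriv g (f w)) (f w) :=
      (hg.differentiableAt (hU.mem_nhds (hf hw))).hasDerivAt
    exact (h1.of_local_left_inverse (hc w hw) hne
      ((hV.eventually_mem hw).mono fun v hv => hr v hv)).differentiableAt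
  intro w hw
  refine DifferentiableAt.differentiableWithinAt ?_
  have hga : AnalyticAt ℂ (deriv g) (f w) := ((hg.analyticOnNhd hU) _ (hf hw)).deriv
  have hne : ∀ᶠ z in 𝓝[≠] f w, deriv g z ≠ 0 := by
    refine hga.eventually_eq_zero_or_eventually_ne_zero.resolve_left fun h0 => ?_
    obtain ⟨r, hr0, hball⟩ := Metric.mem_nhds_iff.1 (inter_mem h0 (hU.mem_nhds (hf hw)))
    have hz1 : f w + (r / 2 : ℝ) ∈ ball (f w) r := by
      simp only [mem_ball, dist_self_add_left, norm_real, Real.norm_eq_abs]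
      rw [abs_of_pos] <;> linarith
    have := (convex_ball (f w) r).is_const_of_fderivWithin_eq_zero (𝕜 := ℂ) (f := g)
      (hg.mono fun z hz => (hball hz).2) (fun z hz => by
        rw [fderivWithin_of_isOpen isOpen_ball hz]
        ext
        simpa using (hball hz).1) (mem_ball_self hr0) hz1
    have := hi (hf hw) (hball hz1).2 this
    simp at this
    exact hr0.ne' this
  have hfi : InjOn f V := fun z hz v hv h => by rw [← hr z hz, ← hr v hv, h]
  have h1 : ∀ᶠ v in 𝓝[≠] w, v ∈ V ∧ deriv g (f v) ≠ 0 := by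
    have h2 : Tendsto f (𝓝[≠] w) (𝓝[≠] f w) := by
      refine tendsto_nhdsWithin_iff.2 ⟨(hc w hw).mono_left nhdsWithin_le_nhds, ?_⟩
      have : ∀ᶠ v in 𝓝[≠] w, v ∈ V := (hV.eventually_mem hw).filter_mono
        nhdsWithin_le_nhds
      filter_upwards [this, self_mem_nhdsWithin] with v hv hvw
      exact fun h => hvw (hfi hv hw h)
    exact ((hV.eventually_mem hw).filter_mono nhdsWithin_le_nhds).and
      (h2.eventually hne)
  exact (analyticAt_of_differentiable_on_punctured_nhds_of_continuousAt
    (h1.mono fun v hv => hd v hv.1 hv.2) (hc w hw)).differentiableAt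

/-- A maximum principle for imaginary parts, allowing finitely many exceptional boundary values. -/
lemma im_le_of_boundary {X : Set ℂ} (hX : IsOpen X) (hXc : IsPreconnected X)
    (hXu : ∀ R : ℝ, ∃ z ∈ X, R ≤ ‖z‖) {h : ℂ → ℂ} (hh : DifferentiableOn ℂ h X)
    {B : ℝ} (hB : ∀ z ∈ X, ‖h z‖ ≤ B) (hinf : ∀ ε > 0, ∃ R, ∀ z ∈ X, R ≤ ‖z‖ → ‖h z‖ ≤ ε)
    {M : ℝ} (hM : 0 ≤ M) {E : Set ℝ} (hE : E.Finite)
    (hbd : ∀ w : ℕ → ℂ, (∀ n, w n ∈ X) → ∀ p, p ∉ X → Tendsto w atTop (𝓝 p) →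
      ∀ q, Tendsto (h ∘ w) atTop (𝓝 q) → q.im ∈ E ∨ q.im ≤ M) :
    ∀ z ∈ X, (h z).im ≤ M := by
  intro z0 hz0
  by_contra hlt
  push Not at hlt
  rcases (hh.analyticOnNhd hX).is_constant_or_isOpen hXc with ⟨c, hc⟩ | hopen
  · have hc0 : ‖c‖ ≤ 0 := le_of_forall_pos_le_add fun ε hε => by
      obtain ⟨R, hR⟩ := hinf ε hε
      obtain ⟨z, hz, hzR⟩ := hXu R
      have := hR z hz hzR
      rw [hc z hz] at this; linarith
    rw [hc z0 hz0, norm_le_zero_iff.1 hc0] at hlt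
    exact absurd hlt (not_lt.2 hM)
  have hYo : IsOpen (h '' X) := hopen X Subset.rfl hX
  -- a value with generic imaginary part
  obtain ⟨q1, hq1, hq1M, hq1E⟩ : ∃ q ∈ h '' X, M < q.im ∧ q.im ∉ E := by
    have h1 : h '' X ∩ {q | M < q.im} ∈ 𝓝 (h z0) :=
      inter_mem (hYo.mem_nhds ⟨z0, hz0, rfl⟩)
        ((isOpen_lt continuous_const continuous_im).mem_nhds hlt)
    have h2 : Tendsto (fun t : ℝ => h z0 + t * I) (𝓝[≠] 0) (𝓝 (h z0)) := by
      have : Tendsto (fun t : ℝ => h z0 + t * I) (𝓝 0) (𝓝 (h z0 + (0 : ℝ) * I)) :=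
        Continuous.tendsto (by fun_prop) 0
      rw [ofReal_zero, zero_mul, add_zero] at this
      exact this.mono_left nhdsWithin_le_nhds
    have h3 : ∀ᶠ t in 𝓝[≠] (0 : ℝ), (h z0).im + t ∉ E := by
      have hfin : ((fun t : ℝ => (h z0).im + t) ⁻¹' E).Finite :=
        hE.preimage fun a _ b _ hab => by simpa using hab
      have := (hfin.subset (sdiff_subset (t := {0}))).isClosed.isOpen_compl.mem_nhds
        (show (0 : ℝ) ∈ ((fun t : ℝ => (h z0).im + t) ⁻¹' E \ {0})ᶜ by simp)
      filter_upwards [nhdsWithin_le_nhds this, self_mem_nhdsWithin] with t ht ht0 hmem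
      exact ht ⟨hmem, ht0⟩
    obtain ⟨t, ht1, ht2⟩ := ((h2.eventually_mem h1).and h3).exists
    exact ⟨_, ht1.1, ht1.2, by simpa using ht2⟩
  obtain ⟨r, hr, hball⟩ := Metric.isOpen_iff.1 (hE.isClosed.isOpen_compl.inter
    (isOpen_Ioi (a := M))) q1.im ⟨hq1E, hq1M⟩
  set U : Set ℂ := {q | q1.im - r < q.im} ∩ {q | q.im < q1.im + r} with hU
  have hUim : ∀ q ∈ U, M < q.im ∧ q.im ∉ E := fun q hq => by
    have := hball (show q.im ∈ ball q1.im r by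
      rw [Real.ball_eq_Ioo]; exact ⟨hq.1, hq.2⟩)
    exact ⟨this.2, this.1⟩
  have hUpre : IsPreconnected U :=
    ((convex_halfSpace_im_gt _).inter (convex_halfSpace_im_lt _)).isPreconnected
  have hsub : U ⊆ h '' X := by
    refine hUpre.subset_of_closure_inter_subset hYo ⟨q1, ⟨?_, ?_⟩, hq1⟩ ?_
    · simp only [mem_ofPred_eq]; linarith
    · simp only [mem_ofPred_eq]; linarith
    rintro q ⟨hqc, hqU⟩
    obtain ⟨v, hv, hvq⟩ := mem_closure_iff_seq_limit.1 hqc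
    choose w hwX hwv using hv
    have hq := hUim q hqU
    have hvq' : Tendsto (fun n => h (w n)) atTop (𝓝 q) := hvq.congr fun n => (hwv n).symm
    have hqpos : 0 < ‖q‖ := norm_pos_iff.2 fun h0 => by
      rw [h0] at hq; exact absurd hq.1 (not_lt.2 hM)
    obtain ⟨R, hR⟩ := hinf (‖q‖ / 2) (by linarith)
    have hev : ∀ᶠ n in atTop, w n ∈ closedBall (0 : ℂ) R := by
      have : ∀ᶠ n in atTop, ‖q‖ / 2 < ‖h (w n)‖ := hvq'.norm.eventually_const_lt (by linarith)
      filter_upwards [this] with n hn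
      rw [mem_closedBall_zero_iff]
      by_contra hc
      exact absurd (hR _ (hwX n) (not_le.1 hc).le) (not_le.2 hn)
    obtain ⟨p, -, φ, hφ, hp⟩ := tendsto_subseq_of_frequently_bounded
      (isBounded_closedBall (x := (0 : ℂ)) (r := R)) hev.frequently
    by_cases hpX : p ∈ X
    · refine ⟨p, hpX, tendsto_nhds_unique ?_ (hvq'.comp hφ.tendsto_atTop)⟩
      exact (hh.continuousOn.continuousAt (hX.mem_nhds hpX)).tendsto.comp hp
    · rcases hbd (w ∘ φ) (fun n => hwX _) p hpX hp q (hvq'.comp hφ.tendsto_atTop) with h4 | h4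
      · exact absurd h4 hq.2
      · exact absurd hq.1 (not_lt.2 h4)
  obtain ⟨z, hz, hzq⟩ := hsub (show (⟨|B| + 1, q1.im⟩ : ℂ) ∈ U from
    ⟨by simp only [mem_ofPred_eq]; linarith, by simp only [mem_ofPred_eq]; linarith⟩)
  have h5 := hB z hz
  rw [hzq] at h5
  have h6 := abs_re_le_norm (⟨|B| + 1, q1.im⟩ : ℂ)
  have h7 := le_abs_self B
  simp only at h6
  rw [abs_of_pos (by positivity)] at h6
  linarith

lemma isHHull_empty : IsHHull ∅ := by
  refine ⟨empty_subset _, by simp, ?_, ?_⟩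
  · rw [sdiff_empty]
    exact ⟨⟨I, by simp [mem_UHP]⟩, convex_UHP.isPreconnected⟩
  · rw [sdiff_empty]; exact Conf.simplyConnectedSpace_UHP

lemma conf_id (S : SlitSys) : Conf S ∅ S id id where
  hull := isHHull_empty
  bdd := isBounded_empty
  sep := by simp
  holo_g := differentiableOn_id
  holo_f := differentiableOn_id
  maps_g := by intro z hz; simpa [gdom, SlitSys.dom] using hz
  maps_f := by intro z hz; simpa [gdom, SlitSys.dom] using hz
  left_inv := fun _ _ => rfl
  right_inv := fun _ _ => rfl
  norm := by simpa using tendsto_const_nhds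

lemma gdom_anti (S : SlitSys) {F F' : Set ℂ} (h : F ⊆ F') : gdom S F' ⊆ gdom S F :=
  sdiff_subset_sdiff_left (sdiff_subset_sdiff_right h)

namespace SlitSys

/-- The heights of the slits. -/
def heights (S : SlitSys) : Set ℝ := range S.y

lemma finite_heights (S : SlitSys) : S.heights.Finite := finite_range _

lemma im_mem_heights (S : SlitSys) {z : ℂ} (hz : z ∈ S.set) : z.im ∈ S.heights := by
  obtain ⟨j, hj⟩ := S.mem_set.1 hz
  exact ⟨j, hj.1.symm⟩

lemma exists_norm_le_mem_dom (S : SlitSys) (R : ℝ) : ∃ z ∈ S.dom, R ≤ ‖z‖ := by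
  obtain ⟨Y0, hY0, h⟩ := (conf_id S).exists_mul_I_mem
  have hpos : 0 < max Y0 R := lt_max_of_lt_left hY0
  have hn : ‖((max Y0 R : ℝ) * I : ℂ)‖ = max Y0 R := by simp [abs_of_pos hpos]
  refine ⟨(max Y0 R : ℝ) * I, ?_, (le_max_right _ _).trans hn.ge⟩
  have := h ((max Y0 R : ℝ) * I) ((le_max_left _ _).trans hn.ge) (by simpa using hpos)
  simpa [gdom, SlitSys.dom] using this

end SlitSys

namespace Conf

variable {S S₁ S₂ : SlitSys} {F₁ F₂ : Set ℂ} {g₁ f₁ g₂ f₂ : ℂ → ℂ}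

/-- The transition map is close to the identity near infinity. -/
lemma exists_norm_trans_sub_le (H₁ : Conf S F₁ S₁ g₁ f₁) (H₂ : Conf S F₂ S₂ g₂ f₂) (h : F₁ ⊆ F₂)
    {ε : ℝ} (hε : 0 < ε) : ∃ R, ∀ w ∈ S₂.dom, R ≤ ‖w‖ → ‖g₁ (f₂ w) - w‖ ≤ ε := by
  obtain ⟨R1, hR1⟩ := H₁.exists_norm_sub_le (half_pos hε)
  obtain ⟨R2, hR2⟩ := H₂.exists_norm_f_sub_le (half_pos hε)
  refine ⟨max R2 (R1 + ε), fun w hw hR => ?_⟩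
  have h1 := hR2 w hw ((le_max_left _ _).trans hR)
  have h2 : R1 ≤ ‖f₂ w‖ := by
    have := norm_sub_norm_le w (w - f₂ w)
    rw [sub_sub_cancel, norm_sub_rev] at this
    have := (le_max_right _ _).trans hR
    linarith
  have h3 := hR1 _ (gdom_anti S h (H₂.maps_f hw)) h2
  calc ‖g₁ (f₂ w) - w‖ = ‖(g₁ (f₂ w) - f₂ w) + (f₂ w - w)‖ := by ring_nf
    _ ≤ ε / 2 + ε / 2 := (norm_add_le _ _).trans (add_le_add h3 h1)
    _ = ε := by ring

lemma exists_bound_trans_sub (H₁ : Conf S F₁ S₁ g₁ f₁) (H₂ : Conf S F₂ S₂ g₂ f₂) (h : F₁ ⊆ F₂) :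
    ∃ B, ∀ w ∈ S₂.dom, ‖g₁ (f₂ w) - w‖ ≤ B := by
  obtain ⟨R, hR⟩ := H₁.exists_norm_trans_sub_le H₂ h one_pos
  obtain ⟨B, hB⟩ := H₂.exists_bound_f R
  obtain ⟨B', hB'⟩ := H₁.exists_bound_g B
  refine ⟨max 1 (B' + R), fun w hw => ?_⟩
  rcases le_total R ‖w‖ with hw' | hw'
  · exact (hR w hw hw').trans (le_max_left _ _)
  · have := hB' _ (gdom_anti S h (H₂.maps_f hw)) (hB w hw hw')
    exact (norm_sub_le _ _).trans ((add_le_add this hw').trans (le_max_right _ _))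

lemma differentiableOn_trans (H₁ : Conf S F₁ S₁ g₁ f₁) (H₂ : Conf S F₂ S₂ g₂ f₂) (h : F₁ ⊆ F₂) :
    DifferentiableOn ℂ (fun w => g₁ (f₂ w)) S₂.dom :=
  H₁.holo_g.comp H₂.holo_f fun _ hw => gdom_anti S h (H₂.maps_f hw)

/-- At a slit, the transition map has only finitely many possible limiting height differences. -/
lemma im_mem_of_tendsto_trans (H₁ : Conf S F₁ S₁ g₁ f₁) (H₂ : Conf S F₂ S₂ g₂ f₂) (h : F₁ ⊆ F₂)
    {w : ℕ → ℂ} (hw : ∀ n, w n ∈ S₂.dom) {p q : ℂ} (hp : Tendsto w atTop (𝓝 p))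
    (hpS : p ∈ S₂.set) (hq : Tendsto (fun n => g₁ (f₂ (w n)) - w n) atTop (𝓝 q)) :
    q.im ∈ image2 (fun x y => x - y) S₁.heights S₂.heights := by
  obtain ⟨z, hz, φ, hφ, hlim⟩ := H₂.exists_mem_set_of_seg hw hp hpS
  have h1 : Tendsto (fun n => g₁ (f₂ (w (φ n)))) atTop (𝓝 (q + p)) := by
    refine ((hq.add hp).comp hφ.tendsto_atTop).congr fun n => ?_
    simp
  have h2 := H₁.mem_set_of_pair_left (z := fun n => f₂ (w (φ n)))
    (fun n => gdom_anti S h (H₂.maps_f (hw _))) hlim h1 hz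
  refine ⟨_, S₁.im_mem_heights h2, _, S₂.im_mem_heights hpS, by simp⟩

/-- The imaginary part increases under the transition map. -/
lemma im_le_im_trans (H₁ : Conf S F₁ S₁ g₁ f₁) (H₂ : Conf S F₂ S₂ g₂ f₂) (h : F₁ ⊆ F₂)
    {w : ℂ} (hw : w ∈ S₂.dom) : w.im ≤ (g₁ (f₂ w)).im := by
  obtain ⟨B, hB⟩ := H₁.exists_bound_trans_sub H₂ h
  have := im_le_of_boundary S₂.isOpen_dom S₂.isPreconnected_dom S₂.exists_norm_le_mem_dom
    (h := fun w => w - g₁ (f₂ w)) (differentiableOn_id.sub (H₁.differentiableOn_trans H₂ h))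
    (B := B) (fun z hz => by rw [norm_sub_rev]; exact hB z hz) (fun ε hε => by
      obtain ⟨R, hR⟩ := H₁.exists_norm_trans_sub_le H₂ h hε
      exact ⟨R, fun z hz hRz => by rw [norm_sub_rev]; exact hR z hz hRz⟩) le_rfl
    ((S₁.finite_heights.image2 (fun x y => x - y) S₂.finite_heights).image Neg.neg) ?_ w hw
  · simp only [sub_im] at this; linarith
  intro w hw p hp hwp q hq
  have hq' : Tendsto (fun n => g₁ (f₂ (w n)) - w n) atTop (𝓝 (-q)) :=
    hq.neg.congr fun n => by simp
  by_cases hpS : p ∈ S₂.set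
  · left
    exact ⟨_, H₁.im_mem_of_tendsto_trans H₂ h hw hwp hpS hq', by simp⟩
  · right
    have h0 : p.im ≤ 0 := not_lt.1 fun h0 => hp ⟨h0, hpS⟩
    refine (le_of_tendsto_of_tendsto' ((continuous_im.tendsto q).comp hq)
      ((continuous_im.tendsto p).comp hwp) fun n => ?_).trans h0
    have := S₁.im_pos (H₁.maps_g (gdom_anti S h (H₂.maps_f (hw n))))
    simp only [Function.comp, sub_im]; linarith

/-- If `g₁` has small imaginary part on the difference of the hulls, then the transition map
increases imaginary parts only a little. -/
lemma im_trans_le (H₁ : Conf S F₁ S₁ g₁ f₁) (H₂ : Conf S F₂ S₂ g₂ f₂) (h : F₁ ⊆ F₂) {M : ℝ}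
    (hM : 0 ≤ M) (hK : ∀ z ∈ (F₂ \ F₁) ∩ closure (gdom S F₂), (g₁ z).im ≤ M)
    {w : ℂ} (hw : w ∈ S₂.dom) : (g₁ (f₂ w)).im ≤ w.im + M := by
  obtain ⟨B, hB⟩ := H₁.exists_bound_trans_sub H₂ h
  have := im_le_of_boundary S₂.isOpen_dom S₂.isPreconnected_dom S₂.exists_norm_le_mem_dom
    (h := fun w => g₁ (f₂ w) - w) ((H₁.differentiableOn_trans H₂ h).sub differentiableOn_id)
    hB (fun ε hε => H₁.exists_norm_trans_sub_le H₂ h hε) hM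
    (S₁.finite_heights.image2 (fun x y => x - y) S₂.finite_heights) ?_ w hw
  · simp only [sub_im] at this; linarith
  intro w hw p hp hwp q hq
  by_cases hpS : p ∈ S₂.set
  · exact Or.inl (H₁.im_mem_of_tendsto_trans H₂ h hw hwp hpS hq)
  right
  have h0 : p.im ≤ 0 := not_lt.1 fun h0 => hp ⟨h0, hpS⟩
  have h0' : p.im = 0 := le_antisymm h0 (im_nonneg_of_tendsto (fun n => (hw n).1) hwp)
  obtain ⟨R, hR⟩ := (Metric.isBounded_range_of_tendsto w hwp).exists_norm_le
  obtain ⟨B', hB'⟩ := H₂.exists_bound_f R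
  obtain ⟨z, -, φ, hφ, hz⟩ := tendsto_subseq_of_bounded (x := fun n => f₂ (w n))
    (isBounded_closedBall (x := (0 : ℂ)) (r := B')) (fun n => by
      simpa using hB' _ (hw _) (hR _ ⟨_, rfl⟩))
  have hmem : ∀ n, f₂ (w (φ n)) ∈ gdom S F₂ := fun n => H₂.maps_f (hw _)
  have hmem1 : ∀ n, f₂ (w (φ n)) ∈ gdom S F₁ := fun n => gdom_anti S h (hmem n)
  have hg2 : Tendsto (g₂ ∘ fun n => f₂ (w (φ n))) atTop (𝓝 p) :=
    (hwp.comp hφ.tendsto_atTop).congr fun n => (H₂.right_inv _ (hw _)).symm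
  have hg1 : Tendsto (g₁ ∘ fun n => f₂ (w (φ n))) atTop (𝓝 (q + p)) := by
    refine ((hq.add hwp).comp hφ.tendsto_atTop).congr fun n => ?_
    simp
  have hzS : z ∉ S.set := fun hzS =>
    hpS (H₂.mem_set_of_pair_left (z := fun n => f₂ (w (φ n))) hmem hz hg2 hzS)
  have hqp : (q + p).im = q.im := by simp [h0']
  by_cases hz1 : z ∈ UHP \ F₁
  · have hzg : z ∈ gdom S F₁ := ⟨hz1, hzS⟩
    have hlim : Tendsto (g₁ ∘ fun n => f₂ (w (φ n))) atTop (𝓝 (g₁ z)) :=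
      (H₁.holo_g.continuousOn.continuousAt (H₁.isOpen_gdom.mem_nhds hzg)).tendsto.comp hz
    have hzF2 : z ∈ F₂ := by
      by_contra hzF2
      have hz2 : z ∈ gdom S F₂ := ⟨⟨hz1.1, hzF2⟩, hzS⟩
      have hl2 : Tendsto (g₂ ∘ fun n => f₂ (w (φ n))) atTop (𝓝 (g₂ z)) :=
        (H₂.holo_g.continuousOn.continuousAt (H₂.isOpen_gdom.mem_nhds hz2)).tendsto.comp hz
      rw [tendsto_nhds_unique hg2 hl2] at hp
      exact hp (H₂.maps_g hz2)
    have := hK z ⟨⟨hzF2, hz1.2⟩, mem_closure_of_tendsto hz (Eventually.of_forall hmem)⟩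
    rw [← tendsto_nhds_unique hg1 hlim, hqp] at this
    exact this
  · have := H₁.im_eq_zero_of_tendsto hmem1 hz hg1 hz1
    rw [hqp] at this
    rw [this]; exact hM

/-- Monotonicity of the imaginary part in the hull. -/
lemma im_anti (H₁ : Conf S F₁ S₁ g₁ f₁) (H₂ : Conf S F₂ S₂ g₂ f₂) (h : F₁ ⊆ F₂)
    {z : ℂ} (hz : z ∈ gdom S F₂) : (g₂ z).im ≤ (g₁ z).im := by
  have := H₁.im_le_im_trans H₂ h (H₂.maps_g hz)
  rwa [H₂.left_inv z hz] at this

lemma im_le_im_self (H₂ : Conf S F₂ S₂ g₂ f₂) {z : ℂ} (hz : z ∈ gdom S F₂) :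
    (g₂ z).im ≤ z.im :=
  (conf_id S).im_anti H₂ (empty_subset _) hz

end Conf
end SlitLoewner

namespace SlitLoewner

/-! ### Holomorphic functions with nonnegative imaginary part -/

lemma norm_deriv_le_of_im_nonneg {h : ℂ → ℂ} {c : ℂ} {d : ℝ} (hd : 0 < d)
    (hh : DifferentiableOn ℂ h (ball c d)) (hpos : ∀ z ∈ ball c d, 0 ≤ (h z).im) :
    ‖deriv h c‖ ≤ 2 * (h c).im / d := by
  have hc : c ∈ ball c d := mem_ball_self hd
  have key : ∀ ε > 0, ‖deriv h c‖ ≤ 2 * ((h c).im + ε) / d := by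
    intro ε hε
    have hv : 0 < (h c).im + ε := add_pos_of_nonneg_of_pos (hpos c hc) hε
    set k : ℂ := h c - ε * I * 2 - 2 * (h c).im * I with hk
    have hden : ∀ z ∈ ball c d, h z - k ≠ 0 := by
      intro z hz h0
      have := congrArg Complex.im h0
      simp [hk] at this
      linarith [hpos z hz]
    have hle : ∀ z ∈ ball c d, ‖(h z - h c) / (h z - k)‖ ≤ 1 := by
      intro z hz
      rw [norm_div, div_le_one (norm_pos_iff.2 (hden z hz)), norm_def, norm_def]
      refine Real.sqrt_le_sqrt ?_
      simp only [normSq_apply, hk, sub_re, sub_im, mul_re, mul_im, ofReal_re, ofReal_im, I_re,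
        I_im, re_ofNat, im_ofNat]
      nlinarith [hpos z hz, hpos c hc]
    have hdiff : DifferentiableOn ℂ (fun z => (h z - h c) / (h z - k)) (ball c d) :=
      (hh.sub_const _).div (hh.sub_const _) hden
    have h1 : ‖deriv (fun z => (h z - h c) / (h z - k)) c‖ ≤ 1 / d := by
      refine norm_deriv_le_div_of_mapsTo_ball hdiff (fun z hz => ?_) hd
      simp only [sub_self, zero_div, mem_closedBall, dist_zero_right]
      exact hle z hz
    have hdc : DifferentiableAt ℂ h c := hh.differentiableAt (isOpen_ball.mem_nhds hc)
    have h2 : deriv (fun z => (h z - h c) / (h z - k)) c = deriv h c / (h c - k) := by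
      have := ((hdc.hasDerivAt.sub_const (h c)).div (hdc.hasDerivAt.sub_const k)
        (hden c hc)).deriv
      rw [sub_self, zero_mul, sub_zero] at this
      rw [show (fun z => (h z - h c) / (h z - k)) = (fun z => h z - h c) / (fun z => h z - k)
        from rfl, this]
      field_simp [hden c hc]
    have h3 : ‖h c - k‖ = 2 * ((h c).im + ε) := by
      have : h c - k = ((2 * ((h c).im + ε) : ℝ) : ℂ) * I := by
        simp only [hk]; push_cast; ring
      rw [this, norm_mul, norm_I, mul_one, norm_real, Real.norm_eq_abs, abs_of_pos (by linarith)]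
    rw [h2, norm_div, h3, div_le_iff₀ (by linarith)] at h1
    rw [le_div_iff₀ hd]
    rw [div_mul_eq_mul_div, le_div_iff₀ hd] at h1
    linarith
  have ht : Tendsto (fun ε : ℝ => 2 * ((h c).im + ε) / d) (𝓝[>] 0)
      (𝓝 (2 * ((h c).im + 0) / d)) :=
    (Continuous.tendsto (by fun_prop) 0).mono_left nhdsWithin_le_nhds
  rw [add_zero] at ht
  exact ge_of_tendsto ht (eventually_mem_nhdsWithin.mono fun ε hε => key ε hε)

/-- Harnack's inequality along a segment. -/
lemma harnack_segment {X : Set ℂ} {h : ℂ → ℂ} (hh : DifferentiableOn ℂ h X)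
    (hpos : ∀ z ∈ X, 0 ≤ (h z).im) {p q : ℂ} {d : ℝ} (hd : 0 < d)
    (hX : ∀ x ∈ segment ℝ p q, ball x d ⊆ X) {k : ℝ} (hk : 2 * ‖q - p‖ / d ≤ k) :
    (h q).im ≤ (h p).im * Real.exp k ∧ ‖h q - h p‖ ≤ k * ((h p).im * Real.exp k) := by
  have hk0 : 0 ≤ 2 * ‖q - p‖ / d := by positivity
  have hdiff : ∀ x ∈ segment ℝ p q, DifferentiableAt ℂ h x := fun x hx =>
    hh.differentiableAt (mem_of_superset (ball_mem_nhds x hd) (hX x hx))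
  have hder : ∀ x ∈ segment ℝ p q, ‖deriv h x‖ ≤ 2 * (h x).im / d := fun x hx =>
    norm_deriv_le_of_im_nonneg hd (hh.mono (hX x hx)) fun z hz => hpos z (hX x hx hz)
  have hmem : ∀ x ∈ segment ℝ p q, 0 ≤ (h x).im := fun x hx =>
    hpos x (hX x hx (mem_ball_self hd))
  have him : ∀ τ ∈ Icc (0 : ℝ) 1, (h (AffineMap.lineMap p q τ)).im ≤
      (h p).im * Real.exp (2 * ‖q - p‖ / d * τ) := by
    have hseg : ∀ τ ∈ Icc (0 : ℝ) 1, AffineMap.lineMap p q τ ∈ segment ℝ p q := fun τ hτ => by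
      rw [segment_eq_image_lineMap]; exact ⟨τ, hτ, rfl⟩
    have hdv : ∀ τ ∈ Icc (0 : ℝ) 1, HasDerivAt (fun τ : ℝ => (h (AffineMap.lineMap p q τ)).im)
        ((q - p) * deriv h (AffineMap.lineMap p q τ)).im τ := by
      intro τ hτ
      have h1 : HasDerivAt (fun τ : ℝ => (AffineMap.lineMap p q τ : ℂ)) (q - p) τ := by
        have := AffineMap.hasDerivAt_lineMap (a := p) (b := q) (x := τ)
        simpa using this
      have h2 := (hdiff _ (hseg τ hτ)).hasDerivAt.scomp τ h1
      have h3 := (imCLM.hasFDerivAt.comp_hasDerivAt τ h2)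
      rw [smul_eq_mul] at h3
      exact h3
    intro τ hτ
    have hg := norm_le_gronwallBound_of_norm_deriv_right_le (f := fun τ : ℝ =>
      (h (AffineMap.lineMap p q τ)).im) (f' := fun τ =>
        ((q - p) * deriv h (AffineMap.lineMap p q τ)).im) (δ := (h p).im)
      (K := 2 * ‖q - p‖ / d) (ε := 0) (a := 0) (b := 1)
      (fun τ hτ => (hdv τ hτ).continuousAt.continuousWithinAt)
      (fun τ hτ => (hdv τ ⟨hτ.1, hτ.2.le⟩).hasDerivWithinAt) (by
        simp only [AffineMap.lineMap_apply_zero, Real.norm_eq_abs]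
        rw [abs_of_nonneg (hmem p (left_mem_segment ℝ p q))])
      (fun τ hτ => by
        have hs := hseg τ ⟨hτ.1, hτ.2.le⟩
        rw [add_zero, Real.norm_eq_abs, Real.norm_eq_abs, abs_of_nonneg (hmem _ hs)]
        refine (abs_im_le_norm _).trans ?_
        rw [norm_mul]
        calc ‖q - p‖ * _ ≤ ‖q - p‖ * (2 * (h (AffineMap.lineMap p q τ)).im / d) := by
              gcongr; exact hder _ hs
          _ = _ := by ring) τ hτ
    rw [gronwallBound_ε0, sub_zero] at hg
    exact (le_abs_self _).trans hg
  have hp0 := hmem p (left_mem_segment ℝ p q)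
  have him' : ∀ x ∈ segment ℝ p q, (h x).im ≤ (h p).im * Real.exp k := by
    intro x hx
    rw [segment_eq_image_lineMap] at hx
    obtain ⟨τ, hτ, rfl⟩ := hx
    refine (him τ hτ).trans (mul_le_mul_of_nonneg_left (Real.exp_le_exp.2 ?_) hp0)
    exact (mul_le_of_le_one_right hk0 hτ.2).trans hk
  refine ⟨him' q (right_mem_segment ℝ p q), ?_⟩
  have := (convex_segment p q).norm_image_sub_le_of_norm_deriv_le (𝕜 := ℂ) (f := h)
    (C := 2 * ((h p).im * Real.exp k) / d) hdiff (fun x hx => (hder x hx).trans (by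
      gcongr; exact him' x hx)) (left_mem_segment ℝ p q) (right_mem_segment ℝ p q)
  refine this.trans ?_
  calc _ = 2 * ‖q - p‖ / d * ((h p).im * Real.exp k) := by ring
    _ ≤ _ := by gcongr

namespace Conf

variable {S S' : SlitSys} {F : Set ℂ} {g f : ℂ → ℂ}

/-- A bound for `g z - z` depending only on the size of the hull and the slits. -/
lemma norm_g_sub_le_div (H : Conf S F S' g f) {R : ℝ} (hR : 0 < R)
    (hsub : ∀ z : ℂ, R ≤ ‖z‖ → 0 < z.im → z ∈ gdom S F) {z : ℂ} (hz : z ∈ gdom S F)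
    (hzR : 2 * R ≤ ‖z‖) : ‖g z - z‖ ≤ 4 * R ^ 2 / ‖z‖ := by
  set X : Set ℂ := {z | R < ‖z‖ ∧ 0 < z.im} with hX
  have hXo : IsOpen X := (isOpen_lt continuous_const continuous_norm).inter isOpen_UHP
  have hXg : X ⊆ gdom S F := fun z hz => hsub z hz.1.le hz.2
  have hXc : IsPreconnected X := by
    have := isPreconnected_far 0 R
    simpa [hX] using this
  have hdp : DifferentiableOn ℂ (fun z => z - g z) X :=
    differentiableOn_id.sub (H.holo_g.mono hXg)
  have him : ∀ z ∈ gdom S F, 0 ≤ (z - g z).im := fun z hz => by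
    rw [sub_im]; linarith [H.im_le_im_self hz]
  have hRim : ∀ z : ℂ, ((R : ℂ) ^ 2 / z).im = -(R ^ 2 * z.im / ‖z‖ ^ 2) := by
    intro z
    rw [div_im, ← ofReal_pow, ofReal_re, ofReal_im, normSq_eq_norm_sq]; ring
  have hne : ∀ z ∈ X, z ≠ 0 := fun z hz h0 => by
    have := hz.1; rw [h0, norm_zero] at this; linarith
  have hup : ∀ z ∈ X, (z - g z).im ≤ R ^ 2 * z.im / ‖z‖ ^ 2 := by
    intro z hz
    obtain ⟨R1, hR1⟩ := H.exists_norm_sub_le one_pos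
    obtain ⟨B, hB⟩ := H.exists_bound_g (max R R1)
    have hRz : ∀ w ∈ X, ‖(R : ℂ) ^ 2 / w‖ ≤ R := by
      intro w hw
      rw [norm_div, norm_pow, norm_real, Real.norm_eq_abs, abs_of_pos hR,
        div_le_iff₀ (hR.trans hw.1), sq]
      exact mul_le_mul_of_nonneg_left hw.1.le hR.le
    have := im_le_of_boundary hXo hXc (fun Q => ?_) (h := fun z => (z - g z) + R ^ 2 / z)
      (hdp.add ((differentiableOn_const _).div differentiableOn_id hne))
      (B := max 1 (max R R1 + B) + R) (fun w hw => ?_) (fun ε hε => ?_) le_rfl finite_empty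
      (fun w hw p hp hwp q hq => Or.inr ?_) z hz
    · simp only [add_im, hRim] at this; linarith
    · refine ⟨((max R |Q| + 1 : ℝ) : ℂ) * I, ⟨?_, ?_⟩, ?_⟩
      all_goals
        have h1 := le_max_left R |Q|
        have h2 := le_max_right R |Q|
        have h3 := le_abs_self Q
        have h4 : ‖((max R |Q| + 1 : ℝ) : ℂ) * I‖ = max R |Q| + 1 := by
          rw [norm_mul, norm_I, mul_one, norm_real, Real.norm_eq_abs, abs_of_pos (by linarith)]
      · rw [h4]; linarith
      · simp only [mul_im, ofReal_re, ofReal_im, I_re, I_im]; linarith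
      · rw [h4]; linarith
    · refine (norm_add_le _ _).trans (add_le_add ?_ (hRz w hw))
      rcases le_total (max R R1) ‖w‖ with h1 | h1
      · rw [norm_sub_rev]
        exact (hR1 w (hXg hw) ((le_max_right _ _).trans h1)).trans (le_max_left _ _)
      · exact (norm_sub_le _ _).trans ((add_le_add h1 (hB w (hXg hw) h1)).trans
          (le_max_right _ _))
    · obtain ⟨R2, hR2⟩ := H.exists_norm_sub_le (half_pos hε)
      refine ⟨max R2 (R ^ 2 / (ε / 2)), fun w hw hRw => ?_⟩
      refine (norm_add_le _ _).trans ((add_le_add (b := ε / 2) (d := ε / 2) ?_ ?_).trans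
        (add_halves ε).le)
      · rw [norm_sub_rev]; exact hR2 w (hXg hw) ((le_max_left _ _).trans hRw)
      · rw [norm_div, norm_pow, norm_real, Real.norm_eq_abs, abs_of_pos hR,
          div_le_iff₀ (hR.trans hw.1), ← div_le_iff₀' (half_pos hε)]
        exact (le_max_right _ _).trans hRw
    · have hpR : R ≤ ‖p‖ := ge_of_tendsto' hwp.norm fun n => (hw n).1.le
      have hp0 : 0 ≤ p.im := im_nonneg_of_tendsto (fun n => (hw n).2) hwp
      have hlim : Tendsto (fun n => (w n).im - R ^ 2 * (w n).im / ‖w n‖ ^ 2) atTop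
          (𝓝 (p.im - R ^ 2 * p.im / ‖p‖ ^ 2)) := by
        have h1 : ContinuousAt (fun w : ℂ => w.im - R ^ 2 * w.im / ‖w‖ ^ 2) p :=
          ContinuousAt.sub (by fun_prop) (ContinuousAt.div (by fun_prop) (by fun_prop)
            (pow_ne_zero _ (hR.trans_le hpR).ne'))
        exact h1.tendsto.comp hwp
      have h0 : p.im - R ^ 2 * p.im / ‖p‖ ^ 2 = 0 := by
        rcases hpR.eq_or_lt with h1 | h1
        · rw [← h1]; field_simp; ring
        · have : p.im = 0 := le_antisymm (not_lt.1 fun h2 => hp ⟨h1, h2⟩) hp0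
          rw [this]; simp
      rw [← h0]
      refine le_of_tendsto_of_tendsto' ((continuous_im.tendsto q).comp hq) hlim fun n => ?_
      have h1 := (H.maps_g (hXg (hw n))).1
      rw [mem_UHP] at h1
      simp only [Function.comp, add_im, sub_im, hRim]
      linarith
  have hder : ∀ z ∈ X, 2 * R ≤ ‖z‖ → ‖deriv (fun z => z - g z) z‖ ≤ 4 * R ^ 2 / ‖z‖ ^ 2 := by
    intro z hz hzR
    have hzpos : 0 < ‖z‖ := hR.trans hz.1
    have hy : 0 < z.im := hz.2
    have hyz : z.im ≤ ‖z‖ := (le_abs_self _).trans (abs_im_le_norm z)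
    have hball : ball z (z.im / 2) ⊆ X := by
      intro w hw
      rw [mem_ball, dist_eq_norm] at hw
      have h1 := (abs_im_le_norm (w - z)).trans_lt hw
      rw [sub_im, abs_lt] at h1
      have h2 := norm_sub_norm_le z (z - w)
      rw [sub_sub_cancel, norm_sub_rev] at h2
      exact ⟨by linarith, by linarith⟩
    have h1 := norm_deriv_le_of_im_nonneg (half_pos hy) (hdp.mono hball)
      fun w hw => him w (hXg (hball hw))
    refine h1.trans ?_
    rw [div_le_iff₀ (half_pos hy)]
    have := hup z hz
    calc 2 * (z - g z).im ≤ 2 * (R ^ 2 * z.im / ‖z‖ ^ 2) := by linarith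
      _ = 4 * R ^ 2 / ‖z‖ ^ 2 * (z.im / 2) := by ring
  have hzX : z ∈ X := ⟨by linarith, hz.1.1⟩
  have hzpos : 0 < ‖z‖ := hR.trans hzX.1
  set C : ℝ := 4 * R ^ 2 / ‖z‖ with hC
  have hray : ∀ τ : ℝ, 1 ≤ τ → (τ : ℂ) * z ∈ X ∧ ‖(τ : ℂ) * z‖ = τ * ‖z‖ := by
    intro τ hτ
    have h1 : ‖(τ : ℂ) * z‖ = τ * ‖z‖ := by
      rw [norm_mul, norm_real, Real.norm_eq_abs, abs_of_pos (by linarith)]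
    refine ⟨⟨?_, ?_⟩, h1⟩
    · rw [h1]; nlinarith
    · rw [im_ofReal_mul]
      exact mul_pos (by linarith) hz.1.1
  have hbound : ∀ b : ℝ, 1 ≤ b → ‖((b : ℂ) * z - g (b * z)) - (z - g z)‖ ≤ C := by
    intro b hb
    have hdv : ∀ τ : ℝ, 1 ≤ τ → HasDerivAt (fun τ : ℝ => ((τ : ℂ) * z - g (τ * z)) - (z - g z))
        (z * deriv (fun z => z - g z) (τ * z)) τ := by
      intro τ hτ
      have h1 : HasDerivAt (fun τ : ℝ => (τ : ℂ) * z) z τ := by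
        have := (ofRealCLM.hasDerivAt (x := τ)).mul_const z
        simpa using this
      have h2 := ((hdp.differentiableAt (hXo.mem_nhds (hray τ hτ).1)).hasDerivAt.scomp τ h1)
      have h3 := h2.sub_const (z - g z)
      simpa using h3
    have hB : ∀ τ : ℝ, 1 ≤ τ → HasDerivAt (fun τ : ℝ => C * (1 - τ⁻¹)) (C / τ ^ 2) τ := by
      intro τ hτ
      have := (((hasDerivAt_inv (show τ ≠ 0 by linarith)).const_sub 1).const_mul C)
      rw [neg_neg, ← div_eq_mul_inv] at this
      exact this
    have := image_norm_le_of_norm_deriv_right_le_deriv_boundary' (a := 1) (b := b)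
      (f := fun τ : ℝ => ((τ : ℂ) * z - g (τ * z)) - (z - g z))
      (fun τ hτ => (hdv τ hτ.1).continuousAt.continuousWithinAt)
      (fun τ hτ => (hdv τ hτ.1).hasDerivWithinAt) (B := fun τ => C * (1 - τ⁻¹))
      (B' := fun τ => C / τ ^ 2) (by simp) (fun τ hτ => (hB τ hτ.1).continuousAt.continuousWithinAt)
      (fun τ hτ => (hB τ hτ.1).hasDerivWithinAt) (fun τ hτ => by
        obtain ⟨h1, h2⟩ := hray τ hτ.1
        have h3 := hder _ h1 (by rw [h2]; nlinarith [hτ.1])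
        have hτ0 : 0 < τ := by linarith [hτ.1]
        rw [norm_mul, h2] at *
        calc ‖z‖ * _ ≤ ‖z‖ * (4 * R ^ 2 / (τ * ‖z‖) ^ 2) := by gcongr
          _ = C / τ ^ 2 := by rw [hC]; field_simp) ⟨hb, le_rfl⟩
    refine this.trans ?_
    have hC0 : 0 ≤ C := by positivity
    have : 0 < b⁻¹ := by positivity
    nlinarith
  have hlim : Tendsto (fun n : ℕ => (((n + 1 : ℝ) : ℂ) * z - g (((n + 1 : ℝ) : ℂ) * z)) - (z - g z))
      atTop (𝓝 (0 - (z - g z))) := by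
    refine Tendsto.sub_const ?_ _
    have h1 : Tendsto (fun n : ℕ => ((n + 1 : ℝ) : ℂ) * z) atTop
        (cobounded ℂ ⊓ 𝓟 (gdom S F)) := by
      refine tendsto_inf.2 ⟨?_, tendsto_principal.2 (Eventually.of_forall fun n =>
        hXg (hray _ (by simp)).1)⟩
      rw [← tendsto_norm_atTop_iff_cobounded]
      have : (fun n : ℕ => ‖((n + 1 : ℝ) : ℂ) * z‖) = fun n : ℕ => (n + 1 : ℝ) * ‖z‖ := by
        ext n; exact (hray _ (by simp)).2
      rw [this]
      exact (tendsto_natCast_atTop_atTop.atTop_add tendsto_const_nhds).atTop_mul_const hzpos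
    have := (H.norm.comp h1).neg
    rw [neg_zero] at this
    exact this.congr fun n => by simp
  have := le_of_tendsto' hlim.norm fun n : ℕ => hbound (n + 1) (by simp)
  rw [zero_sub, neg_sub] at this
  exact this

lemma norm_g_sub_le (H : Conf S F S' g f) {R : ℝ} (hR : 0 < R)
    (hsub : ∀ z : ℂ, R ≤ ‖z‖ → 0 < z.im → z ∈ gdom S F) {z : ℂ} (hz : z ∈ gdom S F)
    (hzR : 2 * R ≤ ‖z‖) : ‖g z - z‖ ≤ 2 * R := by
  refine (H.norm_g_sub_le_div hR hsub hz hzR).trans ?_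
  rw [div_le_iff₀ (by linarith)]
  nlinarith

end Conf
end SlitLoewner

namespace SlitLoewner

open scoped ENNReal

/-! ### The length–area method -/

lemma det_restrictScalars_toSpanSingleton (c : ℂ) :
    ((ContinuousLinearMap.toSpanSingleton ℂ c).restrictScalars ℝ).det = ‖c‖ ^ 2 := by
  have h : LinearMap.det (LinearMap.toSpanSingleton ℂ ℂ c) = c := by
    simp
  rw [ContinuousLinearMap.det]
  simp only [ContinuousLinearMap.coe_restrictScalars]
  have h2 : ((ContinuousLinearMap.toSpanSingleton ℂ c : ℂ →L[ℂ] ℂ) : ℂ →ₗ[ℂ] ℂ)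
      = LinearMap.toSpanSingleton ℂ ℂ c := rfl
  rw [h2, LinearMap.det_restrictScalars, h, Algebra.norm_complex_apply, normSq_eq_norm_sq]

lemma measurable_enorm_deriv_indicator {X : Set ℂ} (hX : IsOpen X) (F : ℂ → ℂ) :
    Measurable (X.indicator fun z => ‖deriv F z‖ₑ) :=
  ((measurable_deriv F).enorm).indicator hX.measurableSet

/-- The area formula for injective holomorphic functions. -/
lemma lintegral_enorm_deriv_sq {X : Set ℂ} (hX : IsOpen X) {F : ℂ → ℂ}
    (hF : DifferentiableOn ℂ F X) (hinj : InjOn F X) :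
    ∫⁻ z, (X.indicator (fun z => ‖deriv F z‖ₑ) z) ^ 2 = volume (F '' X) := by
  have h1 : ∀ z ∈ X, HasFDerivWithinAt F
      ((ContinuousLinearMap.toSpanSingleton ℂ (deriv F z)).restrictScalars ℝ) X z := fun z hz =>
    (((hF.differentiableAt (hX.mem_nhds hz)).hasDerivAt.hasFDerivAt).restrictScalars
      ℝ).hasFDerivWithinAt
  rw [← lintegral_abs_det_fderiv_eq_addHaar_image volume hX.measurableSet h1 hinj,
    ← lintegral_indicator hX.measurableSet]
  refine lintegral_congr fun z => ?_
  by_cases hz : z ∈ X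
  · rw [indicator_of_mem hz, indicator_of_mem hz, det_restrictScalars_toSpanSingleton,
      abs_of_nonneg (by positivity), ENNReal.ofReal_pow (norm_nonneg _), ofReal_norm]
  · simp [indicator_of_notMem hz]

lemma sq_lintegral_le {α : Type*} [MeasurableSpace α] (μ : Measure α) {f : α → ℝ≥0∞}
    (hf : Measurable f) : (∫⁻ θ, f θ ∂μ) ^ 2 ≤ μ univ * ∫⁻ θ, f θ ^ 2 ∂μ := by
  have := ENNReal.lintegral_mul_le_Lp_mul_Lq μ Real.HolderConjugate.two_two
    (f := fun _ => 1) (g := f) aemeasurable_const hf.aemeasurable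
  simp only [Pi.mul_apply, one_mul, ENNReal.one_rpow, lintegral_const] at this
  calc _ ≤ _ := pow_le_pow_left' this 2
    _ = _ := by
      rw [mul_pow, ← ENNReal.rpow_natCast, ← ENNReal.rpow_mul, ← ENNReal.rpow_natCast,
        ← ENNReal.rpow_mul]
      norm_num

lemma measurable_lintegral_circle (z₀ : ℂ) {f : ℂ → ℝ≥0∞} (hf : Measurable f) :
    Measurable fun r : ℝ => ENNReal.ofReal r *
      ∫⁻ θ in Ioo (-Real.pi) Real.pi, f (circleMap z₀ r θ) := by
  have hc : Measurable fun p : ℝ × ℝ => circleMap z₀ p.1 p.2 := by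
    simp only [circleMap]; fun_prop
  exact ENNReal.measurable_ofReal.mul (hf.comp hc).lintegral_prod_right'

lemma lintegral_circle (z₀ : ℂ) {f : ℂ → ℝ≥0∞} (hf : Measurable f) :
    ∫⁻ r in Ioi 0, ENNReal.ofReal r * ∫⁻ θ in Ioo (-Real.pi) Real.pi, f (circleMap z₀ r θ)
      = ∫⁻ z, f z := by
  rw [← lintegral_add_left_eq_self _ z₀, ← Complex.lintegral_comp_polarCoord_symm,
    polarCoord_target, Measure.volume_eq_prod, setLIntegral_prod]
  · refine lintegral_congr fun r => ?_
    have hm : Measurable fun θ => f (circleMap z₀ r θ) := hf.comp (by fun_prop)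
    rw [← lintegral_const_mul _ hm]
    refine lintegral_congr fun θ => ?_
    rw [Complex.polarCoord_symm_apply, circleMap, exp_mul_I, smul_eq_mul]
    push_cast; rfl
  · refine Measurable.aemeasurable ?_
    simp only [Complex.polarCoord_symm_apply, smul_eq_mul]
    fun_prop

lemma lintegral_circle_sq_le (z₀ : ℂ) {f : ℂ → ℝ≥0∞} (hf : Measurable f) :
    ∫⁻ r in Ioi 0, ENNReal.ofReal r * (∫⁻ θ in Ioo (-Real.pi) Real.pi, f (circleMap z₀ r θ)) ^ 2
      ≤ ENNReal.ofReal (2 * Real.pi) * ∫⁻ z, f z ^ 2 := by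
  rw [← lintegral_circle z₀ (hf.pow_const 2),
    ← lintegral_const_mul _ (measurable_lintegral_circle z₀ (hf.pow_const 2))]
  refine lintegral_mono fun r => ?_
  have hm : Measurable fun θ => f (circleMap z₀ r θ) := hf.comp (by fun_prop)
  have := sq_lintegral_le (volume.restrict (Ioo (-Real.pi) Real.pi)) hm
  rw [Measure.restrict_apply_univ, Real.volume_Ioo,
    show Real.pi - -Real.pi = 2 * Real.pi by ring] at this
  rw [mul_left_comm]
  gcongr

/-- The length of the image under `F` of the part inside `X` of a circle. -/
def circleLength (X : Set ℂ) (F : ℂ → ℂ) (z₀ : ℂ) (r : ℝ) : ℝ≥0∞ :=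
  ENNReal.ofReal r * ∫⁻ θ in Ioo (-Real.pi) Real.pi,
    X.indicator (fun z => ‖deriv F z‖ₑ) (circleMap z₀ r θ)

lemma circleLength_inter_ball {X : Set ℂ} {F : ℂ → ℂ} {z₀ : ℂ} {r ρ : ℝ} (hr : 0 ≤ r)
    (hρ : r < ρ) : circleLength (X ∩ ball z₀ ρ) F z₀ r = circleLength X F z₀ r := by
  have : ∀ θ, circleMap z₀ r θ ∈ ball z₀ ρ := fun θ =>
    sphere_subset_closedBall.trans (closedBall_subset_ball hρ) (circleMap_mem_sphere z₀ hr θ)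
  rw [circleLength, circleLength]
  congr 1
  refine lintegral_congr fun θ => ?_
  by_cases h : circleMap z₀ r θ ∈ X
  · rw [indicator_of_mem h, indicator_of_mem (show _ ∈ X ∩ ball z₀ ρ from ⟨h, this θ⟩)]
  · rw [indicator_of_notMem h, indicator_of_notMem fun h' => h h'.1]

lemma measurable_circleLength {X : Set ℂ} (hX : IsOpen X) (F : ℂ → ℂ) (z₀ : ℂ) :
    Measurable (circleLength X F z₀) :=
  measurable_lintegral_circle z₀ (measurable_enorm_deriv_indicator hX F)

lemma lintegral_circleLength_sq_le {X : Set ℂ} (hX : IsOpen X) {F : ℂ → ℂ}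
    (hF : DifferentiableOn ℂ F X) (hinj : InjOn F X) (z₀ : ℂ) :
    ∫⁻ r in Ioi 0, circleLength X F z₀ r ^ 2 * ENNReal.ofReal r⁻¹
      ≤ ENNReal.ofReal (2 * Real.pi) * volume (F '' X) := by
  rw [← lintegral_enorm_deriv_sq hX hF hinj]
  refine le_trans (setLIntegral_mono' measurableSet_Ioi fun r hr => ?_)
    (lintegral_circle_sq_le z₀ (measurable_enorm_deriv_indicator hX F))
  rw [circleLength, mul_pow, mul_right_comm, sq, mul_assoc (ENNReal.ofReal r),
    ← ENNReal.ofReal_mul (le_of_lt hr), mul_inv_cancel₀ (ne_of_gt hr), ENNReal.ofReal_one, mul_one]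

/-- Many circles have short images. -/
lemma volume_circleLength_le_pos {X : Set ℂ} (hX : IsOpen X) {F : ℂ → ℂ}
    (hF : DifferentiableOn ℂ F X) (hinj : InjOn F X) (z₀ : ℂ) {α L ρ₁ ρ₂ : ℝ} (h1 : 0 < ρ₁)
    (h12 : ρ₁ < ρ₂) (hα : volume (F '' (X ∩ ball z₀ ρ₂)) ≤ ENNReal.ofReal α)
    (hL : 2 * Real.pi * α < L ^ 2 * Real.log (ρ₂ / ρ₁)) (hL0 : 0 ≤ L) (hα0 : 0 ≤ α) :
    0 < volume {r ∈ Ioo ρ₁ ρ₂ | circleLength X F z₀ r ≤ ENNReal.ofReal L} := by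
  by_contra! h0
  have h0' : volume {r ∈ Ioo ρ₁ ρ₂ | circleLength X F z₀ r ≤ ENNReal.ofReal L} = 0 :=
    le_antisymm h0 bot_le
  have hae : ∀ᵐ r ∂(volume.restrict (Ioo ρ₁ ρ₂)), ENNReal.ofReal L < circleLength X F z₀ r := by
    rw [ae_restrict_iff' measurableSet_Ioo]
    refine measure_mono_null (fun r hr => ?_) h0'
    simp only [mem_compl_iff, mem_ofPred_eq, Classical.not_imp, not_lt] at hr
    exact hr
  have hlog : ∫⁻ r in Ioo ρ₁ ρ₂, ENNReal.ofReal r⁻¹ = ENNReal.ofReal (Real.log (ρ₂ / ρ₁)) := by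
    have hi : IntegrableOn (fun r : ℝ => r⁻¹) (Ioc ρ₁ ρ₂) := by
      refine (intervalIntegrable_iff_integrableOn_Ioc_of_le h12.le).1 ?_
      refine intervalIntegral.intervalIntegrable_inv (fun x hx => ?_) continuousOn_id
      rw [uIcc_of_le h12.le] at hx
      exact (h1.trans_le hx.1).ne'
    rw [← integral_inv_of_pos h1 (h1.trans h12), intervalIntegral.integral_of_le h12.le,
      ofReal_integral_eq_lintegral_ofReal hi]
    · exact setLIntegral_congr Ioo_ae_eq_Ioc
    · rw [EventuallyLE, ae_restrict_iff' measurableSet_Ioc]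
      exact Eventually.of_forall fun r hr => by
        have := h1.trans hr.1
        simp only [Pi.zero_apply]; positivity
  have hXb : IsOpen (X ∩ ball z₀ ρ₂) := hX.inter isOpen_ball
  have key : ENNReal.ofReal (L ^ 2 * Real.log (ρ₂ / ρ₁)) ≤ ENNReal.ofReal (2 * Real.pi * α) := by
    calc _ = ENNReal.ofReal L ^ 2 * ∫⁻ r in Ioo ρ₁ ρ₂, ENNReal.ofReal r⁻¹ := by
          rw [hlog, ENNReal.ofReal_mul (by positivity), ENNReal.ofReal_pow hL0]
      _ = ∫⁻ r in Ioo ρ₁ ρ₂, ENNReal.ofReal L ^ 2 * ENNReal.ofReal r⁻¹ := by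
          rw [lintegral_const_mul _ (by fun_prop)]
      _ ≤ ∫⁻ r in Ioo ρ₁ ρ₂, circleLength (X ∩ ball z₀ ρ₂) F z₀ r ^ 2 * ENNReal.ofReal r⁻¹ := by
          refine lintegral_mono_ae ?_
          filter_upwards [hae, ae_restrict_mem measurableSet_Ioo] with r hr hr2
          rw [circleLength_inter_ball (h1.trans hr2.1).le hr2.2]
          gcongr
      _ ≤ ∫⁻ r in Ioi 0, circleLength (X ∩ ball z₀ ρ₂) F z₀ r ^ 2 * ENNReal.ofReal r⁻¹ :=
          lintegral_mono_set fun r hr => h1.trans hr.1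
      _ ≤ ENNReal.ofReal (2 * Real.pi) * volume (F '' (X ∩ ball z₀ ρ₂)) :=
          lintegral_circleLength_sq_le hXb (hF.mono inter_subset_left)
            (hinj.mono inter_subset_left) z₀
      _ ≤ ENNReal.ofReal (2 * Real.pi) * ENNReal.ofReal α := by gcongr
      _ = _ := (ENNReal.ofReal_mul (by positivity)).symm
  rw [ENNReal.ofReal_le_ofReal_iff (by positivity)] at key
  linarith

lemma volume_image_circle_le {X : Set ℂ} (hX : IsOpen X) {F : ℂ → ℂ}
    (hF : DifferentiableOn ℂ F X) (l : ℂ →L[ℝ] ℝ) (hl : ∀ z, ‖l z‖ ≤ ‖z‖) (z₀ : ℂ) {r : ℝ}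
    (hr : 0 ≤ r) {A : Set ℝ} (hA : MeasurableSet A) (hAX : ∀ θ ∈ A, circleMap z₀ r θ ∈ X) :
    volume ((fun θ => l (F (circleMap z₀ r θ))) '' A) ≤
      ENNReal.ofReal r * ∫⁻ θ in A, X.indicator (fun z => ‖deriv F z‖ₑ) (circleMap z₀ r θ) := by
  have hd : ∀ θ ∈ A, HasDerivWithinAt (fun θ => l (F (circleMap z₀ r θ)))
      (l (circleMap 0 r θ * I * deriv F (circleMap z₀ r θ))) A θ := by
    intro θ hθ
    have h1 := (hF.differentiableAt (hX.mem_nhds (hAX θ hθ))).hasDerivAt.scomp θ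
      (hasDerivAt_circleMap z₀ r θ)
    exact (l.hasFDerivAt.comp_hasDerivAt θ h1).hasDerivWithinAt
  refine (addHaar_image_le_lintegral_abs_det_fderiv volume hA
    fun θ hθ => (hd θ hθ).hasFDerivWithinAt).trans ?_
  simp only [ContinuousLinearMap.det_toSpanSingleton]
  have hm : Measurable fun θ => X.indicator (fun z => ‖deriv F z‖ₑ) (circleMap z₀ r θ) :=
    (measurable_enorm_deriv_indicator hX F).comp (by fun_prop)
  rw [← lintegral_const_mul _ hm]
  refine setLIntegral_mono' hA fun θ hθ => ?_
  rw [indicator_of_mem (hAX θ hθ), ← ofReal_norm, ← ENNReal.ofReal_mul hr]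
  refine ENNReal.ofReal_le_ofReal ?_
  rw [← Real.norm_eq_abs]
  refine (hl _).trans ?_
  rw [norm_mul, norm_mul, norm_I, norm_circleMap_zero, abs_of_nonneg hr, mul_one]

lemma norm_reCLM_le (z : ℂ) : ‖reCLM z‖ ≤ ‖z‖ := abs_re_le_norm z
lemma norm_imCLM_le (z : ℂ) : ‖imCLM z‖ ≤ ‖z‖ := abs_im_le_norm z

/-- The projections of the image of `X ∩ sphere z₀ r` have measure at most the length. -/
lemma volume_image_sphere_le {X : Set ℂ} (hX : IsOpen X) {F : ℂ → ℂ}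
    (hF : DifferentiableOn ℂ F X) (l : ℂ →L[ℝ] ℝ) (hl : ∀ z, ‖l z‖ ≤ ‖z‖) (z₀ : ℂ) {r : ℝ}
    (hr : 0 ≤ r) :
    volume ((fun z => l (F z)) '' (X ∩ sphere z₀ r)) ≤ circleLength X F z₀ r := by
  set A : Set ℝ := Ioo (-Real.pi) Real.pi ∩ (circleMap z₀ r) ⁻¹' X with hA
  have hAo : IsOpen A := isOpen_Ioo.inter (hX.preimage (continuous_circleMap z₀ r))
  have hsub : (fun z => l (F z)) '' (X ∩ sphere z₀ r) ⊆
      ((fun θ => l (F (circleMap z₀ r θ))) '' A) ∪ {l (F (circleMap z₀ r Real.pi))} := by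
    rintro _ ⟨z, ⟨hzX, hz⟩, rfl⟩
    have h1 : z = circleMap z₀ r (arg (z - z₀)) := by
      rw [mem_sphere, dist_eq_norm] at hz
      rw [circleMap, ← hz, norm_mul_exp_arg_mul_I]; ring
    rcases (arg_le_pi (z - z₀)).lt_or_eq with h2 | h2
    · exact Or.inl ⟨arg (z - z₀), ⟨⟨neg_pi_lt_arg _, h2⟩, by rw [mem_preimage, ← h1]; exact hzX⟩,
        by simp only [← h1]⟩
    · right; rw [mem_singleton_iff, ← h2, ← h1]
  calc _ ≤ _ := measure_mono hsub
    _ ≤ _ := measure_union_le _ _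
    _ ≤ ENNReal.ofReal r * ∫⁻ θ in A, X.indicator (fun z => ‖deriv F z‖ₑ) (circleMap z₀ r θ) := by
        rw [Real.volume_singleton, add_zero]
        exact volume_image_circle_le hX hF l hl z₀ hr hAo.measurableSet fun θ hθ => hθ.2
    _ ≤ _ := by
        rw [circleLength]
        gcongr
        exact inter_subset_left

/-- The image of a circular arc. -/
lemma edist_circle_le {X : Set ℂ} (hX : IsOpen X) {F : ℂ → ℂ}
    (hF : DifferentiableOn ℂ F X) (z₀ : ℂ) {r : ℝ} (hr : 0 ≤ r) {θ₁ θ₂ : ℝ} (h12 : θ₁ ≤ θ₂)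
    (hA : ∀ θ ∈ Icc θ₁ θ₂, circleMap z₀ r θ ∈ X) :
    edist (F (circleMap z₀ r θ₁)) (F (circleMap z₀ r θ₂)) ≤
      2 * (ENNReal.ofReal r * ∫⁻ θ in Icc θ₁ θ₂,
        X.indicator (fun z => ‖deriv F z‖ₑ) (circleMap z₀ r θ)) := by
  have key : ∀ l : ℂ →L[ℝ] ℝ, (∀ z, ‖l z‖ ≤ ‖z‖) →
      ENNReal.ofReal |l (F (circleMap z₀ r θ₁)) - l (F (circleMap z₀ r θ₂))| ≤
      ENNReal.ofReal r * ∫⁻ θ in Icc θ₁ θ₂,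
        X.indicator (fun z => ‖deriv F z‖ₑ) (circleMap z₀ r θ) := by
    intro l hl
    refine le_trans ?_ (volume_image_circle_le hX hF l hl z₀ hr measurableSet_Icc hA)
    have hc : ContinuousOn (fun θ => l (F (circleMap z₀ r θ))) (Icc θ₁ θ₂) :=
      l.continuous.comp_continuousOn
        (hF.continuousOn.comp (continuous_circleMap z₀ r).continuousOn hA)
    have h1 := hc.mono (by rw [uIcc_of_le h12] : uIcc θ₁ θ₂ ⊆ Icc θ₁ θ₂)
    have h2 := intermediate_value_uIcc h1
    rw [uIcc_of_le h12] at h2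
    refine le_trans ?_ (measure_mono h2)
    rw [uIcc, Real.volume_Icc, max_sub_min_eq_abs']
  rw [edist_dist, dist_eq_norm, two_mul]
  refine le_trans ?_ (add_le_add (key reCLM norm_reCLM_le) (key imCLM norm_imCLM_le))
  rw [← ENNReal.ofReal_add (abs_nonneg _) (abs_nonneg _)]
  refine ENNReal.ofReal_le_ofReal ?_
  simp only [reCLM_apply, imCLM_apply, ← sub_re, ← sub_im]
  exact norm_le_abs_re_add_abs_im _

end SlitLoewner

namespace SlitLoewner

/-! ### Short circles and boundary behaviour -/

lemma volume_image_inter_ball_le {X : Set ℂ} {F : ℂ → ℂ} {R ρ : ℝ} (hR : 0 ≤ R) (hρ : 0 ≤ ρ)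
    (hF : ∀ z ∈ X, ‖F z - z‖ ≤ R) (z₀ : ℂ) :
    volume (F '' (X ∩ ball z₀ ρ)) ≤ ENNReal.ofReal (Real.pi * (ρ + R) ^ 2) := by
  have hsub : F '' (X ∩ ball z₀ ρ) ⊆ closedBall z₀ (ρ + R) := by
    rintro _ ⟨z, ⟨hz, hzb⟩, rfl⟩
    rw [mem_closedBall]
    refine (dist_triangle (F z) z z₀).trans ?_
    rw [dist_eq_norm (F z)]
    have := hF z hz
    rw [mem_ball] at hzb
    linarith
  refine (measure_mono hsub).trans ?_
  rw [Complex.volume_closedBall, mul_comm Real.pi, ENNReal.ofReal_mul (by positivity),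
    ENNReal.ofReal_pow (by positivity)]
  gcongr
  rw [← NNReal.coe_real_pi, ENNReal.ofReal_coe_nnreal]

/-- Injective holomorphic maps that are uniformly close to the identity map many circles
around a given point to short curves. -/
lemma exists_forall_volume_circleLength_pos {R L ρ₂ : ℝ} (hR : 0 ≤ R) (hL : 0 < L)
    (hρ₂ : 0 < ρ₂) : ∃ ρ₁ ∈ Ioo 0 ρ₂, ∀ (X : Set ℂ) (F : ℂ → ℂ) (z₀ : ℂ), IsOpen X →
      DifferentiableOn ℂ F X → InjOn F X → (∀ z ∈ X, ‖F z - z‖ ≤ R) →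
      0 < volume {r ∈ Ioo ρ₁ ρ₂ | circleLength X F z₀ r ≤ ENNReal.ofReal L} := by
  set α : ℝ := Real.pi * (ρ₂ + R) ^ 2 with hα
  set k : ℝ := 2 * Real.pi * α / L ^ 2 + 1 with hk
  have hα0 : 0 ≤ α := by positivity
  have hk0 : 0 < k := by positivity
  refine ⟨ρ₂ * Real.exp (-k), ⟨by positivity, ?_⟩, fun X F z₀ hX hF hinj hb => ?_⟩
  · exact mul_lt_of_lt_one_right hρ₂ (by rw [← Real.exp_zero]; exact Real.exp_lt_exp.2 (by linarith))
  · refine volume_circleLength_le_pos hX hF hinj z₀ (by positivity)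
      (mul_lt_of_lt_one_right hρ₂ (by rw [← Real.exp_zero]; exact Real.exp_lt_exp.2 (by linarith)))
      (volume_image_inter_ball_le hR hρ₂.le hb z₀) ?_ hL.le hα0
    have : ρ₂ / (ρ₂ * Real.exp (-k)) = Real.exp k := by
      rw [Real.exp_neg]; field_simp
    rw [this, Real.log_exp, hk, mul_add, mul_div_cancel₀ _ (by positivity)]
    linarith [pow_pos hL 2]

lemma exists_forall_circleLength_le {R L ρ₂ : ℝ} (hR : 0 ≤ R) (hL : 0 < L)
    (hρ₂ : 0 < ρ₂) : ∃ ρ₁ ∈ Ioo 0 ρ₂, ∀ (X : Set ℂ) (F : ℂ → ℂ) (z₀ : ℂ), IsOpen X →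
      DifferentiableOn ℂ F X → InjOn F X → (∀ z ∈ X, ‖F z - z‖ ≤ R) →
      ∃ r ∈ Ioo ρ₁ ρ₂, circleLength X F z₀ r ≤ ENNReal.ofReal L := by
  obtain ⟨ρ₁, h1, h2⟩ := exists_forall_volume_circleLength_pos hR hL hρ₂
  refine ⟨ρ₁, h1, fun X F z₀ hX hF hinj hb => ?_⟩
  obtain ⟨r, hr⟩ := nonempty_of_measure_ne_zero (h2 X F z₀ hX hF hinj hb).ne'
  exact ⟨r, hr.1, hr.2⟩

namespace Conf

variable {S S' : SlitSys} {F : Set ℂ} {g f : ℂ → ℂ}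

lemma norm_g_sub_le' (H : Conf S F S' g f) {R : ℝ} (hR : 0 < R)
    (hsub : ∀ z : ℂ, R ≤ ‖z‖ → 0 < z.im → z ∈ gdom S F) {z : ℂ} (hz : z ∈ gdom S F) :
    ‖g z - z‖ ≤ 6 * R := by
  rcases le_or_gt (2 * R) ‖z‖ with h | h
  · exact (H.norm_g_sub_le hR hsub hz h).trans (by linarith)
  · have := H.norm_g_le (R := 2 * R) (c := 2 * R) (X := 2 * R) (by linarith)
      (fun z hz h => H.norm_g_sub_le hR hsub hz h) le_rfl hz h.le
    exact (norm_sub_le _ _).trans (by linarith)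

/-- A horizontal line missing the slits pulls back to a curve reaching `∞`. -/
lemma exists_mem_sphere_im_eq (H : Conf S F S' g f) {z₀ : ℂ} {r y : ℝ} (hy : 0 < y)
    (hyh : y ∉ S'.heights) {z : ℂ} (hz : z ∈ gdom S F) (hzb : dist z z₀ ≤ r)
    (hzy : (g z).im = y) : ∃ p ∈ gdom S F ∩ sphere z₀ r, (g p).im = y := by
  set Λ : Set ℂ := {w | w.im = y} with hΛ
  have hΛs : Λ ⊆ S'.dom := fun w (hw : w.im = y) =>
    ⟨by rw [mem_UHP, hw]; exact hy, fun h => hyh (hw ▸ S'.im_mem_heights h)⟩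
  have hΛc : IsPreconnected Λ := by
    have : Convex ℝ Λ := (convex_singleton y).is_linear_preimage imLm.isLinear
    exact this.isPreconnected
  have hfc : IsPreconnected (f '' Λ) := hΛc.image f (H.holo_f.continuousOn.mono hΛs)
  obtain ⟨B, hB⟩ := H.exists_bound_g (‖z₀‖ + r)
  set w : ℂ := ((|B| + 1 : ℝ) : ℂ) + y * I with hw
  have hwΛ : w ∈ Λ := by simp [hw, hΛ]
  have hwB : B < ‖w‖ := by
    have : w.re = |B| + 1 := by simp [hw]
    calc B ≤ |B| := le_abs_self B
      _ < |B| + 1 := by linarith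
      _ ≤ |w.re| := by rw [this]; exact le_abs_self _
      _ ≤ ‖w‖ := abs_re_le_norm w
  have hfw : r ≤ dist (f w) z₀ := by
    by_contra! h
    have h1 := hB (f w) (H.maps_f (hΛs hwΛ)) (by
      have := norm_le_norm_add_norm_sub z₀ (f w)
      rw [dist_eq_norm, norm_sub_rev] at h
      rw [dist_eq_norm] at *
      linarith [norm_sub_rev z₀ (f w)])
    rw [H.right_inv w (hΛs hwΛ)] at h1
    linarith
  have hzΛ : z ∈ f '' Λ := ⟨g z, hzy, H.left_inv z hz⟩
  obtain ⟨p, ⟨q, hq, rfl⟩, hp⟩ := exists_mem_sphere_of_isPreconnected hfc hzΛ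
    (mem_image_of_mem f hwΛ) hzb hfw
  exact ⟨f q, ⟨H.maps_f (hΛs hq), hp⟩, by rw [H.right_inv q (hΛs hq)]; exact hq⟩

/-- A connected set inside a circle with short image has small imaginary part, provided the
imaginary part is somewhere small on it. -/
lemma im_le_of_circleLength_le (H : Conf S F S' g f) {z₀ : ℂ} {r L : ℝ} (hr : 0 ≤ r)
    (hL : 0 ≤ L) (hlen : circleLength (gdom S F) g z₀ r ≤ ENNReal.ofReal L) {σ : Set ℂ}
    (hσc : IsPreconnected σ) (hσ : σ ⊆ gdom S F ∩ closedBall z₀ r)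
    (h0 : ∀ ε > 0, ∃ z ∈ σ, (g z).im < ε) : ∀ z ∈ σ, (g z).im ≤ L := by
  intro z hz
  by_contra! hzL
  have hsphere := (volume_image_sphere_le H.isOpen_gdom H.holo_g imCLM norm_imCLM_le z₀ hr).trans
    hlen
  set A := (fun z => imCLM (g z)) '' (gdom S F ∩ sphere z₀ r) with hA
  have hnot : ¬ Ioo 0 (g z).im ⊆ A ∪ S'.heights := by
    intro hsub
    have h1 := (measure_mono hsub).trans (measure_union_le (μ := volume) A S'.heights)
    rw [S'.finite_heights.measure_zero, add_zero, Real.volume_Ioo, sub_zero] at h1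
    have h2 := h1.trans hsphere
    rw [ENNReal.ofReal_le_ofReal_iff hL] at h2
    linarith
  obtain ⟨y, hy, hyn⟩ := not_subset.1 hnot
  rw [mem_union, not_or] at hyn
  obtain ⟨z', hz', hz'y⟩ := h0 y hy.1
  have hc : ContinuousOn (fun z => (g z).im) σ :=
    continuous_im.comp_continuousOn (H.holo_g.continuousOn.mono fun w hw => (hσ hw).1)
  obtain ⟨z₁, hz₁, hz₁y⟩ := hσc.intermediate_value hz' hz hc ⟨hz'y.le, hy.2.le⟩
  obtain ⟨p, hp, hpy⟩ := H.exists_mem_sphere_im_eq hy.1 hyn.2 (hσ hz₁).1 (hσ hz₁).2 hz₁y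
  exact hyn.1 ⟨p, hp, hpy⟩

end Conf

/-- Mapping-out functions have uniformly small imaginary part near the boundary. -/
lemma exists_forall_im_le_of_near_boundary {R L d : ℝ} (hR : 0 ≤ R) (hL : 0 < L) (hd : 0 < d) :
    ∃ ε ∈ Ioc 0 d, ∀ (S S' : SlitSys) (F : Set ℂ) (g f : ℂ → ℂ), Conf S F S' g f →
      (∀ z ∈ gdom S F, ‖g z - z‖ ≤ R) → ∀ p ∉ UHP \ F, (∀ s ∈ S.set, d ≤ dist s p) →
      ∀ z ∈ gdom S F, dist z p ≤ ε → (g z).im ≤ L := by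
  obtain ⟨ρ₁, hρ₁, hr⟩ := exists_forall_circleLength_le hR hL one_pos
  refine ⟨min (d / 2) ρ₁, ⟨lt_min (half_pos hd) hρ₁.1, (min_le_left _ _).trans (by linarith)⟩,
    fun S S' F g f H hgR p hp hpS z hz hzp => ?_⟩
  obtain ⟨r, hrI, hrL⟩ := hr _ _ p H.isOpen_gdom H.holo_g H.inj_g hgR
  have hr0 : 0 < r := hρ₁.1.trans hrI.1
  set c : ℝ → ℂ := fun τ => AffineMap.lineMap z p τ with hc
  have hcc : Continuous c := AffineMap.lineMap_continuous
  have hcd : ∀ τ ∈ Icc (0 : ℝ) 1, dist (c τ) p ≤ dist z p := by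
    intro τ hτ
    rw [hc]
    simp only [dist_lineMap_right]
    rw [Real.norm_eq_abs, abs_of_nonneg (by linarith [hτ.2])]
    exact mul_le_of_le_one_left dist_nonneg (by linarith [hτ.1])
  set K : Set ℝ := Icc 0 1 ∩ c ⁻¹' (gdom S F)ᶜ with hK
  have hKc : IsCompact K := isCompact_Icc.inter_right (H.isOpen_gdom.isClosed_compl.preimage hcc)
  have hK1 : (1 : ℝ) ∈ K := ⟨⟨zero_le_one, le_rfl⟩, by
    simp only [hc, mem_preimage, AffineMap.lineMap_apply_one]
    exact fun h => hp h.1⟩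
  obtain ⟨τ, hτ, hτmin⟩ := hKc.exists_isLeast ⟨1, hK1⟩
  have hτ0 : 0 < τ := by
    rcases hτ.1.1.lt_or_eq with h | h
    · exact h
    · exfalso; apply hτ.2
      rw [← h]; simpa [hc] using hz
  have hin : ∀ t ∈ Ico 0 τ, c t ∈ gdom S F := by
    intro t ht
    by_contra h
    exact absurd (hτmin ⟨⟨ht.1, ht.2.le.trans hτ.1.2⟩, h⟩) (not_le.2 ht.2)
  have hq : c τ ∉ UHP \ F := by
    intro h
    have h1 : c τ ∈ S.set := by
      by_contra h2; exact hτ.2 ⟨h, h2⟩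
    have h2 := hpS _ h1
    have h3 := hcd τ hτ.1
    have h4 := min_le_left (d / 2) ρ₁
    linarith
  have hlim : Tendsto (fun n : ℕ => τ * (1 - 1 / ((n : ℝ) + 1))) atTop (𝓝 τ) := by
    have := (tendsto_one_div_add_atTop_nhds_zero_nat (𝕜 := ℝ)).const_sub 1
    simpa using this.const_mul τ
  have hmem : ∀ n : ℕ, τ * (1 - 1 / ((n : ℝ) + 1)) ∈ Ico 0 τ := by
    intro n
    have h1 : 0 < 1 / ((n : ℝ) + 1) := by positivity
    have h2 : 1 / ((n : ℝ) + 1) ≤ 1 := by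
      rw [div_le_one (by positivity)]; linarith [(Nat.cast_nonneg n : (0 : ℝ) ≤ n)]
    exact ⟨mul_nonneg hτ0.le (by linarith), mul_lt_of_lt_one_right hτ0 (by linarith)⟩
  have him := H.tendsto_im_zero (fun n => hin _ (hmem n)) ((hcc.tendsto τ).comp hlim) hq
  refine H.im_le_of_circleLength_le hr0.le hL.le hrL (σ := c '' Ico 0 τ)
    (isPreconnected_Ico.image c hcc.continuousOn) ?_ (fun ε hε => ?_) z
    ⟨0, ⟨le_rfl, hτ0⟩, by simp [hc]⟩
  · rintro _ ⟨t, ht, rfl⟩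
    refine ⟨hin t ht, ?_⟩
    rw [mem_closedBall]
    have := hcd t ⟨ht.1, ht.2.le.trans hτ.1.2⟩
    have h4 := min_le_right (d / 2) ρ₁
    linarith [hrI.1]
  · obtain ⟨n, hn⟩ := (him.eventually_lt_const hε).exists
    exact ⟨_, ⟨_, hmem n, rfl⟩, hn⟩

end SlitLoewner

namespace SlitLoewner

/-! ### Cross-cuts of small diameter -/

lemma isPreconnected_slitGauge_between {a b y e e' : ℝ} (hab : a ≤ b) (he : 0 < e) (hee : e < e') :
    IsPreconnected {z | e < slitGauge a b y z ∧ slitGauge a b y z < e'} := by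
  have h := isPreconnected_frame (a := a - e') (b := b + e') (c := y - e') (d := y + e')
    (a' := a - e) (b' := b + e) (c' := y - e) (d' := y + e) (by linarith) (by linarith)
    (by linarith) (by linarith) (by linarith) (by linarith)
  convert h using 1
  ext z
  have h1 : e < slitGauge a b y z ↔
      z.re < a - e ∨ b + e < z.re ∨ z.im < y - e ∨ y + e < z.im := by
    rw [← not_le, slitGauge_le_iff]
    grind
  simp only [mem_ofPred_eq, slitGauge_lt_iff, h1]
  clear h h1
  tauto

/-- Removing a closed neighbourhood of a slit does not disconnect the domain. -/
lemma Conf.isPreconnected_gdom_diff_gauge {S S' : SlitSys} {F : Set ℂ} {g f : ℂ → ℂ}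
    (H : Conf S F S' g f) {e e' : ℝ} (he : 0 < e) (hee : e < e') (j : Fin S.n)
    (hring : S.ring j e' ⊆ S.dom) (hFe : ∀ z ∈ F, e' ≤ S.gauge j z) :
    IsPreconnected (gdom S F \ {z | S.gauge j z ≤ e}) := by
  have hgc : Continuous (S.gauge j) := continuous_slitGauge _ _ _
  set U := gdom S F \ {z | S.gauge j z ≤ e} with hU
  set M : Set ℂ := {z | e < S.gauge j z ∧ S.gauge j z < e'} with hM
  have hMc : IsPreconnected M := isPreconnected_slitGauge_between (S.a_lt_b j).le he hee
  have hMU : M ⊆ U := fun z hz => by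
    have h1 := hring ⟨he.trans hz.1, hz.2⟩
    exact ⟨⟨⟨h1.1, fun h => absurd (hFe z h) (not_le.2 hz.2)⟩, h1.2⟩, not_le.2 hz.1⟩
  have hUo : IsOpen U := H.isOpen_gdom.sdiff (isClosed_le hgc continuous_const)
  intro u v hu hv huv hUu hUv
  by_contra hne
  have hdisj : ∀ z ∈ U, z ∈ u → z ∉ v := fun z h1 h2 h3 => hne ⟨z, h1, h2, h3⟩
  have key : ∀ u v : Set ℂ, IsOpen u → IsOpen v → U ⊆ u ∪ v → (U ∩ v).Nonempty →
      (∀ z ∈ U, z ∈ u → z ∉ v) → ¬ (M ⊆ u ∧ (U ∩ u).Nonempty) := by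
    intro u v hu hv huv hUv hdisj hMu
    have hno : IsOpen {z | S.gauge j z < e'} := isOpen_lt hgc continuous_const
    obtain ⟨z, hzG, h1, h2⟩ := H.isPreconnected_gdom ((U ∩ u) ∪ {z | S.gauge j z < e'}) (U ∩ v)
      ((hUo.inter hu).union hno) (hUo.inter hv) (fun z hz => by
        by_cases hze : S.gauge j z ≤ e
        · exact Or.inl (Or.inr (hze.trans_lt hee))
        · rcases huv ⟨hz, hze⟩ with h | h
          · exact Or.inl (Or.inl ⟨⟨hz, hze⟩, h⟩)
          · exact Or.inr ⟨⟨hz, hze⟩, h⟩)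
      (by obtain ⟨z, hz⟩ := hMu.2; exact ⟨z, hz.1.1, Or.inl hz⟩)
      (by obtain ⟨z, hz⟩ := hUv; exact ⟨z, hz.1.1, hz⟩)
    rcases h1 with h1 | h1
    · exact hdisj z h1.1 h1.2 h2.2
    · exact hdisj z h2.1 (hMu.1 ⟨not_le.1 h2.1.2, h1⟩) h2.2
  have hM2 : M ⊆ u ∨ M ⊆ v := by
    by_contra h
    rw [not_or, not_subset, not_subset] at h
    obtain ⟨⟨p, hp, hpu⟩, q, hq, hqv⟩ := h
    obtain ⟨z, hz, hz1, hz2⟩ := hMc u v hu hv (hMU.trans huv)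
      ⟨q, hq, (huv (hMU hq)).resolve_right hqv⟩ ⟨p, hp, (huv (hMU hp)).resolve_left hpu⟩
    exact hdisj z (hMU hz) hz1 hz2
  rcases hM2 with h | h
  · exact key u v hu hv huv hUv hdisj ⟨h, hUu⟩
  · exact key v u hv hu (by rwa [union_comm]) hUu (fun z h1 h2 h3 => hdisj z h1 h3 h2) ⟨h, hUv⟩

/-- An unbounded connected subset of `G \ C` avoids every set separated by `C` from `∞`. -/
lemma notMem_of_separates {G C Q N : Set ℂ} (h : SeparatesFromInfty G C Q)
    (hN : IsPreconnected N) (hNG : N ⊆ G \ C) (hNb : ¬ IsBounded N) {z : ℂ} (hz : z ∈ N) :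
    z ∉ Q := fun hQ =>
  hNb ((h z ⟨hQ, hNG hz⟩).subset (hN.subset_connectedComponentIn hz hNG))

lemma Conf.not_isBounded_image_f {S S' : SlitSys} {F : Set ℂ} {g f : ℂ → ℂ}
    (H : Conf S F S' g f) {N : Set ℂ} (hN : N ⊆ S'.dom) (hb : ¬ IsBounded N) :
    ¬ IsBounded (f '' N) := by
  intro h
  obtain ⟨R, hR⟩ := h.exists_norm_le
  obtain ⟨B, hB⟩ := H.exists_bound_g R
  refine hb (isBounded_iff_forall_norm_le.2 ⟨B, fun w hw => ?_⟩)
  have := hB (f w) (H.maps_f (hN hw)) (hR _ (mem_image_of_mem f hw))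
  rwa [H.right_inv w (hN hw)] at this

lemma SlitSys.not_isBounded_dom_diff (S : SlitSys) (x r : ℝ) :
    ¬ IsBounded (S.dom \ closedBall (x : ℂ) r) := by
  intro h
  obtain ⟨R, hR⟩ := h.exists_norm_le
  obtain ⟨z, hz, hzn⟩ := S.exists_norm_le_mem_dom (max (R + 1) (‖(x : ℂ)‖ + r + 1))
  have h1 := le_max_left (R + 1) (‖(x : ℂ)‖ + r + 1)
  have h2 := le_max_right (R + 1) (‖(x : ℂ)‖ + r + 1)
  have := hR z ⟨hz, fun h => by
    rw [mem_closedBall, dist_eq_norm] at h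
    have := norm_le_norm_add_norm_sub (x : ℂ) z
    rw [norm_sub_rev] at this
    linarith [norm_sub_rev z (x : ℂ)]⟩
  linarith

/-- The real part of the image of a set inside a circle is controlled by the image of the
circle, as long as the set is mapped below all slits. -/
lemma Conf.exists_mem_sphere_re_eq {S S' : SlitSys} {F : Set ℂ} {g f : ℂ → ℂ}
    (H : Conf S F S' g f) {z₀ : ℂ} {r L m : ℝ} (hr : 0 ≤ r) (hL : 0 < L) (hLm : 3 * L < m)
    (hm : ∀ w ∈ S'.set, m ≤ w.im)
    (hlen : circleLength (gdom S F) g z₀ r ≤ ENNReal.ofReal L) {z : ℂ} (hz : z ∈ gdom S F)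
    (hzb : dist z z₀ ≤ r) (hzL : (g z).im ≤ L) :
    ∃ p ∈ gdom S F ∩ sphere z₀ r, (g p).re = (g z).re := by
  have hsphere := (volume_image_sphere_le H.isOpen_gdom H.holo_g imCLM norm_imCLM_le z₀ hr).trans
    hlen
  have hnot : ¬ Ioo L (3 * L) ⊆ (fun z => imCLM (g z)) '' (gdom S F ∩ sphere z₀ r) := by
    intro hsub
    have h1 := (measure_mono hsub).trans hsphere
    rw [Real.volume_Ioo, ENNReal.ofReal_le_ofReal_iff hL.le] at h1
    linarith
  obtain ⟨y, hy, hyn⟩ := not_subset.1 hnot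
  set V : Set ℂ := {w | w.re = (g z).re ∧ w.im ∈ Icc (g z).im y} with hV
  set Λ : Set ℂ := {w | w.im = y} with hΛ
  have hgz := (H.maps_g hz).1
  rw [mem_UHP] at hgz
  have hVc : IsPreconnected V := by
    have h1 : Convex ℝ {w : ℂ | w.re = (g z).re} :=
      (convex_singleton _).is_linear_preimage reLm.isLinear
    have h2 : Convex ℝ {w : ℂ | w.im ∈ Icc (g z).im y} :=
      (convex_Icc _ _).is_linear_preimage imLm.isLinear
    exact (h1.inter h2).isPreconnected
  have hΛc : IsPreconnected Λ := by
    have : Convex ℝ Λ := (convex_singleton y).is_linear_preimage imLm.isLinear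
    exact this.isPreconnected
  have hgy : (g z).im ≤ y := hzL.trans hy.1.le
  have hVΛ : IsPreconnected (V ∪ Λ) :=
    hVc.union ⟨(g z).re, y⟩ ⟨rfl, hgy, le_rfl⟩ rfl hΛc
  have hdom : V ∪ Λ ⊆ S'.dom := by
    intro w hw
    have h1 : 0 < w.im ∧ w.im ≤ y := by
      rcases hw with hw | hw
      · exact ⟨hgz.trans_le hw.2.1, hw.2.2⟩
      · rw [hΛ, mem_ofPred_eq] at hw; exact ⟨by rw [hw]; exact hL.trans hy.1, hw.le⟩
    exact ⟨h1.1, fun h => by linarith [hm w h, hy.2]⟩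
  have hub : ¬ IsBounded (V ∪ Λ) := by
    intro h
    obtain ⟨B, hB⟩ := h.exists_norm_le
    have h1 := hB ⟨|B| + 1, y⟩ (Or.inr rfl)
    have h2 := (abs_re_le_norm (⟨|B| + 1, y⟩ : ℂ)).trans h1
    have h3 := (le_abs_self _).trans h2
    simp only at h3
    linarith [le_abs_self B]
  have hub' := H.not_isBounded_image_f hdom hub
  have hfar : ∃ q ∈ f '' (V ∪ Λ), r ≤ dist q z₀ := by
    by_contra! h
    exact hub' ((isBounded_ball (x := z₀) (r := r)).subset fun q hq => h q hq)
  obtain ⟨q, hq, hqr⟩ := hfar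
  obtain ⟨p, ⟨w, hw, rfl⟩, hp⟩ := exists_mem_sphere_of_isPreconnected
    (hVΛ.image f (H.holo_f.continuousOn.mono hdom))
    ⟨g z, Or.inl ⟨rfl, le_rfl, hgy⟩, H.left_inv z hz⟩ hq hzb hqr
  refine ⟨f w, ⟨H.maps_f (hdom hw), hp⟩, ?_⟩
  rcases hw with hw | hw
  · rw [H.right_inv w (hdom (Or.inl hw))]; exact hw.1
  · refine absurd ⟨f w, ⟨H.maps_f (hdom (Or.inr hw)), hp⟩, ?_⟩ hyn
    simp only [H.right_inv w (hdom (Or.inr hw))]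
    exact hw

lemma exists_forall_image_subset_of_separates (S : SlitSys) {e R m κ : ℝ} (he : 0 < e)
    (hring : ∀ j, S.ring j e ⊆ S.dom) (hR : 0 ≤ R) (hm0 : 0 < m) (hκ : 0 < κ) :
    ∃ ε > 0, ∀ (S' : SlitSys) (F : Set ℂ) (g f : ℂ → ℂ), Conf S F S' g f →
      (∀ z ∈ gdom S F, ‖g z - z‖ ≤ R) → (∀ w ∈ S'.set, m ≤ w.im) →
      (∀ z ∈ F, ∀ j, e ≤ S.gauge j z) → ∀ C, IsCrossCut (gdom S F) C → diam C < ε →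
      ∀ Q ⊆ gdom S F, (∀ z ∈ Q, ∀ j, e ≤ S.gauge j z) → Q.Nonempty →
      SeparatesFromInfty (gdom S F) C Q → ∃ x : ℝ, g '' Q ⊆ closedBall (x : ℂ) κ := by
  set L := min (κ / 2) (m / 4) with hLdef
  have hL : 0 < L := lt_min (by linarith) (by linarith)
  have hLκ : 2 * L ≤ κ := by linarith [min_le_left (κ / 2) (m / 4)]
  have hLm : 3 * L < m := by linarith [min_le_right (κ / 2) (m / 4)]
  obtain ⟨ρ₁, hρ₁, hr⟩ := exists_forall_circleLength_le hR hL one_pos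
  refine ⟨min (e / 2) ρ₁, lt_min (half_pos he) hρ₁.1, ?_⟩
  rintro S' F g f H hgR hm hFe C ⟨c, hcc, hci, hc0, hc1, hcG, rfl⟩ hdiam Q hQ hQe hQne hsep
  have hdist : ∀ s ∈ Icc (0 : ℝ) 1, ∀ t ∈ Icc (0 : ℝ) 1, dist (c s) (c t) < min (e / 2) ρ₁ :=
    fun s hs t ht => (dist_le_diam_of_mem (isCompact_Icc.image_of_continuousOn hcc).isBounded
      (mem_image_of_mem c hs) (mem_image_of_mem c ht)).trans_lt hdiam
  have hfr : ∀ p ∈ frontier (gdom S F), p ∉ gdom S F := fun p hp => by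
    rw [H.isOpen_gdom.frontier_eq] at hp; exact hp.2
  have h0I : (0 : ℝ) ∈ Icc (0 : ℝ) 1 := ⟨le_rfl, zero_le_one⟩
  have h1I : (1 : ℝ) ∈ Icc (0 : ℝ) 1 := ⟨zero_le_one, le_rfl⟩
  have hend : ∀ a ∈ Icc (0 : ℝ) 1, c a ∈ frontier (gdom S F) → c a ∉ UHP \ F := by
    intro a ha hca hmem
    have hset : c a ∈ S.set := by
      by_contra h; exact hfr _ hca ⟨hmem, h⟩
    obtain ⟨j, hj⟩ := mem_iUnion.1 hset
    rw [mem_slit_iff] at hj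
    have hN := H.isPreconnected_gdom_diff_gauge (half_pos he) (half_lt_self he) j (hring j)
      fun z hz => hFe z hz j
    obtain ⟨z, hz⟩ := hQne
    refine notMem_of_separates hsep hN ?_ ?_ ⟨hQ hz, ?_⟩ hz
    · rintro w ⟨hw, hwe⟩
      refine ⟨hw, ?_⟩
      rintro ⟨s, hs, rfl⟩
      apply hwe
      have h1 := (hdist s hs a ha).trans_le (min_le_left _ _)
      rw [dist_eq_norm] at h1
      have h2 := abs_lt.1 ((abs_re_le_norm _).trans_lt h1)
      have h3 := abs_lt.1 ((abs_im_le_norm _).trans_lt h1)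
      have h4 := slitGauge_le_iff.1 hj
      rw [sub_re] at h2
      rw [sub_im] at h3
      exact slitGauge_le_iff.2 ⟨⟨by linarith [h4.1.1], by linarith [h4.1.2]⟩,
        by linarith [h4.2.1], by linarith [h4.2.2]⟩
    · intro hb
      have h1 := hb.union (isBounded_slitGauge_le (S.a j) (S.b j) (S.y j) (e / 2))
      obtain ⟨Y0, -, hY⟩ := H.exists_mul_I_mem
      obtain ⟨B, hB⟩ := h1.exists_norm_le
      have hn : ‖((max (|Y0|) (|B| + 1) : ℝ) : ℂ) * I‖ = max (|Y0|) (|B| + 1) := by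
        rw [norm_mul, norm_I, mul_one, norm_real, Real.norm_eq_abs,
          abs_of_nonneg ((abs_nonneg _).trans (le_max_left _ _))]
      have h5 := le_max_left |Y0| (|B| + 1)
      have h6 := le_max_right |Y0| (|B| + 1)
      have h2 := hY (((max (|Y0|) (|B| + 1) : ℝ) : ℂ) * I) (by rw [hn]; linarith [le_abs_self Y0])
        (by simp only [mul_im, ofReal_re, ofReal_im, I_re, I_im]; linarith [abs_nonneg B])
      have h3 := hB (((max (|Y0|) (|B| + 1) : ℝ) : ℂ) * I) (by
        by_cases hg : S.gauge j (((max (|Y0|) (|B| + 1) : ℝ) : ℂ) * I) ≤ e / 2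
        · exact Or.inr hg
        · exact Or.inl ⟨h2, hg⟩)
      rw [hn] at h3
      linarith [le_abs_self B]
    · rw [mem_ofPred_eq, not_le]
      exact (half_lt_self he).trans_le (hQe z hz j)
  have hCG : ∀ t ∈ Icc (0 : ℝ) 1, c t ∈ gdom S F → t ∈ Ioo (0 : ℝ) 1 := by
    intro t ht h
    refine ⟨lt_of_le_of_ne ht.1 ?_, lt_of_le_of_ne ht.2 ?_⟩
    · rintro rfl; exact hfr _ hc0 h
    · rintro rfl; exact hfr _ hc1 h
  obtain ⟨r, hrI, hrL⟩ := hr _ _ (c 0) H.isOpen_gdom H.holo_g H.inj_g hgR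
  have hr0 : 0 < r := hρ₁.1.trans hrI.1
  set σ := c '' Ioo 0 1 with hσ
  have hσb : σ ⊆ gdom S F ∩ closedBall (c 0) r := by
    rintro _ ⟨t, ht, rfl⟩
    exact ⟨hcG ⟨t, ht, rfl⟩, (((hdist t ⟨ht.1.le, ht.2.le⟩ 0 h0I).trans_le
      (min_le_right _ _)).trans hrI.1).le⟩
  have hσc : IsPreconnected σ := isPreconnected_Ioo.image c (hcc.mono Ioo_subset_Icc_self)
  have him : ∀ z ∈ σ, (g z).im ≤ L := by
    refine H.im_le_of_circleLength_le hr0.le hL.le hrL hσc hσb fun ε hε => ?_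
    have hmem : ∀ n : ℕ, 1 / ((n : ℝ) + 2) ∈ Ioo (0 : ℝ) 1 := fun n => by
      have : (0 : ℝ) ≤ n := Nat.cast_nonneg n
      exact ⟨by positivity, by rw [div_lt_one (by positivity)]; linarith⟩
    have hlim : Tendsto (fun n : ℕ => 1 / ((n : ℝ) + 2)) atTop (𝓝[Icc 0 1] 0) := by
      refine tendsto_nhdsWithin_iff.2 ⟨?_, Eventually.of_forall fun n => Ioo_subset_Icc_self (hmem n)⟩
      simp only [one_div]
      exact tendsto_inv_atTop_zero.comp
        (tendsto_natCast_atTop_atTop.atTop_add tendsto_const_nhds)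
    have := H.tendsto_im_zero (fun n => hcG ⟨_, hmem n, rfl⟩) ((hcc 0 h0I).tendsto.comp hlim)
      (hend 0 h0I hc0)
    obtain ⟨n, hn⟩ := (this.eventually_lt_const hε).exists
    exact ⟨_, ⟨_, hmem n, rfl⟩, hn⟩
  have hre : ∀ z ∈ σ, ∀ z' ∈ σ, |(g z).re - (g z').re| ≤ L := by
    intro z hz z' hz'
    have hsub : (fun z => (g z).re) '' σ ⊆
        (fun z => reCLM (g z)) '' (gdom S F ∩ sphere (c 0) r) := by
      rintro _ ⟨w, hw, rfl⟩
      obtain ⟨p, hp, hpe⟩ := H.exists_mem_sphere_re_eq hr0.le hL hLm hm hrL (hσb hw).1 (hσb hw).2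
        (him w hw)
      exact ⟨p, hp, hpe⟩
    have hconv : (fun z => (g z).re) '' σ |>.OrdConnected :=
      (hσc.image _ (continuous_re.comp_continuousOn (H.holo_g.continuousOn.mono fun w hw =>
        (hσb hw).1))).ordConnected
    have h1 := hconv.uIcc_subset (mem_image_of_mem _ hz) (mem_image_of_mem _ hz')
    have h2 := (measure_mono (μ := volume) (h1.trans hsub)).trans
      ((volume_image_sphere_le H.isOpen_gdom H.holo_g reCLM norm_reCLM_le (c 0) hr0.le).trans hrL)
    rw [uIcc, Real.volume_Icc, max_sub_min_eq_abs', ENNReal.ofReal_le_ofReal_iff hL.le] at h2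
    exact h2
  have hhalf : c (1 / 2) ∈ σ := ⟨1 / 2, by norm_num, rfl⟩
  refine ⟨(g (c (1 / 2))).re, ?_⟩
  have hball : ∀ z ∈ σ, g z ∈ closedBall (((g (c (1 / 2))).re : ℝ) : ℂ) κ := by
    intro z hz
    rw [mem_closedBall, dist_eq_norm]
    refine (norm_le_abs_re_add_abs_im _).trans ?_
    have h1 := hre z hz _ hhalf
    have h2 := him z hz
    have h3 := (H.maps_g (hσb hz).1).1
    rw [mem_UHP] at h3
    simp only [sub_re, sub_im, ofReal_re, ofReal_im, sub_zero]
    rw [abs_of_pos h3]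
    linarith
  rintro _ ⟨z, hz, rfl⟩
  by_contra hgz
  set N := S'.dom \ closedBall (((g (c (1 / 2))).re : ℝ) : ℂ) κ with hN
  have hNd : N ⊆ S'.dom := sdiff_subset
  refine notMem_of_separates hsep ((S'.isPreconnected_dom_diff _ κ).image f
    (H.holo_f.continuousOn.mono hNd)) ?_ (H.not_isBounded_image_f hNd
      (S'.not_isBounded_dom_diff _ _)) ⟨g z, ⟨H.maps_g (hQ hz), hgz⟩, H.left_inv z (hQ hz)⟩ hz
  rintro _ ⟨w, hw, rfl⟩
  refine ⟨H.maps_f hw.1, ?_⟩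
  rintro ⟨t, ht, htw⟩
  have h1 : c t ∈ gdom S F := by rw [htw]; exact H.maps_f hw.1
  have h2 := hball _ ⟨t, hCG t ht h1, htw⟩
  rw [H.right_inv w hw.1] at h2
  exact hw.2 h2

end SlitLoewner

namespace SlitLoewner

/-! ### Families of mapping-out functions -/

lemma SlitSys.mem_closure_dom (S : SlitSys) {w : ℂ} (hw : w ∈ S.set) : w ∈ closure S.dom := by
  have h1 : ∀ᶠ v in 𝓝 w.im, v ∉ S.heights \ {w.im} :=
    ((S.finite_heights.subset sdiff_subset).isClosed.isOpen_compl).mem_nhds (by simp)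
  have h2 : Tendsto (fun n : ℕ => (1 / ((n : ℝ) + 1))) atTop (𝓝 0) :=
    tendsto_one_div_add_atTop_nhds_zero_nat
  have h3 : Tendsto (fun n : ℕ => w.im + 1 / ((n : ℝ) + 1)) atTop (𝓝 w.im) := by
    simpa using h2.const_add w.im
  have h4 : Tendsto (fun n : ℕ => w + ((1 / ((n : ℝ) + 1) : ℝ) : ℂ) * I) atTop (𝓝 w) := by
    have := (((continuous_ofReal.tendsto 0).comp h2).mul_const I).const_add w
    simpa using this
  refine mem_closure_of_tendsto h4 ((h3.eventually h1).mono fun n hn => ?_)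
  have him : (w + ((1 / ((n : ℝ) + 1) : ℝ) : ℂ) * I).im = w.im + 1 / ((n : ℝ) + 1) := by
    rw [add_im, im_ofReal_mul, I_im, mul_one]
  have hpos : 0 < 1 / ((n : ℝ) + 1) := Nat.one_div_pos_of_nat
  have hwU := S.set_subset_UHP hw
  rw [mem_UHP] at hwU
  refine ⟨by rw [mem_UHP, him]; linarith, fun hm => hn ⟨him ▸ S.im_mem_heights hm, ?_⟩⟩
  rw [mem_singleton_iff]; linarith

/-- Slits move down when the hull grows. -/
lemma Conf.exists_im_le_of_mem_set {S S₁ S₂ : SlitSys} {F₁ F₂ : Set ℂ} {g₁ f₁ g₂ f₂ : ℂ → ℂ}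
    (H₁ : Conf S F₁ S₁ g₁ f₁) (H₂ : Conf S F₂ S₂ g₂ f₂) (h : F₁ ⊆ F₂) {w : ℂ}
    (hw : w ∈ S₁.set) : ∃ v ∈ S₂.set, v.im ≤ w.im := by
  obtain ⟨u, hu, huw⟩ := mem_closure_iff_seq_limit.1 (S₁.mem_closure_dom hw)
  obtain ⟨q, hq, φ, hφ, hfq⟩ := H₁.exists_mem_set_of_seg hu huw hw
  have hev : ∀ᶠ n in atTop, f₁ (u (φ n)) ∉ F₂ :=
    (hfq.eventually (isClosed_closure.isOpen_compl.eventually_mem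
      (disjoint_right.1 H₂.sep hq))).mono fun n hn hF => hn (subset_closure hF)
  have hev' : ∀ᶠ n in atTop, f₁ (u (φ n)) ∈ gdom S F₂ := hev.mono fun n hn =>
    ⟨⟨(H₁.maps_f (hu _)).1.1, hn⟩, (H₁.maps_f (hu _)).2⟩
  obtain ⟨N, hN⟩ := eventually_atTop.1 hev'
  obtain ⟨R, hR⟩ := (isBounded_range_of_tendsto _ hfq).exists_norm_le
  obtain ⟨B, hB⟩ := H₂.exists_bound_g R
  set z : ℕ → ℂ := fun n => f₁ (u (φ (n + N))) with hz
  have hzm : ∀ n, z n ∈ gdom S F₂ := fun n => hN _ (by omega)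
  have hzt : Tendsto z atTop (𝓝 q) := hfq.comp (tendsto_add_atTop_nat N)
  obtain ⟨v, -, ψ, hψ, hv⟩ := tendsto_subseq_of_bounded (x := g₂ ∘ z)
    (isBounded_closedBall (x := (0 : ℂ)) (r := B))
    (fun n => mem_closedBall_zero_iff.2 (hB _ (hzm n) (hR _ (mem_range_self (n + N)))))
  refine ⟨v, H₂.mem_set_of_pair_left (fun n => hzm (ψ n)) (hzt.comp hψ.tendsto_atTop) hv hq, ?_⟩
  have hw' : Tendsto (fun n => u (φ (ψ n + N))) atTop (𝓝 w) :=
    huw.comp (hφ.tendsto_atTop.comp ((tendsto_add_atTop_nat N).comp hψ.tendsto_atTop))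
  refine le_of_tendsto_of_tendsto ((continuous_im.tendsto _).comp hv)
    ((continuous_im.tendsto _).comp hw') (Eventually.of_forall fun n => ?_)
  have := H₁.im_anti H₂ h (hzm (ψ n))
  rwa [show g₁ (z (ψ n)) = u (φ (ψ n + N)) from H₁.right_inv _ (hu _)] at this

lemma Conf.exists_norm_sub_le_of_mem_set {S S' : SlitSys} {F : Set ℂ} {g f : ℂ → ℂ} {R : ℝ}
    (H : Conf S F S' g f) (hR : ∀ z ∈ gdom S F, ‖g z - z‖ ≤ R) {w : ℂ} (hw : w ∈ S'.set) :
    ∃ q ∈ S.set, ‖w - q‖ ≤ R := by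
  obtain ⟨u, hu, huw⟩ := mem_closure_iff_seq_limit.1 (S'.mem_closure_dom hw)
  obtain ⟨q, hq, φ, hφ, hfq⟩ := H.exists_mem_set_of_seg hu huw hw
  refine ⟨q, hq, le_of_tendsto ((huw.comp hφ.tendsto_atTop).sub hfq).norm
    (Eventually.of_forall fun n => ?_)⟩
  have := hR _ (H.maps_f (hu (φ n)))
  rwa [H.right_inv _ (hu _)] at this

/-- A family of mapping-out functions of a strictly increasing family of hulls, together with
uniform bounds. -/
structure Chain (S : SlitSys) (T : ℝ) (F : ℝ → Set ℂ) (S' : ℝ → SlitSys) (g f : ℝ → ℂ → ℂ)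
    (R m e : ℝ) : Prop where
  T_pos : 0 < T
  R_pos : 0 < R
  m_pos : 0 < m
  e_pos : 0 < e
  conf : ∀ t ∈ Icc 0 T, Conf S (F t) (S' t) (g t) (f t)
  mono : ∀ s ∈ Icc 0 T, ∀ t ∈ Icc 0 T, s ≤ t → F s ⊆ F t
  strict : ∀ s ∈ Icc 0 T, ∀ t ∈ Icc 0 T, s < t → (F t \ F s).Nonempty
  mem_gdom : ∀ t ∈ Icc 0 T, ∀ z : ℂ, R ≤ ‖z‖ → 0 < z.im → z ∈ gdom S (F t)
  near : ∀ t ∈ Icc 0 T, ∀ z ∈ gdom S (F t), ‖g t z - z‖ ≤ R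
  far : ∀ t ∈ Icc 0 T, ∀ z ∈ gdom S (F t), R ≤ ‖z‖ → ‖g t z - z‖ ≤ R / ‖z‖
  slit_im : ∀ t ∈ Icc 0 T, ∀ w ∈ (S' t).set, m ≤ w.im
  slit_norm : ∀ t ∈ Icc 0 T, ∀ w ∈ (S' t).set, ‖w‖ ≤ R
  ring : ∀ j, S.ring j e ⊆ S.dom
  gauge : ∀ t ∈ Icc 0 T, ∀ z ∈ F t, ∀ j, e ≤ S.gauge j z

lemma exists_chain {S : SlitSys} {T : ℝ} (hT : 0 < T) {F : ℝ → Set ℂ} {S' : ℝ → SlitSys}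
    {g f : ℝ → ℂ → ℂ} (hc : ∀ t ∈ Icc 0 T, Conf S (F t) (S' t) (g t) (f t))
    (hmono : ∀ s ∈ Icc 0 T, ∀ t ∈ Icc 0 T, s < t → F s ⊆ F t ∧ F s ≠ F t) :
    ∃ R m e, Chain S T F S' g f R m e := by
  have hT' : T ∈ Icc 0 T := ⟨hT.le, le_rfl⟩
  have mono : ∀ s ∈ Icc 0 T, ∀ t ∈ Icc 0 T, s ≤ t → F s ⊆ F t := fun s hs t ht hst => by
    rcases hst.eq_or_lt with rfl | h
    exacts [subset_rfl, (hmono s hs t ht h).1]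
  obtain ⟨Y0, hY0, hY⟩ := (hc T hT').exists_mul_I_mem
  have hsub : ∀ t ∈ Icc 0 T, ∀ z : ℂ, Y0 ≤ ‖z‖ → 0 < z.im → z ∈ gdom S (F t) :=
    fun t ht z h1 h2 => gdom_anti S (mono t ht T hT' ht.2) (hY z h1 h2)
  obtain ⟨RS, hRS, hS⟩ := S.exists_norm_lt
  obtain ⟨m, hm, hmy⟩ := (S' T).exists_lt_y
  obtain ⟨e1, he1, hring⟩ := S.exists_ring_subset_dom
  obtain ⟨e2, he2, hgauge⟩ := exists_pos_forall_lt_of_finite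
    (P := fun (j : Fin S.n) e => ∀ z ∈ closure (F T), e ≤ S.gauge j z) fun j => by
      obtain ⟨e, he, h⟩ := exists_lt_slitGauge (isClosed_closure (s := F T))
        ((hc T hT').sep.mono_right (S.seg_subset_set j))
      exact ⟨e, he, fun e' _ hee z hz => hee.trans (h z hz).le⟩
  refine ⟨6 * Y0 + 4 * Y0 ^ 2 + RS, m, min e1 e2, ⟨hT, by positivity, hm, lt_min he1 he2, hc, mono,
    fun s hs t ht hst => ?_, fun t ht z hz hz' => hsub t ht z ?_ hz', fun t ht z hz => ?_,
    fun t ht z hz hzR => ?_, fun t ht w hw => ?_, fun t ht w hw => ?_,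
    fun j => hring _ (lt_min he1 he2) (min_le_left _ _) j, fun t ht z hz j => ?_⟩⟩
  · rw [sdiff_nonempty]
    exact fun h => (hmono s hs t ht hst).2 ((hmono s hs t ht hst).1.antisymm h)
  · nlinarith [sq_nonneg Y0]
  · refine ((hc t ht).norm_g_sub_le' hY0 (hsub t ht) hz).trans (by nlinarith [sq_nonneg Y0])
  · refine ((hc t ht).norm_g_sub_le_div hY0 (hsub t ht) hz (by nlinarith [sq_nonneg Y0])).trans ?_
    gcongr
    linarith
  · obtain ⟨v, hv, hvw⟩ := (hc t ht).exists_im_le_of_mem_set (hc T hT') (mono t ht T hT' ht.2) hw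
    obtain ⟨j, hj⟩ := (S' T).mem_set.1 hv
    have : v.im = (S' T).y j := hj.1
    linarith [hmy j]
  · obtain ⟨q, hq, hwq⟩ := (hc t ht).exists_norm_sub_le_of_mem_set
      (fun z hz => (hc t ht).norm_g_sub_le' hY0 (hsub t ht) hz) hw
    have := norm_le_norm_add_norm_sub q w
    rw [norm_sub_rev] at this
    nlinarith [sq_nonneg Y0, hS q hq, norm_sub_rev w q]
  · exact hgauge _ (lt_min he1 he2) (min_le_right _ _) j z
      (subset_closure (mono t ht T hT' ht.2 hz))

end SlitLoewner

namespace SlitLoewner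

/-! ### The gate lemma -/

lemma edist_circle_le_circleLength {X : Set ℂ} (hX : IsOpen X) {F : ℂ → ℂ}
    (hF : DifferentiableOn ℂ F X) (z₀ : ℂ) {r : ℝ} (hr : 0 ≤ r) {θ₁ θ₂ : ℝ}
    (h1 : θ₁ ∈ Ioo (-Real.pi) Real.pi) (h2 : θ₂ ∈ Ioo (-Real.pi) Real.pi)
    (hA : ∀ θ ∈ uIcc θ₁ θ₂, circleMap z₀ r θ ∈ X) :
    edist (F (circleMap z₀ r θ₁)) (F (circleMap z₀ r θ₂)) ≤ 2 * circleLength X F z₀ r := by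
  wlog h12 : θ₁ ≤ θ₂ generalizing θ₁ θ₂
  · rw [edist_comm]
    exact this h2 h1 (by rwa [uIcc_comm]) (not_le.1 h12).le
  rw [uIcc_of_le h12] at hA
  refine (edist_circle_le hX hF z₀ hr h12 hA).trans ?_
  unfold circleLength
  gcongr
  exact fun θ hθ => ⟨h1.1.trans_le hθ.1, hθ.2.trans_lt h2.2⟩

lemma exists_circleMap_eq {w : ℂ} {x r : ℝ} (hw : dist w x = r) (him : 0 < w.im) :
    ∃ θ ∈ Ioo 0 Real.pi, w = circleMap x r θ := by
  refine ⟨arg (w - x), ⟨?_, ?_⟩, ?_⟩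
  · exact lt_of_le_of_ne (arg_nonneg_iff.2 (by simpa using him.le)) fun h => by
      have := arg_eq_zero_iff.1 h.symm
      simp at this; linarith [this.2]
  · exact lt_of_le_of_ne (arg_le_pi _) fun h => by
      have := arg_eq_pi_iff.1 h
      simp at this; linarith [this.2]
  · rw [circleMap, ← hw, dist_eq_norm, norm_mul_exp_arg_mul_I]; ring

lemma circleMap_im_ofReal (x r θ : ℝ) : (circleMap (x : ℂ) r θ).im = r * Real.sin θ := by
  simp [circleMap, exp_ofReal_mul_I_im]

lemma circleMap_re_ofReal (x r θ : ℝ) : (circleMap (x : ℂ) r θ).re = x + r * Real.cos θ := by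
  simp [circleMap, exp_ofReal_mul_I_re]

lemma exists_gate {R P m η : ℝ} (hR : 0 < R) (hP : 0 < P) (hm : 0 < m) (hη : 0 < η) :
    ∃ b > 0, b < η ∧ ∃ κ > 0, ∀ (X : Set ℂ) (ψ : ℂ → ℂ) (x : ℝ) (p : ℂ), IsOpen X →
      DifferentiableOn ℂ ψ X → InjOn ψ X → (∀ w ∈ X, ‖ψ w - w‖ ≤ R) → |x| ≤ P →
      (∀ w : ℂ, 0 < w.im → b / 2 < dist w x → (w.im < m ∨ R < ‖w‖) → w ∈ X) →
      ((∀ w ∈ X, w.im ≤ (ψ w).im) ∨ (∀ w ∈ X, (ψ w).im ≤ w.im)) →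
      ‖p‖ ≤ P → R + 1 ≤ p.im → ‖ψ p - p‖ ≤ η / 10 → |(ψ p - p).im| ≤ κ →
      ∃ r ∈ Ioo b η, ∀ w : ℂ, dist w x = r → 0 < w.im → w ∈ X ∧ dist (ψ w) x ≤ η := by
  set ρ : ℝ := min (min (m / 2) (η / 10)) 1 with hρ
  have hρ0 : 0 < ρ := by positivity
  have hρm : ρ ≤ m / 2 := (min_le_left _ _).trans (min_le_left _ _)
  have hρη : ρ ≤ η / 10 := (min_le_left _ _).trans (min_le_right _ _)
  have hρ1 : ρ ≤ 1 := min_le_right _ _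
  obtain ⟨b, hb, hlen⟩ := exists_forall_circleLength_le hR.le (by positivity : 0 < η / 10) hρ0
  have hb0 : 0 < b := hb.1
  have hbρ := hb.2
  set K : ℝ := R + P + 3 with hK
  set Λ : ℝ := P + K + P + 1 with hΛ
  set k : ℝ := 2 * Λ / (b / 2) with hk
  have hΛ0 : 0 < Λ := by positivity
  have hk0 : 0 < k := by positivity
  set κ : ℝ := η / 10 / (3 * k * Real.exp (3 * k)) with hκ
  have hκ0 : 0 < κ := by positivity
  refine ⟨b, hb0, by linarith, κ, hκ0, fun X ψ x p hX hψ hinj hnear hx hmem hsign hpP hp hpψ hpκ => ?_⟩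
  obtain ⟨r, hr, hrL⟩ := hlen X ψ x hX hψ hinj hnear
  have hr0 : 0 < r := hb0.trans hr.1
  have hxm := abs_le.1 hx
  have hpi := (abs_le.1 ((abs_im_le_norm p).trans hpP))
  have hpr := (abs_le.1 ((abs_re_le_norm p).trans hpP))
  set q₁ : ℂ := ⟨K, p.im⟩ with hq₁
  set q₂ : ℂ := ⟨K, r⟩ with hq₂
  set q₃ : ℂ := ⟨x, r⟩ with hq₃
  have hball : ∀ {q w : ℂ}, w ∈ ball q (b / 2) → |w.re - q.re| < b / 2 ∧ |w.im - q.im| < b / 2 :=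
    fun {q w} hw => by
      rw [mem_ball, dist_eq_norm] at hw
      exact ⟨by simpa using (abs_re_le_norm (w - q)).trans_lt hw,
        by simpa using (abs_im_le_norm (w - q)).trans_lt hw⟩
  have him : ∀ w : ℂ, w.im ≤ dist w x := fun w => by
    rw [dist_eq_norm]; simpa using (le_abs_self _).trans (abs_im_le_norm (w - x))
  have hre : ∀ w : ℂ, w.re - x ≤ dist w x := fun w => by
    rw [dist_eq_norm]; simpa using (le_abs_self _).trans (abs_re_le_norm (w - x))
  have hN1 : ∀ w : ℂ, w.im ≤ ‖w‖ := fun w => (le_abs_self _).trans (abs_im_le_norm w)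
  have hN2 : ∀ w : ℂ, w.re ≤ ‖w‖ := fun w => (le_abs_self _).trans (abs_re_le_norm w)
  have hseg₁ : ∀ q ∈ segment ℝ p q₁, ball q (b / 2) ⊆ X := fun q hq w hw => by
    obtain ⟨a, c, ha, hc, hac, rfl⟩ := hq
    have h := (hball hw).2
    have : (a • p + c • q₁).im = p.im := by
      simp only [add_im, real_smul, im_ofReal_mul, hq₁]; rw [← add_mul, hac, one_mul]
    rw [this, abs_lt] at h
    exact hmem w (by linarith) (by linarith [him w]) (.inr (by linarith [hN1 w]))
  have hseg₂ : ∀ q ∈ segment ℝ q₁ q₂, ball q (b / 2) ⊆ X := fun q hq w hw => by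
    obtain ⟨a, c, ha, hc, hac, rfl⟩ := hq
    have h := (hball hw).2
    have h' := (hball hw).1
    have h1 : (a • q₁ + c • q₂).re = K := by
      simp only [add_re, real_smul, re_ofReal_mul, hq₁, hq₂]; rw [← add_mul, hac, one_mul]
    have h2 : r ≤ (a • q₁ + c • q₂).im := by
      simp only [add_im, real_smul, im_ofReal_mul, hq₁, hq₂]
      nlinarith [hr.2]
    rw [abs_lt] at h h'
    rw [h1] at h'
    exact hmem w (by linarith [hr.1]) (by linarith [hre w]) (.inr (by linarith [hN2 w]))
  have hseg₃ : ∀ q ∈ segment ℝ q₂ q₃, ball q (b / 2) ⊆ X := fun q hq w hw => by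
    obtain ⟨a, c, ha, hc, hac, rfl⟩ := hq
    have h := (hball hw).2
    have : (a • q₂ + c • q₃).im = r := by
      simp only [add_im, real_smul, im_ofReal_mul, hq₂, hq₃]; rw [← add_mul, hac, one_mul]
    rw [this, abs_lt] at h
    exact hmem w (by linarith [hr.1]) (by linarith [him w, hr.1]) (.inl (by linarith [hr.2]))
  have hl₁ : 2 * ‖q₁ - p‖ / (b / 2) ≤ k := by
    rw [hk]; gcongr
    refine (norm_le_abs_re_add_abs_im _).trans ?_
    simp only [hq₁, sub_re, sub_im, sub_self, abs_zero, add_zero]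
    rw [abs_le]; constructor <;> linarith
  have hl₂ : 2 * ‖q₂ - q₁‖ / (b / 2) ≤ k := by
    rw [hk]; gcongr
    refine (norm_le_abs_re_add_abs_im _).trans ?_
    simp only [hq₁, hq₂, sub_re, sub_im, sub_self, abs_zero, zero_add]
    rw [abs_le]; constructor <;> linarith [hr.2]
  have hl₃ : 2 * ‖q₃ - q₂‖ / (b / 2) ≤ k := by
    rw [hk]; gcongr
    refine (norm_le_abs_re_add_abs_im _).trans ?_
    simp only [hq₂, hq₃, sub_re, sub_im, sub_self, abs_zero, add_zero]
    rw [abs_le]; constructor <;> linarith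
  have key : ∀ h : ℂ → ℂ, DifferentiableOn ℂ h X → (∀ w ∈ X, 0 ≤ (h w).im) → (h p).im ≤ κ →
      ‖h p‖ ≤ η / 10 → ‖h q₃‖ ≤ η / 5 := by
    intro h hh hpos hκp hpη
    obtain ⟨a1, b1⟩ := harnack_segment hh hpos (half_pos hb0) hseg₁ hl₁
    obtain ⟨a2, b2⟩ := harnack_segment hh hpos (half_pos hb0) hseg₂ hl₂
    obtain ⟨a3, b3⟩ := harnack_segment hh hpos (half_pos hb0) hseg₃ hl₃
    set E := Real.exp k with hE
    have hE1 : 1 ≤ E := Real.one_le_exp hk0.le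
    have hE3 : Real.exp (3 * k) = E ^ 3 := by rw [hE, ← Real.exp_nat_mul]; norm_num
    have c1 : (h p).im * E ≤ κ * E := by gcongr
    have c2 : (h q₁).im * E ≤ κ * E * E := by gcongr; linarith
    have c3 : (h q₂).im * E ≤ κ * E * E * E := by gcongr; linarith
    have e1 : κ * E * E ≤ κ * E * E * E := le_mul_of_one_le_right (by positivity) hE1
    have e2 : κ * E ≤ κ * E * E := le_mul_of_one_le_right (by positivity) hE1
    have hκE : 3 * (k * (κ * E * E * E)) = η / 10 := by
      rw [hκ, hE3]; field_simp
    have d1 := b1.trans (mul_le_mul_of_nonneg_left (c1.trans (e2.trans e1)) hk0.le)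
    have d2 := b2.trans (mul_le_mul_of_nonneg_left (c2.trans e1) hk0.le)
    have d3 := b3.trans (mul_le_mul_of_nonneg_left c3 hk0.le)
    have t1 := norm_le_norm_add_norm_sub (h q₂) (h q₃)
    have t2 := norm_le_norm_add_norm_sub (h q₁) (h q₂)
    have t3 := norm_le_norm_add_norm_sub (h p) (h q₁)
    linarith [norm_sub_rev (h q₃) (h q₂), norm_sub_rev (h q₂) (h q₁), norm_sub_rev (h q₁) (h p)]
  have hq₃ψ : ‖ψ q₃ - q₃‖ ≤ η / 5 := by
    rcases hsign with hs | hs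
    · exact key (fun w => ψ w - w) (hψ.sub differentiableOn_id)
        (fun w hw => by simpa using hs w hw) ((le_abs_self _).trans hpκ) hpψ
    · have := key (fun w => w - ψ w) (differentiableOn_id.sub hψ)
        (fun w hw => by simpa using hs w hw)
        (by rw [← neg_sub, neg_im]; exact (neg_le_abs _).trans hpκ) (by rwa [norm_sub_rev])
      rwa [norm_sub_rev]
  have hcm : ∀ θ ∈ Ioo 0 Real.pi, circleMap (x : ℂ) r θ ∈ X := fun θ hθ => by
    have h1 := Real.sin_pos_of_mem_Ioo hθ
    refine hmem _ ?_ ?_ (.inl ?_)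
    · rw [circleMap_im_ofReal]; positivity
    · rw [dist_comm, dist_eq_norm]; simp [circleMap, abs_of_pos hr0]; linarith [hr.1]
    · rw [circleMap_im_ofReal]; nlinarith [Real.sin_le_one θ, hr.2]
  refine ⟨r, ⟨hr.1, by linarith [hr.2]⟩, fun w hwx hw => ?_⟩
  obtain ⟨θ, hθ, rfl⟩ := exists_circleMap_eq hwx hw
  refine ⟨hcm θ hθ, ?_⟩
  have hpi := Real.pi_pos
  have hq₃' : q₃ = circleMap x r (Real.pi / 2) := by
    apply Complex.ext
    · rw [circleMap_re_ofReal]; simp [hq₃]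
    · rw [circleMap_im_ofReal]; simp [hq₃]
  have hed := edist_circle_le_circleLength hX hψ (x : ℂ) hr0.le (θ₁ := θ) (θ₂ := Real.pi / 2)
    ⟨by linarith [hθ.1], hθ.2⟩ ⟨by linarith, by linarith⟩ fun θ' h' => by
      refine hcm θ' ⟨lt_of_lt_of_le (lt_min hθ.1 (by positivity)) h'.1,
        lt_of_le_of_lt h'.2 (max_lt hθ.2 (by linarith))⟩
  have hed' : dist (ψ (circleMap x r θ)) (ψ q₃) ≤ 2 * (η / 10) := by
    rw [← hq₃'] at hed
    rw [← ENNReal.ofReal_le_ofReal_iff (by positivity), ← edist_dist,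
      ENNReal.ofReal_mul (by norm_num)]
    refine hed.trans ?_
    rw [ENNReal.ofReal_ofNat]
    gcongr
  have hqx : dist q₃ x = r := by
    rw [dist_eq_norm, show q₃ - x = (r : ℂ) * I by apply Complex.ext <;> simp [hq₃], norm_mul,
      norm_I, mul_one, norm_real, Real.norm_eq_abs, abs_of_pos hr0]
  have t1 := dist_triangle4 (ψ (circleMap x r θ)) (ψ q₃) q₃ x
  rw [dist_eq_norm (ψ q₃) q₃] at t1
  linarith [hr.2]

end SlitLoewner

namespace SlitLoewner

lemma exists_dist_eq_of_not_isBounded {N : Set ℂ} (hN : IsPreconnected N) (hb : ¬ IsBounded N)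
    {φ : ℂ → ℂ} (hφ : ContinuousOn φ N) {R : ℝ} (hR : ∀ n ∈ N, ‖φ n - n‖ ≤ R) {c : ℂ} {r : ℝ}
    {n₀ : ℂ} (hn₀ : n₀ ∈ N) (h : dist (φ n₀) c ≤ r) : ∃ n ∈ N, dist (φ n) c = r := by
  have : ∃ n ∈ N, r ≤ dist (φ n) c := by
    by_contra! hcon
    refine hb (isBounded_iff_forall_norm_le.2 ⟨r + R + ‖c‖, fun n hn => ?_⟩)
    have h1 := hcon n hn
    have h2 := hR n hn
    rw [dist_eq_norm] at h1
    have h3 := norm_le_norm_add_norm_sub (φ n) n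
    have h4 := norm_le_norm_add_norm_sub c (φ n)
    rw [norm_sub_rev] at h4
    linarith [norm_sub_rev n (φ n), norm_sub_rev (φ n) c]
  obtain ⟨n₁, hn₁, h1⟩ := this
  obtain ⟨z, ⟨n, hn, rfl⟩, hz⟩ := exists_mem_sphere_of_isPreconnected (hN.image φ hφ)
    (mem_image_of_mem φ hn₀) (mem_image_of_mem φ hn₁) h h1
  exact ⟨n, hn, hz⟩

namespace Chain

variable {S : SlitSys} {T : ℝ} {F : ℝ → Set ℂ} {S' : ℝ → SlitSys} {g f : ℝ → ℂ → ℂ}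
  {R m e : ℝ}

lemma gdom_subset (C : Chain S T F S' g f R m e) {s u : ℝ} (hs : s ∈ Icc 0 T) (hu : u ∈ Icc 0 T)
    (h : s ≤ u) : gdom S (F u) ⊆ gdom S (F s) := gdom_anti S (C.mono s hs u hu h)

lemma mem_gdom_of_mem (C : Chain S T F S' g f R m e) {s u : ℝ}
    (hu : u ∈ Icc 0 T) {z : ℂ} (hz : z ∈ F u) (hzs : z ∉ F s) : z ∈ gdom S (F s) :=
  ⟨⟨(C.conf u hu).hull.1 hz, hzs⟩, fun h => disjoint_left.1 (C.conf u hu).sep (subset_closure hz) h⟩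

lemma f_mem_gdom (C : Chain S T F S' g f R m e) {s u : ℝ} (hs : s ∈ Icc 0 T)
    {w : ℂ} (hw : w ∈ (S' s).dom) (hK : w ∉ g s '' (F u \ F s)) : f s w ∈ gdom S (F u) := by
  have h := (C.conf s hs).maps_f hw
  exact ⟨⟨h.1.1, fun hF => hK ⟨f s w, ⟨hF, h.1.2⟩, (C.conf s hs).right_inv w hw⟩⟩, h.2⟩

lemma norm_trans_sub_le (C : Chain S T F S' g f R m e) {s u : ℝ} (hs : s ∈ Icc 0 T)
    (hu : u ∈ Icc 0 T) {w : ℂ} (hw : w ∈ (S' s).dom) (h : f s w ∈ gdom S (F u)) :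
    ‖g u (f s w) - w‖ ≤ 2 * R := by
  have h1 := C.near u hu _ h
  have h2 := C.near s hs _ ((C.conf s hs).maps_f hw)
  rw [(C.conf s hs).right_inv w hw] at h2
  have := norm_sub_le_norm_sub_add_norm_sub (g u (f s w)) (f s w) w
  linarith [norm_sub_rev w (f s w)]

lemma mem_dom_of_im_lt (C : Chain S T F S' g f R m e) {s : ℝ} (hs : s ∈ Icc 0 T) {w : ℂ}
    (hw : 0 < w.im) (h : w.im < m ∨ R < ‖w‖) : w ∈ (S' s).dom :=
  ⟨hw, fun hS => h.elim (fun h => (C.slit_im s hs w hS).not_gt h)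
    fun h => (C.slit_norm s hs w hS).not_gt h⟩

lemma im_anti (C : Chain S T F S' g f R m e) {s u : ℝ} (hs : s ∈ Icc 0 T) (hu : u ∈ Icc 0 T)
    (h : s ≤ u) {z : ℂ} (hz : z ∈ gdom S (F u)) : (g u z).im ≤ (g s z).im :=
  (C.conf s hs).im_anti (C.conf u hu) (C.mono s hs u hu h) hz

lemma differentiableOn_inv_trans (C : Chain S T F S' g f R m e) {s u : ℝ} (hs : s ∈ Icc 0 T)
    (hu : u ∈ Icc 0 T) (h : s ≤ u) :
    DifferentiableOn ℂ (fun w => g u (f s w)) (g s '' gdom S (F u)) := by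
  have hsub := C.gdom_subset hs hu h
  refine (C.conf u hu).holo_g.comp ((C.conf s hs).holo_f.mono ?_) ?_
  · rintro _ ⟨z, hz, rfl⟩; exact (C.conf s hs).maps_g (hsub hz)
  · rintro _ ⟨z, hz, rfl⟩; rwa [(C.conf s hs).left_inv z (hsub hz)]

/-- Semicircles of suitable radii are moved only slightly by the transition maps. -/
lemma exists_gate (C : Chain S T F S' g f R m e) (M : ℝ) {η : ℝ} (hη : 0 < η) :
    ∃ b > 0, b < η ∧ ∃ Y > 0, R ≤ Y ∧ ∃ κ > 0, ∀ s ∈ Icc 0 T, ∀ u ∈ Icc 0 T, s ≤ u → ∀ x : ℝ, |x| ≤ M →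
      (g s (Y * I)).im - (g u (Y * I)).im ≤ κ →
      (g s '' (F u \ F s) ⊆ closedBall (x : ℂ) (b / 2) → ∃ r ∈ Ioo b η, ∀ w : ℂ, dist w x = r →
        0 < w.im → dist (g u (f s w)) x ≤ η) ∧
      ∃ r ∈ Ioo b η, ∀ w : ℂ, dist w x = r → 0 < w.im → dist (g s (f u w)) x ≤ η := by
  have hR := C.R_pos
  set Y : ℝ := 3 * R + 1 + 20 * R / η with hY
  have hY0 : 0 < Y := by positivity
  have hRY : 3 * R + 1 ≤ Y := by rw [hY]; linarith [div_pos (mul_pos (by norm_num : (0:ℝ) < 20) hR) hη]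
  set P : ℝ := |M| + Y + R with hP
  have hP0 : 0 < P := by positivity
  obtain ⟨b, hb, hbη, κ, hκ, hgate⟩ := SlitLoewner.exists_gate (R := 2 * R) (by positivity) hP0
    C.m_pos hη
  have hYI : ‖(Y * I : ℂ)‖ = Y := by simp [abs_of_pos hY0]
  have hYim : (Y * I : ℂ).im = Y := by simp
  have hmem : ∀ t ∈ Icc 0 T, (Y * I : ℂ) ∈ gdom S (F t) := fun t ht =>
    C.mem_gdom t ht _ (by rw [hYI]; linarith) (by rw [hYim]; exact hY0)
  have hfar : ∀ t ∈ Icc 0 T, ‖g t (Y * I) - Y * I‖ ≤ η / 20 := fun t ht => by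
    refine (C.far t ht _ (hmem t ht) (by rw [hYI]; linarith)).trans ?_
    rw [hYI, div_le_iff₀ hY0, hY]
    have : η / 20 * (3 * R + 1 + 20 * R / η) = η / 20 * (3 * R + 1) + R := by field_simp
    rw [this]; nlinarith [mul_pos hη hR]
  have hp : ∀ t ∈ Icc 0 T, ‖g t (Y * I)‖ ≤ P ∧ 2 * R + 1 ≤ (g t (Y * I)).im := fun t ht => by
    have h1 := C.near t ht _ (hmem t ht)
    have h2 := norm_le_norm_add_norm_sub (Y * I : ℂ) (g t (Y * I))
    have h3 := (abs_le.1 ((abs_im_le_norm _).trans h1)).1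
    rw [sub_im, hYim] at h3
    rw [hYI] at h2
    exact ⟨by linarith [abs_nonneg M, norm_sub_rev (Y * I : ℂ) (g t (Y * I))], by linarith⟩
  have hdiff : ∀ s ∈ Icc 0 T, ∀ u ∈ Icc 0 T, ‖g u (Y * I) - g s (Y * I)‖ ≤ η / 10 := fun s hs u hu => by
    have := norm_sub_le_norm_sub_add_norm_sub (g u (Y * I)) (Y * I) (g s (Y * I))
    linarith [hfar s hs, hfar u hu, norm_sub_rev (Y * I : ℂ) (g s (Y * I))]
  refine ⟨b, hb, hbη, Y, hY0, by linarith, κ, hκ, fun s hs u hu hsu x hx hcap => ?_⟩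
  have hxP : |x| ≤ P := hx.trans ((le_abs_self M).trans (by rw [hP]; linarith))
  have hsub := C.gdom_subset hs hu hsu
  have Hs := C.conf s hs
  have Hu := C.conf u hu
  have hanti := C.im_anti hs hu hsu (hmem u hu)
  constructor
  · intro hK
    obtain ⟨r, hr, h⟩ := hgate (g s '' gdom S (F u)) (fun w => g u (f s w)) x (g s (Y * I))
      (Hs.isOpen_image_g Hu.isOpen_gdom hsub) (C.differentiableOn_inv_trans hs hu hsu) (by
        rintro _ ⟨z, hz, rfl⟩ _ ⟨z', hz', rfl⟩ h
        simp only [Hs.left_inv z (hsub hz), Hs.left_inv z' (hsub hz')] at h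
        rw [Hu.inj_g hz hz' h]) (by
        rintro _ ⟨z, hz, rfl⟩
        exact C.norm_trans_sub_le hs hu (Hs.maps_g (hsub hz)) (by rwa [Hs.left_inv z (hsub hz)]))
      hxP (fun w hw hwb hwm => by
        have hwd : w ∈ (S' s).dom := C.mem_dom_of_im_lt hs hw (hwm.imp id fun h => by linarith)
        exact ⟨f s w, C.f_mem_gdom hs hwd fun h => (mem_closedBall.1 (hK h)).not_gt hwb,
          Hs.right_inv w hwd⟩)
      (.inr (by
        rintro _ ⟨z, hz, rfl⟩
        simp only [Hs.left_inv z (hsub hz)]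
        exact C.im_anti hs hu hsu hz))
      (hp s hs).1 (hp s hs).2 (by rw [Hs.left_inv _ (hmem s hs)]; exact hdiff s hs u hu) (by
        rw [Hs.left_inv _ (hmem s hs), sub_im, abs_le]; constructor <;> linarith)
    exact ⟨r, hr, fun w hw hw0 => (h w hw hw0).2⟩
  · obtain ⟨r, hr, h⟩ := hgate (S' u).dom (fun w => g s (f u w)) x (g u (Y * I))
      (S' u).isOpen_dom (Hs.differentiableOn_trans Hu (C.mono s hs u hu hsu))
      (fun w hw w' hw' h => Hu.inj_f hw hw'
        (Hs.inj_g (hsub (Hu.maps_f hw)) (hsub (Hu.maps_f hw')) h))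
      (fun w hw => C.norm_trans_sub_le hu hs hw (hsub (Hu.maps_f hw)))
      hxP (fun w hw hwb hwm => C.mem_dom_of_im_lt hu hw (hwm.imp id fun h => by linarith))
      (.inl fun w hw => Hs.im_le_im_trans Hu (C.mono s hs u hu hsu) hw)
      (hp u hu).1 (hp u hu).2 (by rw [Hu.left_inv _ (hmem u hu)]; exact hdiff u hu s hs) (by
        rw [Hu.left_inv _ (hmem u hu), sub_im, abs_le]; constructor <;> linarith)
    exact ⟨r, hr, fun w hw hw0 => (h w hw hw0).2⟩

/-- Small hull increments seen from an earlier time are small seen from a later time. -/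
lemma dist_le_of_gate_forward (C : Chain S T F S' g f R m e) {s u u' : ℝ} (hs : s ∈ Icc 0 T)
    (hu : u ∈ Icc 0 T) (hu' : u' ∈ Icc 0 T) (hsu : s ≤ u) {x r η : ℝ}
    (hgate : ∀ w : ℂ, dist w x = r → 0 < w.im → dist (g u (f s w)) x ≤ η) {q : ℂ}
    (hq : q ∈ F u' \ F u) (hqr : dist (g s q) x ≤ r) : dist (g u q) x ≤ η := by
  by_contra hcon
  have Hs := C.conf s hs
  have Hu := C.conf u hu
  have hsub := C.gdom_subset hs hu hsu
  have hqu := C.mem_gdom_of_mem hu' hq.1 hq.2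
  obtain ⟨n, hn, hnr⟩ := exists_dist_eq_of_not_isBounded ((S' u).isPreconnected_dom_diff x η)
    ((S' u).not_isBounded_dom_diff x η) (φ := fun w => g s (f u w))
    ((Hs.differentiableOn_trans Hu (C.mono s hs u hu hsu)).continuousOn.mono sdiff_subset)
    (R := 2 * R) (fun w hw => C.norm_trans_sub_le hu hs hw.1 (hsub (Hu.maps_f hw.1)))
    (n₀ := g u q) ⟨Hu.maps_g hqu, hcon⟩ (by simpa only [Hu.left_inv q hqu] using hqr)
  have hfn := Hu.maps_f hn.1
  have := hgate _ hnr ((S' s).im_pos (Hs.maps_g (hsub hfn)))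
  rw [Hs.left_inv _ (hsub hfn), Hu.right_inv n hn.1] at this
  exact hn.2 this

/-- Small hull increments seen from a later time are small seen from an earlier time. -/
lemma dist_le_of_gate_backward (C : Chain S T F S' g f R m e) {s u u' : ℝ} (hs : s ∈ Icc 0 T)
    (hu : u ∈ Icc 0 T) (hu' : u' ∈ Icc 0 T) (hsu : s ≤ u) {x x' a r η : ℝ}
    (hgate : ∀ w : ℂ, dist w x' = r → 0 < w.im → dist (g s (f u w)) x' ≤ η)
    (hK : g s '' (F u \ F s) ⊆ closedBall (x : ℂ) a) (hxx : |x' - x| + η ≤ a)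
    {q : ℂ} (hq : q ∈ F u' \ F u) (hqr : dist (g u q) x' ≤ r) : dist (g s q) x ≤ a := by
  by_contra hcon
  have Hs := C.conf s hs
  have Hu := C.conf u hu
  have hsub := C.gdom_subset hs hu hsu
  have hqu := C.mem_gdom_of_mem hu' hq.1 hq.2
  have hN : ∀ w ∈ (S' s).dom \ closedBall (x : ℂ) a, f s w ∈ gdom S (F u) := fun w hw =>
    C.f_mem_gdom hs hw.1 fun h => hw.2 (hK h)
  obtain ⟨n, hn, hnr⟩ := exists_dist_eq_of_not_isBounded ((S' s).isPreconnected_dom_diff x a)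
    ((S' s).not_isBounded_dom_diff x a) (φ := fun w => g u (f s w))
    ((C.differentiableOn_inv_trans hs hu hsu).continuousOn.mono fun w hw =>
      ⟨f s w, hN w hw, Hs.right_inv w hw.1⟩)
    (R := 2 * R) (fun w hw => C.norm_trans_sub_le hs hu hw.1 (hN w hw))
    (n₀ := g s q) ⟨Hs.maps_g (hsub hqu), hcon⟩ (by simpa only [Hs.left_inv q (hsub hqu)] using hqr)
  have hfn := hN n hn
  have := hgate _ hnr ((S' u).im_pos (Hu.maps_g hfn))
  rw [Hu.left_inv _ hfn, Hs.right_inv n hn.1] at this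
  refine hn.2 (mem_closedBall.2 ((dist_triangle n x' x).trans (le_trans ?_ hxx)))
  rw [add_comm]
  refine add_le_add (le_of_eq ?_) this
  rw [dist_eq_norm, ← ofReal_sub, norm_real, Real.norm_eq_abs]

/-- The decrease of the imaginary part is controlled by the size of the hull increment. -/
lemma im_sub_le (C : Chain S T F S' g f R m e) {s u : ℝ} (hs : s ∈ Icc 0 T)
    (hu : u ∈ Icc 0 T) (hsu : s ≤ u) {M : ℝ} (hM : 0 ≤ M)
    (hK : ∀ z ∈ (F u \ F s) ∩ closure (gdom S (F u)), (g s z).im ≤ M) {z : ℂ}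
    (hz : z ∈ gdom S (F u)) : (g s z).im - (g u z).im ≤ M := by
  have := (C.conf s hs).im_trans_le (C.conf u hu) (C.mono s hs u hu hsu) hM hK
    ((C.conf u hu).maps_g hz)
  rw [(C.conf u hu).left_inv z hz] at this
  linarith

end Chain

end SlitLoewner

namespace SlitLoewner

/-! ### Local growth implies a continuous driving function -/

lemma im_le_of_mem_closedBall {w : ℂ} {x r : ℝ} (h : w ∈ closedBall (x : ℂ) r) : w.im ≤ r := by
  rw [mem_closedBall, dist_eq_norm] at h
  simpa using (le_abs_self _).trans ((abs_im_le_norm (w - x)).trans h)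

lemma dom_diff (S : SlitSys) (F : Set ℂ) : S.dom \ F = gdom S F := Set.sdiff_sdiff_comm

namespace Chain

variable {S : SlitSys} {T : ℝ} {F : ℝ → Set ℂ} {S' : ℝ → SlitSys} {g f : ℝ → ℂ → ℂ}
  {R m e : ℝ}

lemma exists_image_subset_of_localGrowth (C : Chain S T F S' g f R m e)
    (h : LocalGrowth T S.dom F) {η τ : ℝ} (hη : 0 < η) (hτ : 0 < τ) :
    ∃ δ ∈ Ioo 0 T, δ ≤ τ ∧ ∀ t ∈ Icc 0 (T - δ), ∃ x : ℝ,
      g t '' (F (t + δ) \ F t) ⊆ closedBall (x : ℂ) η := by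
  have hT := C.T_pos
  have h0 : (0 : ℝ) ∈ Icc 0 T := ⟨le_rfl, hT.le⟩
  have hτ' : min τ T ∈ Icc 0 T := ⟨(lt_min hτ hT).le, min_le_right _ _⟩
  obtain ⟨q, hq, hq0⟩ := C.strict 0 h0 _ hτ' (lt_min hτ hT)
  have him := (S' 0).im_pos ((C.conf 0 h0).maps_g (C.mem_gdom_of_mem hτ' hq hq0))
  obtain ⟨ε, hε, hL⟩ := exists_forall_image_subset_of_separates S C.e_pos C.ring C.R_pos.le C.m_pos
    (lt_min hη (half_pos him))
  obtain ⟨δ, hδ, hcut⟩ := h ε hε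
  have key : ∀ t ∈ Icc 0 (T - δ), ∃ x : ℝ,
      g t '' (F (t + δ) \ F t) ⊆ closedBall (x : ℂ) (min η ((g 0 q).im / 2)) := fun t ht => by
    have ht1 : t ∈ Icc 0 T := ⟨ht.1, by linarith [ht.2, hδ.1]⟩
    have ht2 : t + δ ∈ Icc 0 T := ⟨by linarith [ht.1, hδ.1], by linarith [ht.2]⟩
    obtain ⟨c, hc, hcd, hsep⟩ := hcut t ht
    rw [dom_diff] at hc hsep
    exact hL (S' t) (F t) (g t) (f t) (C.conf t ht1) (C.near t ht1) (C.slit_im t ht1)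
      (C.gauge t ht1) c hc hcd _ (fun z hz => C.mem_gdom_of_mem ht2 hz.1 hz.2)
      (fun z hz => C.gauge _ ht2 z hz.1) (C.strict t ht1 _ ht2 (by linarith [hδ.1])) hsep
  refine ⟨δ, hδ, ?_, fun t ht => (key t ht).imp fun x hx =>
    hx.trans (closedBall_subset_closedBall (min_le_left _ _))⟩
  by_contra! hcon
  obtain ⟨x, hx⟩ := key 0 ⟨le_rfl, by linarith [hδ.2]⟩
  have hqδ : q ∈ F (0 + δ) := by
    rw [zero_add]
    exact C.mono _ hτ' δ ⟨hδ.1.le, hδ.2.le⟩ ((min_le_left _ _).trans hcon.le) hq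
  have := (im_le_of_mem_closedBall (hx (mem_image_of_mem _ ⟨hqδ, hq0⟩))).trans (min_le_right _ _)
  linarith

lemma norm_image_le (C : Chain S T F S' g f R m e) {s u : ℝ} (hs : s ∈ Icc 0 T)
    (hu : u ∈ Icc 0 T) : g s '' (F u \ F s) ⊆ closedBall 0 (2 * R) := by
  rintro _ ⟨z, hz, rfl⟩
  have hzR : ‖z‖ < R := by
    by_contra! h
    exact (C.mem_gdom u hu z h ((C.conf u hu).hull.1 hz.1)).1.2 hz.1
  have h1 := C.near s hs z (C.mem_gdom_of_mem hu hz.1 hz.2)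
  have h2 := norm_le_norm_add_norm_sub z (g s z)
  rw [mem_closedBall_zero_iff]
  linarith [norm_sub_rev z (g s z)]

/-- The set of limit points of the hull increments at time `t`. -/
def tip (T : ℝ) (F : ℝ → Set ℂ) (g : ℝ → ℂ → ℂ) (t : ℝ) : Set ℂ :=
  ⋂ δ ∈ Ioc 0 (T - t), closure (g t '' (F (t + δ) \ F t))

lemma tip_nonempty (C : Chain S T F S' g f R m e) {t : ℝ} (ht : t ∈ Ico 0 T) :
    (tip T F g t).Nonempty := by
  have ht1 : t ∈ Icc 0 T := ⟨ht.1, ht.2.le⟩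
  have hmem : ∀ δ : Ioc 0 (T - t), t + δ ∈ Icc 0 T := fun δ =>
    ⟨by linarith [ht.1, δ.2.1], by linarith [δ.2.2]⟩
  have : Nonempty (Ioc 0 (T - t)) := ⟨⟨T - t, by linarith [ht.2], le_rfl⟩⟩
  rw [tip, biInter_eq_iInter]
  refine IsCompact.nonempty_iInter_of_directed_nonempty_isCompact_isClosed _ ?_ ?_ ?_ ?_
  · refine directed_of_isDirected_ge fun δ δ' hδ => closure_mono (image_mono (sdiff_subset_sdiff_left ?_))
    exact C.mono _ (hmem _) _ (hmem _) (by simpa using hδ)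
  · exact fun δ => ((C.strict t ht1 _ (hmem δ) (by linarith [δ.2.1])).image _).closure
  · exact fun δ => ((isBounded_closedBall).subset (C.norm_image_le ht1 (hmem δ))).isCompact_closure
  · exact fun δ => isClosed_closure

lemma tip_subset {t δ : ℝ} (hδ : 0 < δ)
    (h : t + δ ≤ T) {K : Set ℂ} (hK : IsClosed K) (hsub : g t '' (F (t + δ) \ F t) ⊆ K) :
    tip T F g t ⊆ K :=
  (biInter_subset_of_mem (show δ ∈ Ioc 0 (T - t) from ⟨hδ, by linarith⟩)).trans
    (closure_minimal hsub hK)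

lemma exists_tip_eq (C : Chain S T F S' g f R m e) (h : LocalGrowth T S.dom F) :
    ∃ ξ : ℝ → ℝ, (∀ t ∈ Ico 0 T, tip T F g t = {(ξ t : ℂ)}) ∧
      ∀ a > 0, ∀ τ > 0, ∃ δ ∈ Ioo 0 T, δ ≤ τ ∧ ∀ t ∈ Icc 0 (T - δ),
        g t '' (F (t + δ) \ F t) ⊆ closedBall (ξ t : ℂ) a := by
  have hex : ∀ t, ∃ ξ : ℝ, t ∈ Ico 0 T → tip T F g t = {(ξ : ℂ)} := by
    intro t
    by_cases ht : t ∈ Ico 0 T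
    swap
    · exact ⟨0, fun h => (ht h).elim⟩
    obtain ⟨w, hw⟩ := C.tip_nonempty ht
    have hsmall : ∀ η > 0, ∃ x : ℝ, tip T F g t ⊆ closedBall (x : ℂ) η := fun η hη => by
      obtain ⟨δ, hδ, hδt, hx⟩ := C.exists_image_subset_of_localGrowth h hη (sub_pos.2 ht.2)
      obtain ⟨x, hx⟩ := hx t ⟨ht.1, by linarith⟩
      exact ⟨x, tip_subset (T := T) hδ.1 (by linarith) isClosed_closedBall hx⟩
    have him : w.im = 0 := by
      by_contra hne
      obtain ⟨x, hx⟩ := hsmall (|w.im| / 2) (by positivity)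
      have h1 := hx hw
      rw [mem_closedBall, dist_eq_norm] at h1
      have h2 := (abs_im_le_norm (w - x)).trans h1
      have h3 : 0 < |w.im| := abs_pos.2 hne
      rw [sub_im, ofReal_im, sub_zero] at h2
      linarith
    have hwr : ((w.re : ℝ) : ℂ) = w := Complex.ext (by simp) (by simp [him])
    refine ⟨w.re, fun _ => eq_singleton_iff_unique_mem.2 ⟨by rwa [hwr], fun v hv => ?_⟩⟩
    rw [hwr]
    by_contra hne
    obtain ⟨x, hx⟩ := hsmall (dist v w / 4) (by have := dist_pos.2 hne; positivity)
    have h1 := mem_closedBall.1 (hx hv)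
    have h2 := mem_closedBall'.1 (hx hw)
    have := dist_triangle v x w
    linarith [dist_pos.2 hne]
  choose ξ hξ using hex
  refine ⟨ξ, hξ, fun a ha τ hτ => ?_⟩
  obtain ⟨δ, hδ, hδτ, hx⟩ := C.exists_image_subset_of_localGrowth h (half_pos ha) hτ
  refine ⟨δ, hδ, hδτ, fun t ht => ?_⟩
  obtain ⟨x, hx⟩ := hx t ht
  have h1 := tip_subset (T := T) hδ.1 (by linarith [ht.2]) isClosed_closedBall hx
  rw [hξ t ⟨ht.1, by linarith [ht.2, hδ.1]⟩, singleton_subset_iff, mem_closedBall'] at h1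
  refine hx.trans (closedBall_subset_closedBall' (by linarith))

lemma abs_le_of_tip_eq (C : Chain S T F S' g f R m e) {t ξ : ℝ} (ht : t ∈ Ico 0 T)
    (h : tip T F g t = {(ξ : ℂ)}) : |ξ| ≤ 2 * R := by
  have := tip_subset (T := T) (F := F) (g := g) (t := t) (δ := T - t) (by linarith [ht.2]) (by linarith)
    isClosed_closedBall (C.norm_image_le ⟨ht.1, ht.2.le⟩ (by
      rw [add_sub_cancel]; exact ⟨C.T_pos.le, le_rfl⟩))
  rw [h, singleton_subset_iff, mem_closedBall_zero_iff, norm_real] at this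
  exact this

lemma norm_mul_I {Y : ℝ} (hY : 0 < Y) : ‖(Y * I : ℂ)‖ = Y := by simp [abs_of_pos hY]

lemma mul_I_mem (C : Chain S T F S' g f R m e) {t Y : ℝ} (ht : t ∈ Icc 0 T) (hY : 0 < Y)
    (hRY : R ≤ Y) : (Y * I : ℂ) ∈ gdom S (F t) :=
  C.mem_gdom t ht _ (by rwa [norm_mul_I hY]) (by simpa using hY)

lemma exists_dist_lt_of_tip (C : Chain S T F S' g f R m e) {ξ : ℝ → ℝ}
    (hξ : ∀ t ∈ Ico 0 T, tip T F g t = {(ξ t : ℂ)})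
    (h : ∀ a > 0, ∀ τ > 0, ∃ δ ∈ Ioo 0 T, δ ≤ τ ∧ ∀ t ∈ Icc 0 (T - δ),
        g t '' (F (t + δ) \ F t) ⊆ closedBall (ξ t : ℂ) a) {η : ℝ} (hη : 0 < η) :
    ∃ δ > 0, ∀ s ∈ Ico 0 T, ∀ t ∈ Ico 0 T, s ≤ t → t < s + δ → |ξ t - ξ s| ≤ 2 * η := by
  obtain ⟨b, hb, hbη, Y, hY, hRY, κ, hκ, hgate⟩ := C.exists_gate (2 * R) hη
  obtain ⟨δ, hδ, -, hK⟩ := h (min (b / 2) κ) (lt_min (half_pos hb) hκ) 1 one_pos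
  have key : ∀ s ∈ Icc 0 (T - δ), ∀ t ∈ Ico s (s + δ), |ξ t - ξ s| ≤ η := by
    intro s hs t ht
    have hs1 : s ∈ Icc 0 T := ⟨hs.1, by linarith [hs.2, hδ.1]⟩
    have ht1 : t ∈ Icc 0 T := ⟨by linarith [hs.1, ht.1], by linarith [hs.2, ht.2]⟩
    have hu1 : s + δ ∈ Icc 0 T := ⟨by linarith [hs.1, hδ.1], by linarith [hs.2]⟩
    have hsub : g s '' (F t \ F s) ⊆ g s '' (F (s + δ) \ F s) :=
      image_mono (sdiff_subset_sdiff_left (C.mono t ht1 _ hu1 ht.2.le))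
    have hK' := hK s hs
    have hξs : ξ s ∈ Icc (-(2 * R)) (2 * R) := abs_le.1
      (C.abs_le_of_tip_eq ⟨hs.1, by linarith [hs.2, hδ.1]⟩ (hξ s ⟨hs.1, by linarith [hs.2, hδ.1]⟩))
    obtain ⟨r, hr, hg⟩ := (hgate s hs1 t ht1 ht.1 (ξ s) (abs_le.2 hξs)
      (C.im_sub_le hs1 ht1 ht.1 hκ.le (fun z hz => (im_le_of_mem_closedBall
        (hK' (hsub (mem_image_of_mem _ hz.1)))).trans (min_le_right _ _))
          (C.mul_I_mem ht1 hY hRY))).1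
      ((hsub.trans hK').trans (closedBall_subset_closedBall (min_le_left _ _)))
    have hsub2 : g t '' (F (s + δ) \ F t) ⊆ closedBall (ξ s : ℂ) η := by
      rintro _ ⟨q, hq, rfl⟩
      refine C.dist_le_of_gate_forward hs1 ht1 hu1 ht.1 hg hq ?_
      have := hK' (mem_image_of_mem _ ⟨hq.1, fun h => hq.2 (C.mono s hs1 t ht1 ht.1 h)⟩)
      exact (mem_closedBall.1 this).trans ((min_le_left _ _).trans (by linarith [hr.1]))
    have := tip_subset (T := T) (F := F) (g := g) (t := t) (δ := s + δ - t) (by linarith [ht.2])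
      (by linarith [hs.2]) isClosed_closedBall (by rwa [add_sub_cancel])
    rw [hξ t ⟨ht1.1, by linarith [hs.2, ht.2]⟩, singleton_subset_iff, mem_closedBall, dist_eq_norm,
      ← ofReal_sub, norm_real] at this
    exact this
  refine ⟨δ, hδ.1, fun s hs t ht hst hts => ?_⟩
  rcases le_total s (T - δ) with h1 | h1
  · linarith [key s ⟨hs.1, h1⟩ t ⟨hst, hts⟩]
  · have h2 := key (T - δ) ⟨by linarith [hδ.2], le_rfl⟩ s ⟨h1, by linarith [hs.2]⟩
    have h3 := key (T - δ) ⟨by linarith [hδ.2], le_rfl⟩ t ⟨by linarith, by linarith [ht.2]⟩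
    rw [abs_le] at *
    constructor <;> linarith [h2.1, h2.2, h3.1, h3.2]

lemma exists_continuousOn_of_dist {ξ : ℝ → ℝ} {T : ℝ} (hT : 0 < T)
    (h : ∀ η > 0, ∃ δ > 0, ∀ s ∈ Ico 0 T, ∀ t ∈ Ico 0 T, s ≤ t → t < s + δ →
      |ξ t - ξ s| ≤ 2 * η) :
    ∃ ξ' : ℝ → ℝ, ContinuousOn ξ' (Icc 0 T) ∧ ∀ t ∈ Ico 0 T, ξ' t = ξ t := by
  have hsym : ∀ η > 0, ∃ δ > 0, ∀ s ∈ Ico 0 T, ∀ t ∈ Ico 0 T, |t - s| < δ → dist (ξ t) (ξ s) < η := by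
    intro η hη
    obtain ⟨δ, hδ, hd⟩ := h (η / 4) (by positivity)
    refine ⟨δ, hδ, fun s hs t ht hst => ?_⟩
    rw [abs_lt] at hst
    rcases le_total s t with h1 | h1
    · have := hd s hs t ht h1 (by linarith)
      rw [Real.dist_eq]; linarith
    · have := hd t ht s hs h1 (by linarith)
      rw [dist_comm, Real.dist_eq]; linarith
  refine ⟨extendFrom (Ico 0 T) ξ, continuousOn_extendFrom (closure_Ico hT.ne).ge fun x hx => ?_,
    fun t ht => extendFrom_eq (subset_closure ht) ?_⟩
  · have : (𝓝[Ico 0 T] x).NeBot := mem_closure_iff_nhdsWithin_neBot.1 ((closure_Ico hT.ne).ge hx)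
    refine cauchy_map_iff_exists_tendsto.1 (Metric.cauchy_iff.2 ⟨inferInstance, fun η hη => ?_⟩)
    obtain ⟨δ, hδ, hd⟩ := hsym η hη
    refine ⟨ξ '' (Ico 0 T ∩ ball x (δ / 2)), image_mem_map (inter_mem self_mem_nhdsWithin
      (mem_nhdsWithin_of_mem_nhds (ball_mem_nhds x (half_pos hδ)))), ?_⟩
    rintro _ ⟨s, ⟨hs, hsx⟩, rfl⟩ _ ⟨t, ⟨ht, htx⟩, rfl⟩
    refine hd t ht s hs ?_
    rw [mem_ball] at hsx htx
    rw [← Real.dist_eq]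
    linarith [dist_triangle_right s t x]
  · refine Metric.tendsto_nhdsWithin_nhds.2 fun η hη => ?_
    obtain ⟨δ, hδ, hd⟩ := hsym η hη
    exact ⟨δ, hδ, fun s hs hst => hd t ht s hs hst⟩

end Chain

end SlitLoewner

namespace SlitLoewner

/-- The set of points having a neighbourhood contained in almost all sets of the sequence. -/
def stableSet (G : ℕ → Set ℂ) : Set ℂ := {z : ℂ | ∃ r > 0, ∃ N : ℕ, ∀ n ≥ N, ball z r ⊆ G n}

namespace Chain

variable {S : SlitSys} {T : ℝ} {F : ℝ → Set ℂ} {S' : ℝ → SlitSys} {g f : ℝ → ℂ → ℂ}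
  {R m e : ℝ}

lemma gdom_subset_kernelAt {a : ℂ} {s : ℕ → ℝ}
    {N : Set ℂ} (hN : IsPreconnected N) (haN : a ∈ N)
    (hNr : ∀ z ∈ N, ∃ r > 0, ∀ n, ball z r ⊆ gdom S (F (s n))) :
    N ⊆ kernelAt a (fun n => S.dom \ F (s n)) := by
  refine hN.subset_connectedComponentIn haN fun z hz => ?_
  obtain ⟨r, hr, h⟩ := hNr z hz
  exact ⟨r, hr, 0, fun n _ => by simpa only [dom_diff] using h n⟩

lemma caratheodory_of_image_subset (C : Chain S T F S' g f R m e)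
    (h : ∀ a > 0, ∀ τ > 0, ∃ δ ∈ Ioo 0 T, δ ≤ τ ∧ ∀ t ∈ Icc 0 (T - δ), ∃ x : ℝ,
        g t '' (F (t + δ) \ F t) ⊆ closedBall (x : ℂ) a) {t₀ : ℝ} (ht₀ : t₀ ∈ Ioc 0 T) :
    CaratheodoryLeftContinuousAt S.dom F T t₀ := by
  intro a ha s hsm hs hst
  have hT' : T ∈ Icc 0 T := ⟨C.T_pos.le, le_rfl⟩
  have ht₀' : t₀ ∈ Icc 0 T := ⟨ht₀.1.le, ht₀.2⟩
  have hs' : ∀ n, s n ∈ Icc 0 T := fun n => ⟨(hs n).1, ((hs n).2.trans_le ht₀.2).le⟩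
  rw [dom_diff] at ha
  have ha₀ := C.gdom_subset ht₀' hT' ht₀.2 ha
  refine Subset.antisymm ?_ ?_
  swap
  · rw [dom_diff]
    refine gdom_subset_kernelAt (C.conf t₀ ht₀').isPreconnected_gdom ha₀ fun z hz => ?_
    obtain ⟨r, hr, hb⟩ := Metric.isOpen_iff.1 (C.conf t₀ ht₀').isOpen_gdom z hz
    exact ⟨r, hr, fun n => hb.trans (C.gdom_subset (hs' n) ht₀' (hs n).2.le)⟩
  set W : Set ℂ := stableSet fun n => S.dom \ F (s n) with hW
  set O : Set ℂ := kernelAt a (fun n => S.dom \ F (s n)) with hO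
  have hOW : O ⊆ W := connectedComponentIn_subset _ _
  have hOc : IsPreconnected O := isPreconnected_connectedComponentIn
  have haO : a ∈ O := by
    refine gdom_subset_kernelAt isPreconnected_singleton (mem_singleton a)
      (fun z hz => ?_) (mem_singleton a)
    obtain ⟨r, hr, hb⟩ := Metric.isOpen_iff.1 (C.conf t₀ ht₀').isOpen_gdom a ha₀
    rw [mem_singleton_iff] at hz
    exact ⟨r, hr, fun n => hz ▸ hb.trans (C.gdom_subset (hs' n) ht₀' (hs n).2.le)⟩
  set A : Set ℂ := {z ∈ W | Tendsto (fun n => (g (s n) z).im) atTop (𝓝 0)} with hA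
  set B : Set ℂ := {z ∈ W | ¬ Tendsto (fun n => (g (s n) z).im) atTop (𝓝 0)} with hB
  have hloc : ∀ z ∈ W, ∃ r > 0, ∀ z' ∈ ball z r, z' ∈ W ∧
      (Tendsto (fun n => (g (s n) z).im) atTop (𝓝 0) ↔
        Tendsto (fun n => (g (s n) z').im) atTop (𝓝 0)) := by
    rintro z ⟨r, hr, N, hN⟩
    refine ⟨r / 2, half_pos hr, fun z' hz' => ⟨⟨r / 2, half_pos hr, N, fun n hn =>
      (ball_subset_ball' (by rw [mem_ball] at hz'; linarith)).trans (hN n hn)⟩, ?_⟩⟩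
    have hharn : ∀ p ∈ ball z (r / 2), ∀ q ∈ ball z (r / 2), ∀ n ≥ N,
        (g (s n) q).im ≤ (g (s n) p).im * Real.exp 4 := by
      intro p hp q hq n hn
      have hGn : ball z r ⊆ S.dom \ F (s n) := hN n hn
      rw [dom_diff] at hGn
      refine (harnack_segment (C.conf _ (hs' n)).holo_g
        (fun z hz => ((S' (s n)).im_pos ((C.conf _ (hs' n)).maps_g hz)).le) (half_pos hr)
        (fun x hx => (ball_subset_ball' ?_).trans hGn) ?_).1
      · have := (convex_ball z (r / 2)).segment_subset hp hq hx
        rw [mem_ball] at this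
        linarith
      · rw [div_le_iff₀ (half_pos hr), ← dist_eq_norm]
        rw [mem_ball] at hp hq
        linarith [dist_triangle_right q p z]
    have hpos : ∀ p ∈ ball z (r / 2), ∀ n ≥ N, 0 ≤ (g (s n) p).im := by
      intro p hp n hn
      have hGn : ball z r ⊆ S.dom \ F (s n) := hN n hn
      rw [dom_diff] at hGn
      exact ((S' (s n)).im_pos ((C.conf _ (hs' n)).maps_g
        (hGn (ball_subset_ball (by linarith) hp)))).le
    have himp : ∀ p ∈ ball z (r / 2), ∀ q ∈ ball z (r / 2),
        Tendsto (fun n => (g (s n) p).im) atTop (𝓝 0) →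
        Tendsto (fun n => (g (s n) q).im) atTop (𝓝 0) := by
      intro p hp q hq ht
      have := ht.mul_const (Real.exp 4)
      rw [zero_mul] at this
      exact tendsto_of_tendsto_of_tendsto_of_le_of_le' tendsto_const_nhds this
        (eventually_atTop.2 ⟨N, hpos q hq⟩) (eventually_atTop.2 ⟨N, hharn p hp q hq⟩)
    have hz := mem_ball_self (x := z) (half_pos hr)
    exact ⟨himp z hz z' hz', himp z' hz' z hz⟩
  have hAo : IsOpen A := Metric.isOpen_iff.2 fun z hz => by
    obtain ⟨r, hr, h⟩ := hloc z hz.1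
    exact ⟨r, hr, fun z' hz' => ⟨(h z' hz').1, (h z' hz').2.1 hz.2⟩⟩
  have hBo : IsOpen B := Metric.isOpen_iff.2 fun z hz => by
    obtain ⟨r, hr, h⟩ := hloc z hz.1
    exact ⟨r, hr, fun z' hz' => ⟨(h z' hz').1, fun h' => hz.2 ((h z' hz').2.2 h')⟩⟩
  have haB : a ∈ B := by
    refine ⟨hOW haO, fun ht => ?_⟩
    have h1 := (S' T).im_pos ((C.conf T hT').maps_g ha)
    have h2 := ge_of_tendsto ht (Eventually.of_forall fun n =>
      C.im_anti (hs' n) hT' (hs' n).2 ha)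
    linarith
  have hOB : O ⊆ B := by
    refine hOc.subset_left_of_subset_union hBo hAo
      (disjoint_left.2 fun z hz hz' => hz.2 hz'.2) (fun z hz => ?_) ⟨a, haO, haB⟩
    by_cases ht : Tendsto (fun n => (g (s n) z).im) atTop (𝓝 0)
    exacts [.inr ⟨hOW hz, ht⟩, .inl ⟨hOW hz, ht⟩]
  intro z hz
  obtain ⟨r, hr, N, hN⟩ := hOW hz
  have hzn : ∀ n ≥ N, z ∈ gdom S (F (s n)) := fun n hn => by
    rw [← dom_diff]; exact hN n hn (mem_ball_self hr)
  refine ⟨(hN N le_rfl (mem_ball_self hr)).1, fun hzF => (hOB hz).2 ?_⟩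
  refine (tendsto_order.2 ⟨fun ε hε => eventually_atTop.2 ⟨N, fun n hn => hε.trans
    ((S' (s n)).im_pos ((C.conf _ (hs' n)).maps_g (hzn n hn)))⟩, fun ε hε => ?_⟩)
  obtain ⟨δ, hδ, hδt, hK⟩ := h (ε / 2) (half_pos hε) (t₀ / 2) (half_pos ht₀.1)
  obtain ⟨x, hx⟩ := hK (t₀ - δ) ⟨by linarith [ht₀.1], by linarith [ht₀.2]⟩
  have htδ : t₀ - δ ∈ Icc 0 T := ⟨by linarith [ht₀.1], by linarith [ht₀.2, hδ.1]⟩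
  rw [sub_add_cancel] at hx
  filter_upwards [eventually_ge_atTop N, hst.eventually_mem (Ioi_mem_nhds (by linarith [hδ.1] :
    t₀ - δ < t₀))] with n hn hn'
  have hzδ : z ∉ F (t₀ - δ) := fun h => (hzn n hn).1.2 (C.mono _ htδ _ (hs' n) (le_of_lt hn') h)
  have h1 := im_le_of_mem_closedBall (hx (mem_image_of_mem _ ⟨hzF, hzδ⟩))
  have h2 := C.im_anti htδ (hs' n) (le_of_lt hn') (hzn n hn)
  linarith

/-- Local growth yields a continuous driving function and left continuity. -/
theorem exists_driving_of_localGrowth (C : Chain S T F S' g f R m e)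
    (h : LocalGrowth T S.dom F) :
    ∃ ξ : ℝ → ℝ, ContinuousOn ξ (Icc 0 T) ∧ (∀ t ∈ Ico 0 T, tip T F g t = {(ξ t : ℂ)}) ∧
      ∀ t₀ ∈ Ioc 0 T, CaratheodoryLeftContinuousAt S.dom F T t₀ := by
  obtain ⟨ξ, hξ, hK⟩ := C.exists_tip_eq h
  obtain ⟨ξ', hc, hξ'⟩ := exists_continuousOn_of_dist C.T_pos
    fun η hη => C.exists_dist_lt_of_tip hξ hK hη
  exact ⟨ξ', hc, fun t ht => by rw [hξ' t ht, hξ t ht], fun t₀ ht₀ =>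
    C.caratheodory_of_image_subset (fun a ha τ hτ =>
      C.exists_image_subset_of_localGrowth h ha hτ) ht₀⟩

end Chain

end SlitLoewner

namespace SlitLoewner

namespace Chain

variable {S : SlitSys} {T : ℝ} {F : ℝ → Set ℂ} {S' : ℝ → SlitSys} {g f : ℝ → ℂ → ℂ}
  {R m e : ℝ}

lemma exists_image_subset_of_tip_eq (C : Chain S T F S' g f R m e) {t x : ℝ} (ht : t ∈ Ico 0 T)
    (h : tip T F g t = {(x : ℂ)}) {κ : ℝ} (hκ : 0 < κ) :
    ∃ δ ∈ Ioc 0 (T - t), g t '' (F (t + δ) \ F t) ⊆ closedBall (x : ℂ) κ := by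
  have ht1 : t ∈ Icc 0 T := ⟨ht.1, ht.2.le⟩
  have hmem : ∀ δ : Ioc 0 (T - t), t + δ ∈ Icc 0 T := fun δ =>
    ⟨by linarith [ht.1, δ.2.1], by linarith [δ.2.2]⟩
  have : Nonempty (Ioc 0 (T - t)) := ⟨⟨T - t, by linarith [ht.2], le_rfl⟩⟩
  rw [tip, biInter_eq_iInter] at h
  obtain ⟨δ, hδ⟩ := exists_subset_nhds_of_isCompact' (U := closedBall (x : ℂ) κ)
    (directed_of_isDirected_ge fun δ δ' hδ => closure_mono (image_mono (sdiff_subset_sdiff_left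
      (C.mono _ (hmem _) _ (hmem _) (by simpa using hδ)))))
    (fun δ => ((isBounded_closedBall).subset (C.norm_image_le ht1 (hmem δ))).isCompact_closure)
    (fun δ => isClosed_closure)
    (fun y hy => by
      rw [h, mem_singleton_iff] at hy
      exact hy ▸ closedBall_mem_nhds _ hκ)
  exact ⟨δ, δ.2, subset_closure.trans hδ⟩

/-- A connected set that meets `gdom S (F T)` and is uniformly locally contained in the earlier
domains is contained in the limit domain. -/
lemma subset_gdom_of_caratheodory {t₀ s₀ : ℝ}
    (hcar : CaratheodoryLeftContinuousAt S.dom F T t₀) (hs₀ : s₀ ∈ Ico 0 t₀) {N : Set ℂ}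
    (hN : IsPreconnected N) {a : ℂ} (haN : a ∈ N) (haT : a ∈ gdom S (F T))
    (hNr : ∀ z ∈ N, ∃ r > 0, ∀ s ∈ Ico s₀ t₀, ball z r ⊆ gdom S (F s)) :
    N ⊆ gdom S (F t₀) := by
  set s : ℕ → ℝ := fun n => t₀ - (t₀ - s₀) / (n + 1) with hs
  have hd : 0 < t₀ - s₀ := sub_pos.2 hs₀.2
  have hmem : ∀ n, s n ∈ Ico s₀ t₀ := fun n => by
    have h1 : 0 < (t₀ - s₀) / ((n : ℝ) + 1) := by positivity
    have h2 : (t₀ - s₀) / ((n : ℝ) + 1) ≤ t₀ - s₀ := div_le_self hd.le (by simp)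
    constructor <;> simp only [hs] <;> linarith
  have hmono : Monotone s := fun n n' hn => by
    have : (t₀ - s₀) / ((n' : ℝ) + 1) ≤ (t₀ - s₀) / ((n : ℝ) + 1) := by gcongr
    simp only [hs]
    linarith
  have hlim : Tendsto s atTop (𝓝 t₀) := by
    have := (tendsto_one_div_add_atTop_nhds_zero_nat (𝕜 := ℝ)).const_mul (t₀ - s₀)
    simpa [hs, div_eq_mul_inv] using (tendsto_const_nhds (x := t₀)).sub this
  have hs0 : ∀ n, s n ∈ Ico 0 t₀ := fun n => ⟨hs₀.1.trans (hmem n).1, (hmem n).2⟩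
  rw [← dom_diff] at haT ⊢
  rw [← hcar a haT s hmono hs0 hlim]
  exact gdom_subset_kernelAt hN haN fun z hz =>
    (hNr z hz).imp fun r hr => ⟨hr.1, fun n => hr.2 _ (hmem n)⟩

lemma exists_dist_le_of_caratheodory (C : Chain S T F S' g f R m e) {t₀ ε : ℝ} (ht₀ : t₀ ∈ Ioc 0 T)
    (hcar : CaratheodoryLeftContinuousAt S.dom F T t₀) (hε : 0 < ε)
    (hεS : ∀ p ∈ F t₀, ∀ s ∈ S.set, ε ≤ dist s p) :
    ∃ s ∈ Ico 0 t₀, ∀ p ∈ (F t₀ \ F s) ∩ closure (gdom S (F t₀)), ∃ q ∉ UHP \ F s,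
      dist p q ≤ ε := by
  have hT' : T ∈ Icc 0 T := ⟨C.T_pos.le, le_rfl⟩
  have ht₀' : t₀ ∈ Icc 0 T := ⟨ht₀.1.le, ht₀.2⟩
  by_contra! hcon
  set s : ℕ → ℝ := fun n => t₀ - t₀ / (n + 1) with hs
  have hmem : ∀ n, s n ∈ Ico 0 t₀ := fun n => by
    have h1 : 0 < t₀ / ((n : ℝ) + 1) := div_pos ht₀.1 (by positivity)
    have h2 : t₀ / ((n : ℝ) + 1) ≤ t₀ := div_le_self ht₀.1.le (by simp)
    constructor <;> simp only [hs] <;> linarith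
  have hlim : Tendsto s atTop (𝓝 t₀) := by
    have := (tendsto_one_div_add_atTop_nhds_zero_nat (𝕜 := ℝ)).const_mul t₀
    simpa [hs, div_eq_mul_inv] using (tendsto_const_nhds (x := t₀)).sub this
  choose p hp hpq using fun n => hcon (s n) (hmem n)
  obtain ⟨p₀, -, φ, hφ, hlimp⟩ := tendsto_subseq_of_bounded (C.conf t₀ ht₀').bdd
    (fun n => (hp n).1.1)
  have hball : ∀ u ∈ Ico 0 t₀, ball p₀ (ε / 2) ⊆ gdom S (F u) := by
    intro u hu z hz
    obtain ⟨n, hn1, hn2⟩ := ((hlimp.eventually_mem (ball_mem_nhds p₀ (half_pos hε))).and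
      ((hlim.comp hφ.tendsto_atTop).eventually_mem (Ioi_mem_nhds hu.2))).exists
    have hzp : dist (p (φ n)) z < ε := by
      have := mem_ball.1 hz
      have := mem_ball.1 hn1
      have h3 := dist_triangle_right (p (φ n)) z p₀
      simp only [Function.comp_apply] at *
      linarith
    have h1 : z ∈ UHP \ F (s (φ n)) := by
      by_contra h
      exact absurd (hpq (φ n) z h) (by linarith)
    have hmu : ∀ v ∈ Ico 0 t₀, v ∈ Icc 0 T := fun v hv => ⟨hv.1, hv.2.le.trans ht₀.2⟩
    refine ⟨⟨h1.1, fun h => h1.2 (C.mono _ (hmu _ hu) _ (hmu _ (hmem _)) (le_of_lt hn2) h)⟩,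
      fun h => ?_⟩
    have := hεS _ (hp (φ n)).1.1 z h
    rw [dist_comm] at this
    linarith
  have hp₀ : p₀ ∈ closure (gdom S (F t₀)) :=
    isClosed_closure.mem_of_tendsto hlimp (Eventually.of_forall fun n => (hp _).2)
  obtain ⟨z, hz1, hz2⟩ := Metric.mem_closure_iff.1 hp₀ (ε / 2) (half_pos hε)
  obtain ⟨Y, hY, hYm⟩ : ∃ Y : ℝ, 0 < Y ∧ (Y * I : ℂ) ∈ gdom S (F T) :=
    ⟨R, C.R_pos, C.mul_I_mem hT' C.R_pos le_rfl⟩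
  have hsub := subset_gdom_of_caratheodory hcar (s₀ := 0) ⟨le_rfl, ht₀.1⟩
    (IsPreconnected.union z hz1 (by rwa [mem_ball, dist_comm])
      (C.conf t₀ ht₀').isPreconnected_gdom (convex_ball p₀ (ε / 2)).isPreconnected)
    (.inl (C.gdom_subset ht₀' hT' ht₀.2 hYm)) hYm (by
      rintro w (hw | hw)
      · obtain ⟨r, hr, hb⟩ := Metric.isOpen_iff.1 (C.conf t₀ ht₀').isOpen_gdom w hw
        exact ⟨r, hr, fun u hu => hb.trans (C.gdom_subset ⟨hu.1, hu.2.le.trans ht₀.2⟩ ht₀' hu.2.le)⟩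
      · obtain ⟨r, hr, hb⟩ := Metric.isOpen_iff.1 isOpen_ball w hw
        exact ⟨r, hr, fun u hu => hb.trans (hball u hu)⟩)
  obtain ⟨n, hn⟩ := (hlimp.eventually_mem (ball_mem_nhds p₀ (half_pos hε))).exists
  exact (hsub (.inr hn)).1.2 (hp _).1.1

lemma exists_le_dist_set (C : Chain S T F S' g f R m e) :
    ∃ d > 0, ∀ t ∈ Icc 0 T, ∀ p ∈ F t, ∀ s ∈ S.set, d ≤ dist s p := by
  have hT' : T ∈ Icc 0 T := ⟨C.T_pos.le, le_rfl⟩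
  obtain ⟨d, hd, h⟩ := (C.conf T hT').sep.symm.exists_thickenings S.isCompact_set isClosed_closure
  refine ⟨d, hd, fun t ht p hp s hs => ?_⟩
  by_contra! hlt
  exact disjoint_left.1 h (mem_thickening_iff.2
    ⟨s, hs, by rwa [dist_comm]⟩) (self_subset_thickening hd _
      (subset_closure (C.mono t ht T hT' ht.2 hp)))

/-- The capacity observable is uniformly continuous in time. -/
lemma exists_forall_im_sub_le (C : Chain S T F S' g f R m e)
    (htip : ∀ t ∈ Ico 0 T, ∃ x : ℝ, tip T F g t = {(x : ℂ)})
    (hcar : ∀ t₀ ∈ Ioc 0 T, CaratheodoryLeftContinuousAt S.dom F T t₀)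
    {Y : ℝ} (hY : 0 < Y) (hRY : R ≤ Y) {κ : ℝ} (hκ : 0 < κ) :
    ∃ δ > 0, ∀ s ∈ Icc 0 T, ∀ u ∈ Icc 0 T, s ≤ u → u < s + δ →
      (g s (Y * I)).im - (g u (Y * I)).im ≤ κ := by
  set c : ℝ → ℝ := fun t => (g t (Y * I)).im with hc
  have hanti : ∀ s ∈ Icc 0 T, ∀ u ∈ Icc 0 T, s ≤ u → c u ≤ c s := fun s hs u hu h =>
    C.im_anti hs hu h (C.mul_I_mem hu hY hRY)
  have hright : ∀ t ∈ Icc 0 T, ∀ κ > 0, ∃ δ > 0, ∀ u ∈ Icc 0 T, t ≤ u → u < t + δ →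
      c t - c u ≤ κ := by
    intro t ht κ hκ
    rcases ht.2.eq_or_lt with rfl | hlt
    · exact ⟨1, one_pos, fun u hu h _ => by rw [le_antisymm hu.2 h]; simpa using hκ.le⟩
    obtain ⟨x, hx⟩ := htip t ⟨ht.1, hlt⟩
    obtain ⟨δ, hδ, hK⟩ := C.exists_image_subset_of_tip_eq ⟨ht.1, hlt⟩ hx hκ
    have htδ : t + δ ∈ Icc 0 T := ⟨by linarith [ht.1, hδ.1], by linarith [hδ.2]⟩
    refine ⟨δ, hδ.1, fun u hu h1 h2 => ?_⟩
    have h3 := C.im_sub_le ht htδ (by linarith [hδ.1]) hκ.le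
      (fun z hz => im_le_of_mem_closedBall (hK (mem_image_of_mem _ hz.1)))
      (C.mul_I_mem htδ hY hRY)
    have h4 := hanti u hu _ htδ h2.le
    simp only [hc] at *
    linarith
  have hleft : ∀ t ∈ Icc 0 T, ∀ κ > 0, ∃ δ > 0, ∀ u ∈ Icc 0 T, u ≤ t → t - δ < u →
      c u - c t ≤ κ := by
    intro t ht κ hκ
    rcases ht.1.eq_or_lt with rfl | hlt
    · exact ⟨1, one_pos, fun u hu h _ => by rw [le_antisymm h hu.1]; simpa using hκ.le⟩
    obtain ⟨d, hd, hdS⟩ := C.exists_le_dist_set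
    obtain ⟨ε, hε, hnear⟩ := exists_forall_im_le_of_near_boundary C.R_pos.le hκ (half_pos hd)
    obtain ⟨s, hs, hq⟩ := C.exists_dist_le_of_caratheodory ⟨hlt, ht.2⟩ (hcar t ⟨hlt, ht.2⟩) hε.1
      (fun p hp s hs => by linarith [hdS t ht p hp s hs, hε.2])
    have hsT : s ∈ Icc 0 T := ⟨hs.1, hs.2.le.trans ht.2⟩
    refine ⟨t - s, sub_pos.2 hs.2, fun u hu h1 h2 => ?_⟩
    have h3 := C.im_sub_le hsT ht hs.2.le hκ.le (fun z hz => by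
      obtain ⟨q, hq, hzq⟩ := hq z hz
      refine hnear _ _ _ _ _ (C.conf s hsT) (C.near s hsT) q hq (fun v hv => ?_) z
        (C.mem_gdom_of_mem ht hz.1.1 hz.1.2) hzq
      have := hdS t ht z hz.1.1 v hv
      linarith [dist_triangle_right v z q, hε.2])
      (C.mul_I_mem ht hY hRY)
    have h4 := hanti s hsT u hu (by linarith)
    simp only [hc] at *
    linarith
  have hcont : ContinuousOn c (Icc 0 T) := by
    refine Metric.continuousOn_iff.2 fun t ht κ hκ => ?_
    obtain ⟨δ₁, hδ₁, h₁⟩ := hright t ht (κ / 2) (half_pos hκ)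
    obtain ⟨δ₂, hδ₂, h₂⟩ := hleft t ht (κ / 2) (half_pos hκ)
    refine ⟨min δ₁ δ₂, lt_min hδ₁ hδ₂, fun u hu hut => ?_⟩
    rw [Real.dist_eq, abs_lt] at hut
    rw [Real.dist_eq, abs_lt]
    rcases le_total t u with h | h
    · have := h₁ u hu h (by linarith [min_le_left δ₁ δ₂])
      have := hanti t ht u hu h
      constructor <;> linarith
    · have := h₂ u hu h (by linarith [min_le_right δ₁ δ₂])
      have := hanti u hu t ht h
      constructor <;> linarith
  obtain ⟨δ, hδ, h⟩ := Metric.uniformContinuousOn_iff.1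
    (isCompact_Icc.uniformContinuousOn_of_continuous hcont) κ hκ
  refine ⟨δ, hδ, fun s hs u hu h1 h2 => ?_⟩
  have := h s hs u hu (by rw [Real.dist_eq, abs_lt]; constructor <;> linarith)
  rw [Real.dist_eq, abs_lt] at this
  exact this.2.le

end Chain

end SlitLoewner

namespace SlitLoewner

namespace Chain

variable {S : SlitSys} {T : ℝ} {F : ℝ → Set ℂ} {S' : ℝ → SlitSys} {g f : ℝ → ℂ → ℂ}
  {R m e : ℝ}

lemma image_subset_of_forall_lt (C : Chain S T F S' g f R m e) {s u x a : ℝ} (hs : 0 ≤ s)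
    (hsu : s < u) (hu : u ≤ T) (hcar : CaratheodoryLeftContinuousAt S.dom F T u)
    (h : ∀ v ∈ Ico s u, g s '' (F v \ F s) ⊆ closedBall (x : ℂ) a) :
    g s '' (F u \ F s) ⊆ closedBall (x : ℂ) a := by
  have hsT : s ∈ Icc 0 T := ⟨hs, hsu.le.trans hu⟩
  have hT' : T ∈ Icc 0 T := ⟨C.T_pos.le, le_rfl⟩
  have huT : u ∈ Icc 0 T := ⟨hs.trans hsu.le, hu⟩
  have H := C.conf s hsT
  set N : Set ℂ := (S' s).dom \ closedBall (x : ℂ) a with hN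
  have hNo : IsOpen N := (S' s).isOpen_dom.sdiff isClosed_closedBall
  have hNd : N ⊆ (S' s).dom := sdiff_subset
  have hfo : IsOpen (f s '' N) := H.isOpen_image_f hNo hNd
  have hfN : ∀ v ∈ Ico s u, f s '' N ⊆ gdom S (F v) := by
    rintro v hv _ ⟨w, hw, rfl⟩
    exact C.f_mem_gdom hsT hw.1 fun hK => hw.2 (h v hv hK)
  set Y : ℝ := 2 * R + |x| + |a| with hY
  have hRY : R ≤ Y := by linarith [abs_nonneg x, abs_nonneg a, C.R_pos]
  have hY0 : 0 < Y := C.R_pos.trans_le hRY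
  have hYs := C.mul_I_mem hsT hY0 hRY
  have hfar : g s (Y * I) ∈ N := by
    refine ⟨H.maps_g hYs, fun hb => ?_⟩
    have h1 := C.near s hsT _ hYs
    rw [mem_closedBall, dist_eq_norm] at hb
    have h2 : ‖(Y * I : ℂ)‖ ≤ ‖g s (Y * I) - x‖ + ‖(x : ℂ)‖ + ‖g s (Y * I) - Y * I‖ := by
      calc ‖(Y * I : ℂ)‖ = ‖(g s (Y * I) - x) + x - (g s (Y * I) - Y * I)‖ := by congr 1; ring
        _ ≤ _ := (norm_sub_le _ _).trans (by gcongr; exact norm_add_le _ _)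
    rw [norm_mul_I hY0, norm_real, Real.norm_eq_abs] at h2
    linarith [le_abs_self a, C.R_pos]
  have hsub := subset_gdom_of_caratheodory hcar ⟨hs, hsu⟩
    (((S' s).isPreconnected_dom_diff x a).image _ (H.holo_f.continuousOn.mono hNd))
    (mem_image_of_mem _ hfar) (by rw [H.left_inv _ hYs]; exact C.mul_I_mem hT' hY0 hRY)
    (fun z hz => by
      obtain ⟨r, hr, hb⟩ := Metric.isOpen_iff.1 hfo z hz
      exact ⟨r, hr, fun v hv => hb.trans (hfN v hv)⟩)
  rintro _ ⟨q, hq, rfl⟩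
  by_contra hcon
  have hqs := C.mem_gdom_of_mem huT hq.1 hq.2
  have := hsub ⟨g s q, ⟨H.maps_g hqs, hcon⟩, rfl⟩
  rw [H.left_inv q hqs] at this
  exact this.1.2 hq.1

/-- Hull increments have uniformly small images around the driving function. -/
lemma exists_forall_image_subset (C : Chain S T F S' g f R m e) {ξ : ℝ → ℝ}
    (hξc : ContinuousOn ξ (Icc 0 T)) (hξ : ∀ t ∈ Ico 0 T, tip T F g t = {(ξ t : ℂ)})
    (hcar : ∀ t₀ ∈ Ioc 0 T, CaratheodoryLeftContinuousAt S.dom F T t₀) {a : ℝ} (ha : 0 < a) :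
    ∃ δ ∈ Ioo 0 T, ∀ s ∈ Icc 0 (T - δ), g s '' (F (s + δ) \ F s) ⊆ closedBall (ξ s : ℂ) a := by
  obtain ⟨b, hb, -, Y, hY, hRY, κ, hκ, hgate⟩ := C.exists_gate (2 * R) (half_pos ha)
  obtain ⟨δ₁, hδ₁, hcap⟩ := C.exists_forall_im_sub_le (fun t ht => ⟨ξ t, hξ t ht⟩) hcar hY hRY hκ
  obtain ⟨δ₂, hδ₂, hξu⟩ := Metric.uniformContinuousOn_iff.1
    (isCompact_Icc.uniformContinuousOn_of_continuous hξc) (a / 2) (half_pos ha)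
  set δ := min (min δ₁ δ₂) T / 2 with hδ
  have hδpos : 0 < δ := half_pos (lt_min (lt_min hδ₁ hδ₂) C.T_pos)
  have hδlt1 : δ < δ₁ := (half_lt_self (lt_min (lt_min hδ₁ hδ₂) C.T_pos)).trans_le
    ((min_le_left _ _).trans (min_le_left _ _))
  have hδlt2 : δ < δ₂ := (half_lt_self (lt_min (lt_min hδ₁ hδ₂) C.T_pos)).trans_le
    ((min_le_left _ _).trans (min_le_right _ _))
  have hδT : δ < T := (half_lt_self (lt_min (lt_min hδ₁ hδ₂) C.T_pos)).trans_le (min_le_right _ _)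
  refine ⟨δ, ⟨hδpos, hδT⟩, fun s hs => ?_⟩
  have hsT : s ∈ Icc 0 T := ⟨hs.1, by linarith [hs.2]⟩
  set E : Set ℝ := {u | g s '' (F u \ F s) ⊆ closedBall (ξ s : ℂ) a} with hE
  have huT : ∀ u ∈ Icc s (s + δ), u ∈ Icc 0 T := fun u hu =>
    ⟨hs.1.trans hu.1, by linarith [hu.2, hs.2]⟩
  have hdown : ∀ u ∈ Icc s (s + δ), ∀ v ∈ Icc s (s + δ), v ≤ u → u ∈ E → v ∈ E :=
    fun u hu v hv hvu hE => (image_mono (sdiff_subset_sdiff_left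
      (C.mono v (huT v hv) u (huT u hu) hvu))).trans hE
  have hsE : s ∈ E := by simp [hE]
  suffices Icc s (s + δ) ⊆ E from this ⟨by linarith, le_rfl⟩
  refine IsClosed.Icc_subset_of_forall_exists_gt (isClosed_of_closure_subset fun u hu => ?_)
    hsE fun u hu y hy => ?_
  · have huI : u ∈ Icc s (s + δ) := closure_minimal inter_subset_right isClosed_Icc hu
    refine ⟨?_, huI⟩
    rcases huI.1.eq_or_lt with rfl | hsu
    · exact hsE
    refine C.image_subset_of_forall_lt hs.1 hsu (huT u huI).2
      (hcar u ⟨hs.1.trans_lt hsu, (huT u huI).2⟩) fun v hv => ?_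
    obtain ⟨u', hu'1, hu'2⟩ := mem_closure_iff_nhds.1 hu _ (Ioi_mem_nhds hv.2)
    exact hdown u' hu'2.2 v ⟨hv.1, hv.2.le.trans huI.2⟩ (le_of_lt hu'1) hu'2.1
  · have huI : u ∈ Icc s (s + δ) := ⟨hu.2.1, hu.2.2.le⟩
    have hu0 := huT u huI
    have huT' : u ∈ Ico 0 T := ⟨hu0.1, by linarith [hu.2.2, hs.2]⟩
    obtain ⟨r, hr, hgr⟩ := (hgate s hsT u hu0 hu.2.1 (ξ u) (C.abs_le_of_tip_eq huT' (hξ u huT'))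
      (hcap s hsT u hu0 hu.2.1 (by linarith [hu.2.2]))).2
    obtain ⟨δ', hδ', hK⟩ := C.exists_image_subset_of_tip_eq huT' (hξ u huT') hb
    set u' := min (u + δ') y with hu'
    have huu' : u < u' := lt_min (by linarith [hδ'.1]) hy
    have huδ : u + δ' ∈ Icc 0 T := ⟨by linarith [hδ'.1, hu0.1], by linarith [hδ'.2]⟩
    have hu'T : u' ∈ Icc 0 T := ⟨hu0.1.trans huu'.le, (min_le_left _ _).trans huδ.2⟩
    have hdist := hξu u hu0 s hsT (by
      rw [Real.dist_eq, abs_of_nonneg (by linarith [hu.2.1])]; linarith [hu.2.2])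
    rw [Real.dist_eq] at hdist
    refine ⟨u', ?_, huu', min_le_right _ _⟩
    rintro _ ⟨q, hq, rfl⟩
    by_cases hqu : q ∈ F u
    · exact hu.1 (mem_image_of_mem _ ⟨hqu, hq.2⟩)
    refine C.dist_le_of_gate_backward hsT hu0 hu'T hu.2.1 hgr hu.1 (by linarith)
      (q := q) ⟨hq.1, hqu⟩ ?_
    exact (mem_closedBall.1 (hK (mem_image_of_mem _
      ⟨C.mono _ hu'T _ huδ (min_le_left _ _) hq.1, hqu⟩))).trans hr.1.le

end Chain

end SlitLoewner

namespace SlitLoewner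

open scoped ENNReal

lemma sq_lintegral_circleLength_le {X : Set ℂ} (hX : IsOpen X) {F : ℂ → ℂ}
    (hF : DifferentiableOn ℂ F X) (hinj : InjOn F X) (z₀ : ℂ) :
    (∫⁻ r in Ioi 0, circleLength X F z₀ r) ^ 2 ≤ volume X * volume (F '' X) := by
  have hm := measurable_enorm_deriv_indicator hX F
  have h1 : ∫⁻ r in Ioi 0, circleLength X F z₀ r =
      ∫⁻ z in X, X.indicator (fun z => ‖deriv F z‖ₑ) z := by
    simp only [circleLength]
    rw [lintegral_circle z₀ hm, setLIntegral_indicator hX.measurableSet, inter_self,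
      lintegral_indicator hX.measurableSet]
  rw [h1, ← lintegral_enorm_deriv_sq hX hF hinj]
  refine (sq_lintegral_le (volume.restrict X) hm).trans ?_
  rw [Measure.restrict_apply_univ]
  gcongr
  exact Measure.restrict_le_self

/-- Only few circular arcs have images landing at a prescribed point. -/
lemma volume_eq_zero_of_le_circleLength {X : Set ℂ} (hX : IsOpen X) (hXv : volume X ≠ ∞) {F : ℂ → ℂ}
    (hF : DifferentiableOn ℂ F X) (hinj : InjOn F X) {p : ℂ} (hp : p ∉ F '' X) (z₀ : ℂ) {A : Set ℝ}
    (hA : A ⊆ Ioi 0) {η : ℝ} (hη : 0 < η) (h : ∀ r ∈ A, ∀ t ∈ Ioo 0 η, ENNReal.ofReal t ≤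
      circleLength (X ∩ F ⁻¹' ball p (4 * t)) F z₀ r) : volume A = 0 := by
  set B : ℝ → Set ℂ := fun t => X ∩ F ⁻¹' ball p (4 * t) with hB
  have hBo : ∀ t, IsOpen (B t) := fun t => hF.continuousOn.isOpen_inter_preimage hX isOpen_ball
  have hle : ∀ t ∈ Ioo 0 η, volume A ^ 2 ≤ ENNReal.ofReal (16 * Real.pi) * volume (B t) := by
    intro t ht
    have h1 : ENNReal.ofReal t * volume A ≤ ∫⁻ r in Ioi 0, circleLength (B t) F z₀ r := by
      refine le_trans ?_ (mul_meas_ge_le_lintegral (measurable_circleLength (hBo t) F z₀) (ENNReal.ofReal t))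
      rw [Measure.restrict_apply' measurableSet_Ioi]
      gcongr
      exact fun r hr => ⟨h r hr t ht, hA hr⟩
    have h2 : volume (F '' B t) ≤ ENNReal.ofReal (16 * Real.pi) * ENNReal.ofReal t ^ 2 := by
      refine (measure_mono (t := ball p (4 * t)) (image_subset_iff.2 inter_subset_right)).trans ?_
      rw [Complex.volume_ball, ← ENNReal.ofReal_pow ht.1.le, ← ENNReal.ofReal_mul (by positivity),
        ← ENNReal.ofReal_pow (by linarith [ht.1])]
      refine le_of_eq ?_
      rw [← NNReal.coe_real_pi, ← ENNReal.ofReal_coe_nnreal, ← ENNReal.ofReal_mul (by positivity)]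
      congr 1
      ring
    have h3 : (ENNReal.ofReal t * volume A) ^ 2 ≤
        volume (B t) * (ENNReal.ofReal (16 * Real.pi) * ENNReal.ofReal t ^ 2) :=
      (pow_le_pow_left' h1 2).trans ((sq_lintegral_circleLength_le (hBo t)
        (hF.mono inter_subset_left) (hinj.mono inter_subset_left) z₀).trans (by gcongr))
    have ht0 : ENNReal.ofReal t ^ 2 ≠ 0 := pow_ne_zero _ (by simpa using ht.1)
    have htt : ENNReal.ofReal t ^ 2 ≠ ∞ := ENNReal.pow_ne_top ENNReal.ofReal_ne_top
    refine (ENNReal.mul_le_mul_iff_right ht0 htt).1 ?_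
    rw [← mul_pow]
    exact h3.trans_eq (by ring)
  have hlim : Tendsto (fun n : ℕ => ENNReal.ofReal (16 * Real.pi) * volume (B (η / (n + 2)))) atTop
      (𝓝 0) := by
    have h1 : Antitone fun n : ℕ => B (η / (n + 2)) := fun n n' hn z hz =>
      ⟨hz.1, ball_subset_ball (by gcongr) hz.2⟩
    have h2 : ⋂ n : ℕ, B (η / (n + 2)) = ∅ := by
      refine eq_empty_of_forall_notMem fun z hz => ?_
      rw [mem_iInter] at hz
      refine hp ⟨z, (hz 0).1, ?_⟩
      by_contra hne
      obtain ⟨n, hn⟩ := exists_nat_gt (4 * η / dist (F z) p)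
      have hd := dist_pos.2 hne
      have h3 : dist (F z) p < 4 * (η / (n + 2)) := (hz n).2
      rw [div_lt_iff₀ hd] at hn
      rw [← mul_div_assoc, lt_div_iff₀ (by positivity)] at h3
      linarith
    have h3 := tendsto_measure_iInter_atTop (μ := volume) (s := fun n : ℕ => B (η / (n + 2)))
      (fun n => (hBo _).measurableSet.nullMeasurableSet) h1
      ⟨0, ne_top_of_le_ne_top hXv (measure_mono inter_subset_left)⟩
    rw [h2, measure_empty] at h3
    have h4 := ENNReal.Tendsto.const_mul h3 (.inr (ENNReal.ofReal_ne_top (r := 16 * Real.pi)))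
    rw [mul_zero] at h4
    exact h4
  have h0 : volume A ^ 2 ≤ 0 := ge_of_tendsto hlim (Eventually.of_forall fun n => hle _
    ⟨by positivity, by rw [div_lt_iff₀ (by positivity)]; nlinarith [(n.cast_nonneg : (0:ℝ) ≤ n)]⟩)
  simpa using h0

end SlitLoewner

namespace SlitLoewner

open scoped ENNReal

lemma exists_tendsto_circleMap {X : Set ℂ} (hX : IsOpen X) {F : ℂ → ℂ}
    (hF : DifferentiableOn ℂ F X) {z₀ : ℂ} {r : ℝ} (hr : 0 < r)
    (hX' : ∀ θ ∈ Ioo 0 Real.pi, circleMap z₀ r θ ∈ X) (hL : circleLength X F z₀ r ≠ ∞) {θ₀ : ℝ}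
    (hθ₀ : θ₀ ∈ Icc 0 Real.pi) :
    ∃ p, Tendsto (fun θ => F (circleMap z₀ r θ)) (𝓝[Ioo 0 Real.pi] θ₀) (𝓝 p) := by
  have : (𝓝[Ioo 0 Real.pi] θ₀).NeBot := by
    rwa [← mem_closure_iff_nhdsWithin_neBot, closure_Ioo Real.pi_pos.ne]
  rw [← cauchy_map_iff_exists_tendsto, EMetric.cauchy_iff]
  refine ⟨map_neBot.ne, fun ε hε => ?_⟩
  set φ : ℝ → ℝ≥0∞ := fun θ => X.indicator (fun z => ‖deriv F z‖ₑ) (circleMap z₀ r θ) with hφ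
  have hφm : Measurable φ := (measurable_enorm_deriv_indicator hX F).comp (by fun_prop)
  obtain ⟨δ, hδ, h⟩ := exists_pos_setLIntegral_lt_of_measure_lt
    (μ := volume.restrict (Ioo (-Real.pi) Real.pi))
    (f := fun θ => 2 * (ENNReal.ofReal r * φ θ)) (by
      rw [lintegral_const_mul _ (hφm.const_mul _), lintegral_const_mul _ hφm]
      exact ENNReal.mul_ne_top (by simp) hL) hε.ne'
  obtain ⟨d, hd0, hd⟩ := ENNReal.lt_iff_exists_nnreal_btwn.1 hδ
  rw [ENNReal.coe_pos] at hd0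
  have key : ∀ θ₁ ∈ Ioo 0 Real.pi ∩ ball θ₀ (d / 2), ∀ θ₂ ∈ Ioo 0 Real.pi ∩ ball θ₀ (d / 2),
      θ₁ ≤ θ₂ → edist (F (circleMap z₀ r θ₁)) (F (circleMap z₀ r θ₂)) < ε := by
    intro θ₁ h1 θ₂ h2 h12
    have hI : Icc θ₁ θ₂ ⊆ Ioo 0 Real.pi := fun θ hθ =>
      ⟨h1.1.1.trans_le hθ.1, hθ.2.trans_lt h2.1.2⟩
    have hI' : Icc θ₁ θ₂ ⊆ Ioo (-Real.pi) Real.pi := fun θ hθ =>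
      ⟨by linarith [(hI hθ).1, Real.pi_pos], (hI hθ).2⟩
    have h3 := h (Icc θ₁ θ₂) (by
      refine (Measure.restrict_apply_le _ _).trans_lt ?_
      rw [Real.volume_Icc]
      refine lt_of_le_of_lt ?_ hd
      rw [← ENNReal.ofReal_coe_nnreal]
      refine ENNReal.ofReal_le_ofReal ?_
      have h4 := h1.2
      have h5 := h2.2
      rw [mem_ball, Real.dist_eq, abs_lt] at h4 h5
      linarith)
    rw [Measure.restrict_restrict_of_subset hI', lintegral_const_mul _ (hφm.const_mul _),
      lintegral_const_mul _ hφm] at h3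
    exact (edist_circle_le hX hF z₀ hr.le h12 fun θ hθ => hX' θ (hI hθ)).trans_lt h3
  refine ⟨_, image_mem_map (inter_mem self_mem_nhdsWithin (mem_nhdsWithin_of_mem_nhds
    (ball_mem_nhds θ₀ (half_pos (NNReal.coe_pos.2 hd0))))), ?_⟩
  rintro _ ⟨θ₁, h1, rfl⟩ _ ⟨θ₂, h2, rfl⟩
  rcases le_total θ₁ θ₂ with h12 | h12
  · exact key θ₁ h1 θ₂ h2 h12
  · rw [edist_comm]
    exact key θ₂ h2 θ₁ h1 h12

lemma le_circleLength_of_tendsto {X : Set ℂ} (hX : IsOpen X) {F : ℂ → ℂ}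
    (hF : DifferentiableOn ℂ F X) {z₀ p : ℂ} {r : ℝ} (hr : 0 < r)
    (hX' : ∀ θ ∈ Ioo 0 Real.pi, circleMap z₀ r θ ∈ X)
    (hp : Tendsto (fun θ => F (circleMap z₀ r θ)) (𝓝[Ioo 0 Real.pi] 0) (𝓝 p)) {t : ℝ} (ht : 0 < t)
    (h : 3 * t ≤ dist (F (circleMap z₀ r (Real.pi / 2))) p) :
    ENNReal.ofReal t ≤ circleLength (X ∩ F ⁻¹' ball p (4 * t)) F z₀ r := by
  have hpi := Real.pi_pos
  set k : ℝ → ℝ := fun θ => dist (F (circleMap z₀ r θ)) p with hk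
  have hkc : ContinuousOn k (Ioo 0 Real.pi) := by
    have h1 : ContinuousOn (fun θ => F (circleMap z₀ r θ)) (Ioo 0 Real.pi) :=
      hF.continuousOn.comp (by fun_prop) hX'
    exact continuous_dist.comp_continuousOn (h1.prodMk continuousOn_const)
  have : (𝓝[Ioo 0 Real.pi] (0 : ℝ)).NeBot := by
    rw [← mem_closure_iff_nhdsWithin_neBot, closure_Ioo hpi.ne]
    exact ⟨le_rfl, hpi.le⟩
  obtain ⟨θ₁, ⟨hθ₁, hlt⟩, hk1⟩ := (((eventually_mem_nhdsWithin (a := (0 : ℝ)) (s := Ioo 0 Real.pi)).and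
    (eventually_nhdsWithin_of_eventually_nhds (Iio_mem_nhds (half_pos hpi)))).and (hp.eventually_mem (ball_mem_nhds p ht))).exists
  have hlt : θ₁ < Real.pi / 2 := hlt
  have hk1 : k θ₁ < t := hk1
  have hI : Icc θ₁ (Real.pi / 2) ⊆ Ioo 0 Real.pi := fun θ hθ =>
    ⟨hθ₁.1.trans_le hθ.1, hθ.2.trans_lt (half_lt_self hpi)⟩
  have hc := hkc.mono hI
  obtain ⟨θ₂, hθ₂, hleast⟩ : ∃ θ₂, IsLeast {θ ∈ Icc θ₁ (Real.pi / 2) | k θ = 3 * t} θ₂ := by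
    refine IsCompact.exists_isLeast ?_ ?_
    · exact isCompact_Icc.of_isClosed_subset (hc.preimage_isClosed_of_isClosed isClosed_Icc
        isClosed_singleton) inter_subset_left
    · obtain ⟨θ, hθ⟩ := intermediate_value_Icc hlt.le hc (⟨by linarith, h⟩ :
        3 * t ∈ Icc (k θ₁) (k (Real.pi / 2)))
      exact ⟨θ, hθ.1, hθ.2⟩
  have hle : ∀ θ ∈ Icc θ₁ θ₂, k θ < 4 * t := by
    intro θ hθ
    by_contra! hcon
    have hsub : Icc θ₁ θ ⊆ Icc θ₁ (Real.pi / 2) := Icc_subset_Icc_right (hθ.2.trans hθ₂.1.2)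
    obtain ⟨θ', hθ', hkθ'⟩ := intermediate_value_Icc hθ.1 (hc.mono hsub)
      (⟨by linarith, by linarith⟩ : 3 * t ∈ Icc (k θ₁) (k θ))
    have h1 := hleast ⟨hsub hθ', hkθ'⟩
    have h2 : θ = θ₂ := le_antisymm hθ.2 (h1.trans hθ'.2)
    rw [h2, hθ₂.2] at hcon
    linarith
  have hI2 : ∀ θ ∈ Icc θ₁ (Real.pi / 2), θ ∈ Ioo (-Real.pi) Real.pi := fun θ hθ =>
    ⟨by linarith [(hI hθ).1], (hI hθ).2⟩
  have h12 := edist_circle_le_circleLength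
    (hF.continuousOn.isOpen_inter_preimage hX (isOpen_ball (x := p) (ε := 4 * t)))
    (hF.mono inter_subset_left) z₀ hr.le (hI2 θ₁ ⟨le_rfl, hlt.le⟩) (hI2 θ₂ hθ₂.1) (fun θ hθ => by
      rw [uIcc_of_le hθ₂.1.1] at hθ
      exact ⟨hX' θ (hI ⟨hθ.1, hθ.2.trans hθ₂.1.2⟩), hle θ hθ⟩)
  have h3 : ENNReal.ofReal (2 * t) ≤ edist (F (circleMap z₀ r θ₁)) (F (circleMap z₀ r θ₂)) := by
    rw [edist_dist]
    refine ENNReal.ofReal_le_ofReal ?_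
    have h4 := dist_triangle_left (F (circleMap z₀ r θ₂)) p (F (circleMap z₀ r θ₁))
    have h5 := hθ₂.2
    simp only [hk] at hk1 h5
    linarith
  rw [ENNReal.ofReal_mul two_pos.le, ENNReal.ofReal_ofNat] at h3
  exact (ENNReal.mul_le_mul_iff_right two_ne_zero ENNReal.ofNat_ne_top).1 (h3.trans h12)

lemma Conf.mem_frontier_of_tendsto {S : SlitSys} {F : Set ℂ} {S' : SlitSys} {g f : ℂ → ℂ}
    (H : Conf S F S' g f) {x r θ₀ : ℝ} (hdom : ∀ θ ∈ Ioo 0 Real.pi, circleMap (x : ℂ) r θ ∈ S'.dom)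
    (hθ₀ : θ₀ ∈ Icc 0 Real.pi) (hsin : Real.sin θ₀ = 0) {p : ℂ}
    (hp : Tendsto (fun θ => f (circleMap x r θ)) (𝓝[Ioo 0 Real.pi] θ₀) (𝓝 p)) :
    p ∈ frontier (gdom S F) := by
  have : (𝓝[Ioo 0 Real.pi] θ₀).NeBot := by
    rwa [← mem_closure_iff_nhdsWithin_neBot, closure_Ioo Real.pi_pos.ne]
  rw [H.isOpen_gdom.frontier_eq]
  refine ⟨mem_closure_of_tendsto hp (eventually_nhdsWithin_of_forall fun θ hθ =>
    H.maps_f (hdom θ hθ)), fun hpG => ?_⟩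
  have h1 := ((H.holo_g.continuousOn.continuousAt (H.isOpen_gdom.mem_nhds hpG)).tendsto.comp hp)
  have h2 : Tendsto (fun θ => circleMap (x : ℂ) r θ) (𝓝[Ioo 0 Real.pi] θ₀)
      (𝓝 (circleMap x r θ₀)) :=
    ((continuous_circleMap _ _).tendsto θ₀).mono_left nhdsWithin_le_nhds
  have h3 := tendsto_nhds_unique (h1.congr' (eventually_nhdsWithin_of_forall fun θ hθ =>
    H.right_inv _ (hdom θ hθ))) h2
  have h4 := S'.im_pos (H.maps_g hpG)
  rw [h3, circleMap_im_ofReal, hsin, mul_zero] at h4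
  exact lt_irrefl _ h4

end SlitLoewner

namespace SlitLoewner

open scoped ENNReal

lemma circleMap_arg (x w : ℂ) : circleMap x (dist w x) (w - x).arg = w := by
  rw [circleMap, dist_eq_norm, norm_mul_exp_arg_mul_I, add_sub_cancel]

lemma arg_sub_mem {x : ℝ} {w : ℂ} (hw : 0 < w.im) : (w - x).arg ∈ Ioo 0 Real.pi := by
  have him : 0 < (w - x).im := by simpa using hw
  refine ⟨(arg_nonneg_iff.2 him.le).lt_of_ne fun h => ?_, (arg_le_pi _).lt_of_ne fun h => ?_⟩
  · exact him.ne' (arg_eq_zero_iff.1 h.symm).2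
  · exact him.ne' (arg_eq_pi_iff.1 h).2

namespace Conf

variable {S : SlitSys} {F : Set ℂ} {S' : SlitSys} {g f : ℂ → ℂ}

/-- The image of a polar graph around a boundary point is a separating cross-cut. -/
lemma exists_isCrossCut_of_polar (H : Conf S F S' g f) {x b ρ₂ : ℝ} (hb : 0 < b)
    (hdom : ∀ w : ℂ, 0 < w.im → dist w x ≤ ρ₂ → w ∈ S'.dom) {ρ : ℝ → ℝ} (hρ : Continuous ρ)
    (hρI : ∀ θ, ρ θ ∈ Ioo b ρ₂) {p₁ p₂ : ℂ} (hp : p₁ ≠ p₂) (h₁ : p₁ ∈ frontier (gdom S F))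
    (h₂ : p₂ ∈ frontier (gdom S F))
    (ht₁ : Tendsto (fun θ => f (circleMap x (ρ θ) θ)) (𝓝[Ioo 0 Real.pi] 0) (𝓝 p₁))
    (ht₂ : Tendsto (fun θ => f (circleMap x (ρ θ) θ)) (𝓝[Ioo 0 Real.pi] Real.pi) (𝓝 p₂)) :
    ∃ C, IsCrossCut (gdom S F) C ∧
      C ⊆ closure ((fun θ => f (circleMap x (ρ θ) θ)) '' Ioo 0 Real.pi) ∧
      ∀ A ⊆ gdom S F, g '' A ⊆ closedBall (x : ℂ) b → SeparatesFromInfty (gdom S F) C A := by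
  have hpi := Real.pi_pos
  set k : ℝ → ℂ := fun θ => circleMap x (ρ θ) θ with hk
  have hkc : Continuous k := by simp only [hk, circleMap]; fun_prop
  have hρ0 : ∀ θ, 0 < ρ θ := fun θ => hb.trans (hρI θ).1
  have hkd : ∀ θ, dist (k θ) x = ρ θ := fun θ => circleMap_mem_sphere _ (hρ0 θ).le θ
  have hkm : ∀ θ ∈ Ioo 0 Real.pi, k θ ∈ S'.dom := fun θ hθ => by
    refine hdom _ ?_ ((hkd θ).trans_le (hρI θ).2.le)
    rw [hk, circleMap_im_ofReal]
    exact mul_pos (hρ0 θ) (Real.sin_pos_of_mem_Ioo hθ)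
  set c : ℝ → ℂ := extendFrom (Ioo 0 Real.pi) fun θ => f (k θ) with hc
  have hcl : closure (Ioo 0 Real.pi) = Icc 0 Real.pi := closure_Ioo hpi.ne
  have hfk : ContinuousOn (fun θ => f (k θ)) (Ioo 0 Real.pi) :=
    H.holo_f.continuousOn.comp hkc.continuousOn hkm
  have hceq : ∀ θ ∈ Ioo 0 Real.pi, c θ = f (k θ) := extendFrom_extends hfk
  have hc0 : c 0 = p₁ := extendFrom_eq (by rw [hcl]; exact ⟨le_rfl, hpi.le⟩) ht₁
  have hcπ : c Real.pi = p₂ := extendFrom_eq (by rw [hcl]; exact ⟨hpi.le, le_rfl⟩) ht₂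
  have hcc : ContinuousOn c (Icc 0 Real.pi) := by
    refine continuousOn_extendFrom hcl.ge fun θ hθ => ?_
    rcases hθ.1.eq_or_lt with rfl | h0
    · exact ⟨p₁, ht₁⟩
    rcases hθ.2.eq_or_lt with rfl | h1
    · exact ⟨p₂, ht₂⟩
    · exact ⟨_, hfk θ ⟨h0, h1⟩⟩
  have hcG : ∀ θ ∈ Ioo 0 Real.pi, c θ ∈ gdom S F := fun θ hθ => by
    rw [hceq θ hθ]
    exact H.maps_f (hkm θ hθ)
  have hfr : ∀ z ∈ frontier (gdom S F), z ∉ gdom S F := fun z hz => by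
    rw [H.isOpen_gdom.frontier_eq] at hz
    exact hz.2
  have hinj : InjOn c (Icc 0 Real.pi) := by
    have hend : ∀ θ ∈ Icc 0 Real.pi, θ = 0 ∨ θ = Real.pi ∨ θ ∈ Ioo 0 Real.pi := fun θ hθ => by
      rcases hθ.1.eq_or_lt with h0 | h0
      · exact .inl h0.symm
      rcases hθ.2.eq_or_lt with h1 | h1
      exacts [.inr (.inl h1), .inr (.inr ⟨h0, h1⟩)]
    have hf1 := hfr _ h₁
    have hf2 := hfr _ h₂
    intro θ hθ θ' hθ' h
    rcases hend θ hθ with rfl | rfl | hI <;> rcases hend θ' hθ' with rfl | rfl | hI'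
    · rfl
    · rw [hc0, hcπ] at h
      exact absurd h hp
    · rw [hc0] at h
      exact absurd (h ▸ hcG _ hI') hf1
    · rw [hc0, hcπ] at h
      exact absurd h.symm hp
    · rfl
    · rw [hcπ] at h
      exact absurd (h ▸ hcG _ hI') hf2
    · rw [hc0] at h
      exact absurd (h ▸ hcG _ hI) hf1
    · rw [hcπ] at h
      exact absurd (h ▸ hcG _ hI) hf2
    · rw [hceq θ hI, hceq θ' hI'] at h
      have h3 := H.inj_f (hkm θ hI) (hkm θ' hI') h
      have h4 : ρ θ = ρ θ' := by rw [← hkd θ, ← hkd θ', h3]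
      have h5 := congrArg re h3
      simp only [hk] at h5
      rw [circleMap_re_ofReal, circleMap_re_ofReal, h4, add_right_inj,
        mul_right_inj' (hρ0 θ').ne'] at h5
      exact Real.injOn_cos hθ hθ' h5
  have hmulI : ∀ t ∈ Icc (0 : ℝ) 1, Real.pi * t ∈ Icc 0 Real.pi := fun t ht =>
    ⟨by have := ht.1; positivity, by nlinarith [ht.2]⟩
  have himg : (fun t => c (Real.pi * t)) '' Icc 0 1 = c '' Icc 0 Real.pi := by
    refine Subset.antisymm ?_ ?_
    · rintro _ ⟨t, ht, rfl⟩
      exact mem_image_of_mem _ (hmulI t ht)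
    · rintro _ ⟨θ, hθ, rfl⟩
      refine ⟨θ / Real.pi, ⟨by have := hθ.1; positivity, (div_le_one hpi).2 hθ.2⟩, ?_⟩
      simp only [mul_div_cancel₀ _ hpi.ne']
  refine ⟨c '' Icc 0 Real.pi, ⟨fun t => c (Real.pi * t), hcc.comp (by fun_prop) hmulI,
    hinj.comp (fun a _ b _ h => mul_left_cancel₀ hpi.ne' h) hmulI, by simpa [hc0] using h₁,
    by simpa [hcπ] using h₂, ?_, himg.symm⟩, ?_, ?_⟩
  · rintro _ ⟨t, ht, rfl⟩
    exact hcG _ ⟨mul_pos hpi ht.1, by nlinarith [ht.2]⟩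
  · rw [← hcl] at hcc ⊢
    refine hcc.image_closure.trans (closure_mono ?_)
    rintro _ ⟨θ, hθ, rfl⟩
    exact ⟨θ, hθ, (hceq θ hθ).symm⟩
  · intro A hA hgA z hz
    set h : ℂ → ℝ := fun w => dist w x - ρ (w - x).arg with hh
    have hhc : ContinuousOn h S'.dom := fun w hw => by
      refine ContinuousAt.continuousWithinAt ?_
      have h1 : ContinuousAt arg (w - x) := continuousAt_arg (mem_slitPlane_iff.2
        (.inr (by simpa using (S'.im_pos hw).ne')))
      have h2 : ContinuousAt (fun w : ℂ => (w - x).arg) w :=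
        ContinuousAt.comp (g := arg) (f := fun w : ℂ => w - x) h1 (by fun_prop)
      exact (continuous_id.dist continuous_const).continuousAt.sub
        (hρ.continuousAt.comp h2)
    set N₁ := S'.dom ∩ h ⁻¹' Iio 0 with hN₁
    set N₂ := S'.dom ∩ h ⁻¹' Ioi 0 with hN₂
    have hO₁ : IsOpen (f '' N₁) := H.isOpen_image_f
      (hhc.isOpen_inter_preimage S'.isOpen_dom isOpen_Iio) inter_subset_left
    have hO₂ : IsOpen (f '' N₂) := H.isOpen_image_f
      (hhc.isOpen_inter_preimage S'.isOpen_dom isOpen_Ioi) inter_subset_left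
    have hcover : gdom S F \ c '' Icc 0 Real.pi ⊆ f '' N₁ ∪ f '' N₂ := by
      rintro y ⟨hy, hyC⟩
      have hgy := H.maps_g hy
      have hne : h (g y) ≠ 0 := fun h0 => hyC ⟨(g y - x).arg,
        Ioo_subset_Icc_self (arg_sub_mem (S'.im_pos hgy)), by
          rw [hceq _ (arg_sub_mem (S'.im_pos hgy))]
          simp only [hk]
          rw [← sub_eq_zero.1 h0, circleMap_arg, H.left_inv y hy]⟩
      rcases hne.lt_or_gt with h0 | h0
      exacts [.inl ⟨g y, ⟨hgy, h0⟩, H.left_inv y hy⟩, .inr ⟨g y, ⟨hgy, h0⟩, H.left_inv y hy⟩]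
    have hdisj : Disjoint (f '' N₁) (f '' N₂) := by
      rw [disjoint_left]
      rintro _ ⟨w, hw, rfl⟩ ⟨w', hw', he⟩
      rw [H.inj_f hw'.1 hw.1 he] at hw'
      have h1 : h w < 0 := hw.2
      have h2 : 0 < h w := hw'.2
      exact lt_asymm h1 h2
    have hz₁ : z ∈ f '' N₁ := by
      have hzG := hz.2.1
      refine ⟨g z, ⟨H.maps_g hzG, ?_⟩, H.left_inv z hzG⟩
      have h1 := mem_closedBall.1 (hgA (mem_image_of_mem _ hz.1))
      have h2 := (hρI (g z - x).arg).1
      simp only [hh, mem_preimage, mem_Iio]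
      linarith
    have hsub : connectedComponentIn (gdom S F \ c '' Icc 0 Real.pi) z ⊆ f '' N₁ :=
      isPreconnected_connectedComponentIn.subset_left_of_subset_union hO₁ hO₂ hdisj
        ((connectedComponentIn_subset _ _).trans hcover) ⟨z, mem_connectedComponentIn hz.2, hz₁⟩
    obtain ⟨B, hB⟩ := H.exists_bound_f (|x| + ρ₂)
    refine (isBounded_closedBall (x := (0 : ℂ)) (r := B)).subset (hsub.trans ?_)
    rintro _ ⟨w, hw, rfl⟩
    rw [mem_closedBall_zero_iff]
    refine hB w hw.1 ?_
    have h1 : dist w x - ρ (w - x).arg < 0 := hw.2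
    have h2 := (hρI (w - x).arg).2
    have h3 := norm_le_norm_add_norm_sub' w x
    rw [norm_real, Real.norm_eq_abs, ← dist_eq_norm] at h3
    linarith

end Conf

end SlitLoewner

namespace SlitLoewner

open scoped ENNReal

lemma dist_circleMap_le_of_circleLength_le {X : Set ℂ} (hX : IsOpen X) {F : ℂ → ℂ}
    (hF : DifferentiableOn ℂ F X) {z₀ : ℂ} {r L : ℝ} (hr : 0 ≤ r) (hL : 0 ≤ L)
    (hX' : ∀ θ ∈ Ioo 0 Real.pi, circleMap z₀ r θ ∈ X)
    (h : circleLength X F z₀ r ≤ ENNReal.ofReal L) {θ₁ θ₂ : ℝ} (h₁ : θ₁ ∈ Ioo 0 Real.pi)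
    (h₂ : θ₂ ∈ Ioo 0 Real.pi) :
    dist (F (circleMap z₀ r θ₁)) (F (circleMap z₀ r θ₂)) ≤ 2 * L := by
  have hpi := Real.pi_pos
  have hed := (edist_circle_le_circleLength hX hF z₀ hr (θ₁ := θ₁) (θ₂ := θ₂)
    ⟨by linarith [h₁.1], h₁.2⟩ ⟨by linarith [h₂.1], h₂.2⟩ fun θ hθ =>
      hX' θ (ordConnected_Ioo.uIcc_subset h₁ h₂ hθ)).trans (mul_le_mul_right h 2)
  rw [edist_dist, ← ENNReal.ofReal_ofNat 2, ← ENNReal.ofReal_mul (by norm_num)] at hed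
  exact (ENNReal.ofReal_le_ofReal_iff (by positivity)).1 hed

namespace Conf

variable {S : SlitSys} {F : Set ℂ} {S' : SlitSys} {g f : ℂ → ℂ}

lemma volume_setOf_tendsto_eq_zero (H : Conf S F S' g f) {x b ρ₂ : ℝ} (hb : 0 < b)
    (hdom : ∀ w : ℂ, 0 < w.im → dist w x ≤ ρ₂ → w ∈ S'.dom) {p : ℂ}
    (hp : p ∈ frontier (gdom S F)) :
    volume {r ∈ Ioo b ρ₂ | Tendsto (fun θ => f (circleMap x r θ)) (𝓝[Ioo 0 Real.pi] 0) (𝓝 p)}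
      = 0 := by
  have hpi := Real.pi_pos
  rcases le_or_gt ρ₂ b with hbρ | hbρ
  · simp [Ioo_eq_empty_of_le hbρ]
  have hcirc : ∀ r ∈ Icc b ρ₂, ∀ θ ∈ Ioo 0 Real.pi, circleMap (x : ℂ) r θ ∈ S'.dom :=
    fun r hr θ hθ => hdom _ (by
      rw [circleMap_im_ofReal]
      exact mul_pos (hb.trans_le hr.1) (Real.sin_pos_of_mem_Ioo hθ))
      ((circleMap_mem_sphere (x : ℂ) (hb.le.trans hr.1) θ).trans_le hr.2)
  have hp' : p ∉ gdom S F := by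
    rw [H.isOpen_gdom.frontier_eq] at hp
    exact hp.2
  have hmid : Real.pi / 2 ∈ Ioo 0 Real.pi := ⟨by linarith, by linarith⟩
  obtain ⟨r₀, hr₀, hmin⟩ := (isCompact_Icc (a := b) (b := ρ₂)).exists_isMinOn
    (nonempty_Icc.2 hbρ.le) (f := fun r => dist (f (circleMap x r (Real.pi / 2))) p)
    (continuous_dist.comp_continuousOn (ContinuousOn.prodMk (H.holo_f.continuousOn.comp
      (Continuous.continuousOn (by simp only [circleMap]; fun_prop))
      fun r hr => hcirc r hr _ hmid) continuousOn_const))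
  have hη : 0 < dist (f (circleMap x r₀ (Real.pi / 2))) p :=
    dist_pos.2 fun h => hp' (h ▸ H.maps_f (hcirc r₀ hr₀ _ hmid))
  have hXo : IsOpen (S'.dom ∩ ball (x : ℂ) ρ₂) := S'.isOpen_dom.inter isOpen_ball
  refine volume_eq_zero_of_le_circleLength (X := S'.dom ∩ ball (x : ℂ) ρ₂) hXo
    ((measure_mono inter_subset_right).trans_lt measure_ball_lt_top).ne
    (H.holo_f.mono inter_subset_left) (H.inj_f.mono inter_subset_left) (p := p) ?_ (x : ℂ)
    (fun r hr => hb.trans hr.1.1) (η := dist (f (circleMap x r₀ (Real.pi / 2))) p / 3)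
    (by positivity) fun r hr t ht => ?_
  · rintro ⟨w, hw, rfl⟩
    exact hp' (H.maps_f hw.1)
  · refine le_circleLength_of_tendsto hXo (H.holo_f.mono inter_subset_left) (hb.trans hr.1.1)
      (fun θ hθ => ⟨hcirc r (Ioo_subset_Icc_self hr.1) θ hθ, ?_⟩) hr.2 ht.1 ?_
    · exact (circleMap_mem_sphere (x : ℂ) (hb.trans hr.1.1).le θ).trans_lt hr.1.2
    · have := isMinOn_iff.1 hmin r (Ioo_subset_Icc_self hr.1)
      linarith [ht.2]

lemma exists_isCrossCut_diam_le (H : Conf S F S' g f) {x b ρ₂ L : ℝ} (hb : 0 < b)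
    (hdom : ∀ w : ℂ, 0 < w.im → dist w x ≤ ρ₂ → w ∈ S'.dom) (hL : 0 < L)
    (hP : 0 < volume {r ∈ Ioo b ρ₂ | circleLength S'.dom f x r ≤ ENNReal.ofReal L}) :
    ∃ C, IsCrossCut (gdom S F) C ∧ diam C ≤ 6 * L ∧
      ∀ A ⊆ gdom S F, g '' A ⊆ closedBall (x : ℂ) b → SeparatesFromInfty (gdom S F) C A := by
  have hpi := Real.pi_pos
  set P := {r ∈ Ioo b ρ₂ | circleLength S'.dom f x r ≤ ENNReal.ofReal L} with hPdef
  have hcirc : ∀ r ∈ Icc b ρ₂, ∀ θ ∈ Ioo 0 Real.pi, circleMap (x : ℂ) r θ ∈ S'.dom :=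
    fun r hr θ hθ => hdom _ (by
      rw [circleMap_im_ofReal]
      exact mul_pos (hb.trans_le hr.1) (Real.sin_pos_of_mem_Ioo hθ))
      ((circleMap_mem_sphere (x : ℂ) (hb.le.trans hr.1) θ).trans_le hr.2)
  have hlim : ∀ r ∈ P, ∀ θ₀ ∈ Icc 0 Real.pi, Real.sin θ₀ = 0 → ∃ p ∈ frontier (gdom S F),
      Tendsto (fun θ => f (circleMap x r θ)) (𝓝[Ioo 0 Real.pi] θ₀) (𝓝 p) := by
    intro r hr θ₀ hθ₀ hsin
    have hc := hcirc r (Ioo_subset_Icc_self hr.1)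
    obtain ⟨p, hp⟩ := exists_tendsto_circleMap S'.isOpen_dom H.holo_f (hb.trans hr.1.1) hc
      (hr.2.trans_lt ENNReal.ofReal_lt_top).ne hθ₀
    exact ⟨p, H.mem_frontier_of_tendsto hc hθ₀ hsin hp, hp⟩
  obtain ⟨r₁, hr₁, hpos⟩ := exists_mem_forall_mem_nhdsWithin_pos_measure hP.ne'
  obtain ⟨p₂, hp₂, ht₂⟩ := hlim r₁ hr₁ Real.pi ⟨hpi.le, le_rfl⟩ Real.sin_pi
  have hmid : Icc (Real.pi / 3) (2 * Real.pi / 3) ⊆ Ioo 0 Real.pi :=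
    fun θ hθ => ⟨by linarith [hθ.1], by linarith [hθ.2]⟩
  obtain ⟨κ, hκ, huc⟩ := Metric.uniformContinuousOn_iff.1
    ((isCompact_Icc (a := b) (b := ρ₂)).prod
      (isCompact_Icc (a := Real.pi / 3) (b := 2 * Real.pi / 3))
      |>.uniformContinuousOn_of_continuous
        (f := fun q : ℝ × ℝ => f (circleMap x q.1 q.2)) (H.holo_f.continuousOn.comp
          (Continuous.continuousOn (by simp only [circleMap]; fun_prop))
          fun q hq => hcirc _ hq.1 _ (hmid hq.2))) L hL
  have hclose : ∀ r ∈ Icc b ρ₂, dist r r₁ < κ → ∀ θ ∈ Icc (Real.pi / 3) (2 * Real.pi / 3),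
      dist (f (circleMap x r θ)) (f (circleMap x r₁ θ)) ≤ L := fun r hr hd θ hθ =>
    (huc (r, θ) ⟨hr, hθ⟩ (r₁, θ) ⟨Ioo_subset_Icc_self hr₁.1, hθ⟩ (by
      rw [Prod.dist_eq, dist_self]; exact max_lt hd hκ)).le
  obtain ⟨r₂, ⟨hr₂, hr₂κ⟩, hr₂n⟩ : ((P ∩ ball r₁ κ) \ {r ∈ Ioo b ρ₂ |
      Tendsto (fun θ => f (circleMap x r θ)) (𝓝[Ioo 0 Real.pi] 0) (𝓝 p₂)}).Nonempty := by
    refine nonempty_of_measure_ne_zero (μ := volume) ?_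
    rw [measure_sdiff_null (H.volume_setOf_tendsto_eq_zero hb hdom hp₂)]
    exact (hpos _ (inter_mem self_mem_nhdsWithin (mem_nhdsWithin_of_mem_nhds
      (ball_mem_nhds r₁ hκ)))).ne'
  obtain ⟨p₁, hp₁, ht₁⟩ := hlim r₂ hr₂ 0 ⟨le_rfl, hpi.le⟩ Real.sin_zero
  have hne : p₁ ≠ p₂ := by
    rintro rfl
    exact hr₂n ⟨hr₂.1, ht₁⟩
  set ρ : ℝ → ℝ := fun θ => r₂ + max 0 (min 1 (3 * θ / Real.pi - 1)) * (r₁ - r₂) with hρ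
  have hρu : ∀ θ, ρ θ ∈ uIcc r₂ r₁ := fun θ => by
    have : ρ θ = AffineMap.lineMap r₂ r₁ (max 0 (min 1 (3 * θ / Real.pi - 1))) := by
      simp only [hρ, AffineMap.lineMap_apply, vsub_eq_sub, vadd_eq_add, smul_eq_mul]
      ring
    rw [this, ← segment_eq_uIcc, segment_eq_image_lineMap]
    exact mem_image_of_mem _ ⟨le_max_left _ _, max_le zero_le_one (min_le_left _ _)⟩
  have hρI : ∀ θ, ρ θ ∈ Ioo b ρ₂ := fun θ => ordConnected_Ioo.uIcc_subset hr₂.1 hr₁.1 (hρu θ)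
  have hρ₂ : ∀ θ ≤ Real.pi / 3, ρ θ = r₂ := fun θ hθ => by
    have : 3 * θ / Real.pi - 1 ≤ 0 := by
      rw [sub_nonpos, div_le_one hpi]; linarith
    simp only [hρ]
    rw [max_eq_left (min_le_of_right_le this), zero_mul, add_zero]
  have hρ₁ : ∀ θ, 2 * Real.pi / 3 ≤ θ → ρ θ = r₁ := fun θ hθ => by
    have : 1 ≤ 3 * θ / Real.pi - 1 := by
      rw [le_sub_iff_add_le, le_div_iff₀ hpi]; linarith
    simp only [hρ]
    rw [min_eq_left this, max_eq_right zero_le_one, one_mul, add_sub_cancel]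
  obtain ⟨C, hC, hCs, hsep⟩ := H.exists_isCrossCut_of_polar hb hdom (ρ := ρ)
    (by fun_prop) hρI hne hp₁ hp₂
    (ht₁.congr' (by
      filter_upwards [mem_nhdsWithin_of_mem_nhds (Iio_mem_nhds (show 0 < Real.pi / 3 by positivity))]
        with θ hθ
      rw [hρ₂ θ (le_of_lt hθ)]))
    (ht₂.congr' (by
      filter_upwards [mem_nhdsWithin_of_mem_nhds (Ioi_mem_nhds
        (show 2 * Real.pi / 3 < Real.pi by linarith))] with θ hθ
      rw [hρ₁ θ (le_of_lt hθ)]))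
  have harc : ∀ r ∈ P, ∀ θ ∈ Ioo 0 Real.pi,
      dist (f (circleMap x r θ)) (f (circleMap x r (Real.pi / 2))) ≤ 2 * L := fun r hr θ hθ =>
    dist_circleMap_le_of_circleLength_le S'.isOpen_dom H.holo_f (hb.trans hr.1.1).le hL.le
      (hcirc r (Ioo_subset_Icc_self hr.1)) hr.2 hθ ⟨by linarith, by linarith⟩
  have hpt : ∀ θ ∈ Ioo 0 Real.pi,
      dist (f (circleMap x (ρ θ) θ)) (f (circleMap x r₁ (Real.pi / 2))) ≤ 3 * L := by
    intro θ hθ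
    rcases le_total θ (Real.pi / 3) with h | h
    · rw [hρ₂ θ h]
      have h1 := harc r₂ hr₂ θ hθ
      have h2 := hclose r₂ (Ioo_subset_Icc_self hr₂.1) hr₂κ (Real.pi / 2)
        ⟨by linarith, by linarith⟩
      linarith [dist_triangle (f (circleMap x r₂ θ)) (f (circleMap x r₂ (Real.pi / 2)))
        (f (circleMap x r₁ (Real.pi / 2)))]
    rcases le_total (2 * Real.pi / 3) θ with h' | h'
    · rw [hρ₁ θ h']
      linarith [harc r₁ hr₁ θ hθ]
    · have hd : dist (ρ θ) r₁ < κ := (Real.dist_right_le_of_mem_uIcc (hρu θ)).trans_lt hr₂κ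
      linarith [hclose (ρ θ) (Ioo_subset_Icc_self (hρI θ)) hd θ ⟨h, h'⟩, harc r₁ hr₁ θ hθ,
        dist_triangle (f (circleMap x (ρ θ) θ)) (f (circleMap x r₁ θ))
        (f (circleMap x r₁ (Real.pi / 2)))]
  refine ⟨C, hC, (diam_le_of_subset_closedBall (by positivity) (hCs.trans
    (closure_minimal ?_ (isClosed_closedBall (x := f (circleMap x r₁ (Real.pi / 2)))
      (ε := 3 * L))))).trans (by linarith), hsep⟩
  rintro _ ⟨θ, hθ, rfl⟩
  exact hpt θ hθ

end Conf

namespace Chain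

variable {S : SlitSys} {T : ℝ} {F : ℝ → Set ℂ} {S' : ℝ → SlitSys} {g f : ℝ → ℂ → ℂ}
  {R m e : ℝ}

theorem localGrowth_of_driving (C : Chain S T F S' g f R m e) {ξ : ℝ → ℝ}
    (hξc : ContinuousOn ξ (Icc 0 T)) (hξ : ∀ t ∈ Ico 0 T, tip T F g t = {(ξ t : ℂ)})
    (hcar : ∀ t₀ ∈ Ioc 0 T, CaratheodoryLeftContinuousAt S.dom F T t₀) :
    LocalGrowth T S.dom F := by
  intro ε hε
  obtain ⟨b, hb, hpos⟩ := exists_forall_volume_circleLength_pos C.R_pos.le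
    (show 0 < ε / 7 by positivity) (half_pos C.m_pos)
  obtain ⟨δ, hδ, hsub⟩ := C.exists_forall_image_subset hξc hξ hcar hb.1
  refine ⟨δ, hδ, fun t ht => ?_⟩
  have ht₁ : t ∈ Icc 0 T := ⟨ht.1, by linarith [ht.2, hδ.1]⟩
  have ht₂ : t + δ ∈ Icc 0 T := ⟨by linarith [ht.1, hδ.1], by linarith [ht.2]⟩
  have H := C.conf t ht₁
  have hdom : ∀ w : ℂ, 0 < w.im → dist w (ξ t) ≤ m / 2 → w ∈ (S' t).dom := fun w hw hd => by
    have h1 := (abs_im_le_norm (w - ξ t)).trans_eq (dist_eq_norm w (ξ t : ℂ)).symm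
    rw [sub_im, ofReal_im, sub_zero] at h1
    exact C.mem_dom_of_im_lt ht₁ hw (.inl (by linarith [le_abs_self w.im, C.m_pos]))
  obtain ⟨K, hK, hd, hs⟩ := H.exists_isCrossCut_diam_le (x := ξ t) hb.1
    hdom (by positivity)
    (hpos (S' t).dom (f t) (ξ t) (S' t).isOpen_dom H.holo_f H.inj_f fun w hw => by
      have := C.near t ht₁ _ (H.maps_f hw)
      rwa [H.right_inv w hw, norm_sub_rev] at this)
  rw [dom_diff]
  exact ⟨K, hK, hd.trans_lt (by linarith), hs _
    (fun z hz => C.mem_gdom_of_mem ht₂ hz.1 hz.2) (hsub t ht)⟩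

end Chain

end SlitLoewner

namespace SlitLoewner

lemma exists_slitSys {N : ℕ} {Cs : Fin N → Set ℂ} (hslit : ∀ j, IsHorizontalSlit (Cs j))
    (hdisj : Pairwise fun i j => Disjoint (Cs i) (Cs j)) :
    ∃ S : SlitSys, S.set = ⋃ j, Cs j := by
  choose y xl xr hy hx hC using hslit
  have hCs : ∀ j, slit (xl j) (xr j) (y j) = Cs j := fun j => by
    rw [hC j]
    ext z
    simp only [slit, mem_ofPred_eq, mem_Icc]
  refine ⟨⟨N, xl, xr, y, hy, hx, fun i j hij => ?_⟩, ?_⟩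
  · simpa only [hCs] using hdisj hij
  · exact iUnion_congr hCs

lemma _root_.IsParallelSlitHalfPlane.exists_dom_eq {D : Set ℂ} (h : IsParallelSlitHalfPlane D) :
    ∃ S : SlitSys, S.dom = D := by
  obtain ⟨N, Cs, hslit, hdisj, rfl⟩ := h
  obtain ⟨S, hS⟩ := exists_slitSys hslit hdisj
  exact ⟨S, by rw [← hS]; rfl⟩

lemma conf_invFunOn {S S' : SlitSys} {F : Set ℂ} {g : ℂ → ℂ} (hF : IsHHull F)
    (hb : IsBounded F) (hs : Disjoint (closure F) S.set) (hg : DifferentiableOn ℂ g (S.dom \ F))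
    (hbij : BijOn g (S.dom \ F) S'.dom)
    (hn : Tendsto (fun z => g z - z) (cobounded ℂ ⊓ 𝓟 (S.dom \ F)) (𝓝 0)) :
    Conf S F S' g (Function.invFunOn g (S.dom \ F)) := by
  have hf : MapsTo (Function.invFunOn g (S.dom \ F)) S'.dom (S.dom \ F) :=
    hbij.surjOn.mapsTo_invFunOn
  have hr : ∀ w ∈ S'.dom, g (Function.invFunOn g (S.dom \ F) w) = w :=
    fun w hw => Function.invFunOn_eq (hbij.surjOn hw)
  have hl : ∀ z ∈ S.dom \ F, Function.invFunOn g (S.dom \ F) (g z) = z :=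
    fun z hz => hbij.injOn.leftInvOn_invFunOn hz
  have ho : IsOpen (S.dom \ F) := by
    rw [dom_diff]
    exact hF.isOpen_compl.sdiff S.isCompact_set.isClosed
  have hfd := differentiableOn_inverse ho S'.isOpen_dom hg hf hl hr
  rw [dom_diff] at *
  exact ⟨hF, hb, hs, hg, hfd, hbij.mapsTo, hf, hl, hr, hn⟩

end SlitLoewner

/-- the local growth property (P.1) is equivalent to (P.3):
existence of a continuous driving function together with left continuity in
Carathéodory's sense. -/
theorem statement19 {T : ℝ} (hT : 0 < T)
    {N : ℕ} {Cs : Fin N → Set ℂ}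
    (hslit : ∀ j, IsHorizontalSlit (Cs j))
    (hdisj : Pairwise fun i j => Disjoint (Cs i) (Cs j))
    {D : Set ℂ} (hD : D = UHP \ ⋃ j, Cs j)
    {F : ℝ → Set ℂ}
    (hhull : ∀ t ∈ Set.Icc 0 T, IsHHull (F t))
    (hbdd : ∀ t ∈ Set.Icc 0 T, Bornology.IsBounded (F t))
    (hmono : ∀ s ∈ Set.Icc 0 T, ∀ t ∈ Set.Icc 0 T, s < t →
      F s ⊆ F t ∧ F s ≠ F t)
    (hFD : ∀ t ∈ Set.Icc 0 T, F t ⊆ D)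
    (hFs : Disjoint (closure (F T)) (⋃ j, Cs j))
    {Dt : ℝ → Set ℂ} (hDt : ∀ t ∈ Set.Icc 0 T, IsParallelSlitHalfPlane (Dt t))
    {g : ℝ → ℂ → ℂ}
    (hgd : ∀ t ∈ Set.Icc 0 T, DifferentiableOn ℂ (g t) (D \ F t))
    (hgb : ∀ t ∈ Set.Icc 0 T, Set.BijOn (g t) (D \ F t) (Dt t))
    (hgn : ∀ t ∈ Set.Icc 0 T,
      Tendsto (fun z => g t z - z) (cobounded ℂ ⊓ 𝓟 (D \ F t)) (𝓝 0))
    {ell : ℝ → ℝ}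
    (hres : ∀ t ∈ Set.Icc 0 T, ∀ θ : ℝ, 0 < θ → θ < Real.pi / 2 →
      Tendsto (fun z => z * (g t z - z)) (cobounded ℂ ⊓ 𝓟 (Sector θ))
        (𝓝 ((ell t : ℂ)))) :
    LocalGrowth T D F ↔
      ∃ ξ : ℝ → ℝ, ContinuousOn ξ (Set.Icc 0 T) ∧
        (∀ t ∈ Set.Ico 0 T,
          (⋂ δ ∈ Set.Ioc 0 (T - t), closure (g t '' (F (t + δ) \ F t)))
            = {((ξ t : ℂ))}) ∧
        (∀ t₀ ∈ Set.Ioc 0 T, CaratheodoryLeftContinuousAt D F T t₀) := by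
  obtain ⟨S, hS⟩ := SlitLoewner.exists_slitSys hslit hdisj
  have hDS : D = S.dom := by rw [hD, ← hS]; rfl
  subst hDS
  have : Nonempty SlitLoewner.SlitSys := ⟨S⟩
  choose! S' hS' using fun t ht => (hDt t ht).exists_dom_eq
  have hT' : T ∈ Icc 0 T := ⟨hT.le, le_rfl⟩
  have hmono' : ∀ t ∈ Icc 0 T, F t ⊆ F T := fun t ht => by
    rcases ht.2.eq_or_lt with rfl | h
    exacts [subset_rfl, (hmono t ht T hT' h).1]
  have hc : ∀ t ∈ Icc 0 T,
      SlitLoewner.Conf S (F t) (S' t) (g t) (Function.invFunOn (g t) (S.dom \ F t)) :=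
    fun t ht => SlitLoewner.conf_invFunOn (hhull t ht) (hbdd t ht)
      (by rw [hS]; exact hFs.mono_left (closure_mono (hmono' t ht)))
      (hgd t ht) (by rw [hS' t ht]; exact hgb t ht) (hgn t ht)
  obtain ⟨R, m, e, C⟩ := SlitLoewner.exists_chain hT hc hmono
  refine ⟨fun h => C.exists_driving_of_localGrowth h, ?_⟩
  rintro ⟨ξ, hξc, hξ, hcar⟩
  exact C.localGrowth_of_driving hξc hξ hcar
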